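/- Under the Setup, there exists α > 0 such that, for every m with 1 ≤ m ≤ M+2, the Nevanlinna characteristics satisfy T(r, f^{(m+1)}/f^{(m)}) + T(r, g^{(m+1)}/g^{(m)}) < α·r for all sufficiently large r. -/

import Mathlib

open Complex Filter Topology MeasureTheory
open scoped Classical

noncomputable section

/-- `mtilde f` is the function `z ↦ conj (f (conj z))`, denoted `f̃` in the paper. -/
def mtilde (f : ℂ → ℂ) : ℂ → ℂ := fun z => (starRingEnd ℂ) (f ((starRingEnd ℂ) z))

/-- Equality of meromorphic functions: near every point of `ℂ`, the two functions agree on a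
punctured neighbourhood (so the set where they disagree is closed and discrete). -/
def MeroEq (h₁ h₂ : ℂ → ℂ) : Prop := ∀ z : ℂ, ∀ᶠ w in 𝓝[≠] z, h₁ w = h₂ w

/-- `f` is strictly non-real: `f̃` is not a constant multiple of `f`. -/
def StrictlyNonReal (f : ℂ → ℂ) : Prop := ¬ ∃ c : ℂ, MeroEq (mtilde f) (fun z => c * f z)

/-- A rational function, as a meromorphic function on `ℂ`. -/
def IsRatFn (h : ℂ → ℂ) : Prop :=
  ∃ p q : Polynomial ℂ, q ≠ 0 ∧ MeroEq h (fun z => p.eval z / q.eval z)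

/-- The order of vanishing (negative at a pole) of a function at a point, when the function is
meromorphic there; junk value `0` otherwise. -/
def meroOrder (h : ℂ → ℂ) (z : ℂ) : WithTop ℤ :=
  if hh : MeromorphicAt h z then meromorphicOrderAt h z else 0

/-- The positive part of the logarithm. -/
def logPlus (x : ℝ) : ℝ := max (Real.log x) 0

/-- The Nevanlinna proximity function `m(r, h)`. -/
def proximity (h : ℂ → ℂ) (r : ℝ) : ℝ :=
  (2 * Real.pi)⁻¹ * ∫ θ in (0:ℝ)..(2 * Real.pi),
    logPlus ‖h ((r : ℂ) * Complex.exp (θ * Complex.I))‖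

/-- The multiplicity of a pole of `h` at `z` (0 if not a pole). -/
def poleMult (h : ℂ → ℂ) (z : ℂ) : ℕ := (-((meroOrder h z).untopD 0)).toNat

/-- The number of poles, counted with multiplicity, in the closed disc of radius `t`. -/
def poleCount (h : ℂ → ℂ) (t : ℝ) : ℝ := ∑ᶠ z ∈ Metric.closedBall (0:ℂ) t, (poleMult h z : ℝ)

/-- The integrated counting function `N(r, h)` of the poles of `h` (with multiplicity). -/
def NCount (h : ℂ → ℂ) (r : ℝ) : ℝ := ∫ t in (1:ℝ)..r, poleCount h t / t

/-- The Nevanlinna characteristic `T(r, h) = m(r, h) + N(r, h)`. -/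
def TChar (h : ℂ → ℂ) (r : ℝ) : ℝ := proximity h r + NCount h r

/-- The number of points of `S` in the closed disc of radius `t`. -/
def distinctCount (S : Set ℂ) (t : ℝ) : ℝ := (S ∩ Metric.closedBall (0:ℂ) t).ncard

/-- The integrated counting function `N̄(r, h)` of the distinct poles of `h`. -/
def NbarPoles (h : ℂ → ℂ) (r : ℝ) : ℝ :=
  ∫ t in (1:ℝ)..r, distinctCount {z | meroOrder h z < 0} t / t

/-- The integrated counting function `N̄(r, 1/h)` of the distinct zeros of `h`. -/
def NbarZeros (h : ℂ → ℂ) (r : ℝ) : ℝ :=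
  ∫ t in (1:ℝ)..r, distinctCount {z | 0 < meroOrder h z} t / t

/-- `h` has finite (Nevanlinna) order: `T(r, h) ≤ r ^ C` for all large `r`. -/
def FiniteOrder (h : ℂ → ℂ) : Prop := ∃ C : ℝ, ∀ᶠ r in atTop, TChar h r ≤ r ^ C

/-- `h` has finite lower order: `T(r, h) ≤ r ^ C` for arbitrarily large `r`. -/
def FiniteLowerOrder (h : ℂ → ℂ) : Prop := ∃ C : ℝ, ∃ᶠ r in atTop, TChar h r ≤ r ^ C

/-- The Setup of Section 3 of the paper: `M ≥ 4` and `f` is a strictly non-real meromorphic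
function in the plane such that `f, f', …, f^(M+3)` all have finitely many non-real zeros. -/
def Setup (M : ℕ) (f : ℂ → ℂ) : Prop :=
  4 ≤ M ∧ (∀ z, MeromorphicAt f z) ∧ StrictlyNonReal f ∧
    ∀ m, m ≤ M + 3 → {z : ℂ | 0 < meroOrder (iteratedDeriv m f) z ∧ z.im ≠ 0}.Finite

/-- The function `F_m(z) = z - f^(m)(z) / f^(m+1)(z)`. -/
def Fm (f : ℂ → ℂ) (m : ℕ) : ℂ → ℂ :=
  fun z => z - iteratedDeriv m f z / iteratedDeriv (m + 1) f z

/-- `Km` is the meromorphic function with finitely many zeros and poles satisfying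
`F_m' = K_m G_m'`, where `G_m` is the analogue of `F_m` for `g = f̃`. -/
def IsKm (f : ℂ → ℂ) (m : ℕ) (Km : ℂ → ℂ) : Prop :=
  (∀ z, MeromorphicAt Km z) ∧ {z | 0 < meroOrder Km z}.Finite ∧
    {z | meroOrder Km z < 0}.Finite ∧
    MeroEq (deriv (Fm f m)) (fun z => Km z * deriv (Fm (mtilde f) m) z)

end



open Complex Filter Topology MeasureTheory
open scoped Classical

noncomputable section

/-! ## The field of meromorphic functions -/

/-- meromorphic germs along the codiscrete filter -/
def merSub : Subring ((codiscrete ℂ).Germ ℂ) where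
  carrier := {φ | ∃ f : ℂ → ℂ, (∀ z, MeromorphicAt f z) ∧ (f : (codiscrete ℂ).Germ ℂ) = φ}
  mul_mem' := by
    rintro _ _ ⟨f, hf, rfl⟩ ⟨g, hg, rfl⟩
    exact ⟨f * g, fun z => (hf z).mul (hg z), rfl⟩
  one_mem' := ⟨1, fun z => MeromorphicAt.const 1 z, rfl⟩
  add_mem' := by
    rintro _ _ ⟨f, hf, rfl⟩ ⟨g, hg, rfl⟩
    exact ⟨f + g, fun z => (hf z).add (hg z), rfl⟩
  zero_mem' := ⟨0, fun z => MeromorphicAt.const 0 z, rfl⟩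
  neg_mem' := by
    rintro _ ⟨f, hf, rfl⟩
    exact ⟨-f, fun z => (hf z).neg, rfl⟩

/-- The field of meromorphic functions on the plane. -/
def Mer : Type := ↥merSub

namespace Mer

instance : CommRing Mer := inferInstanceAs (CommRing ↥merSub)

/-- class of a meromorphic function -/
def mk (f : ℂ → ℂ) (hf : ∀ z, MeromorphicAt f z) : Mer :=
  ⟨(f : (codiscrete ℂ).Germ ℂ), f, hf, rfl⟩

/-- a representative -/
def rep (h : Mer) : ℂ → ℂ := Classical.choose h.2

lemma rep_mero (h : Mer) (z : ℂ) : MeromorphicAt h.rep z := (Classical.choose_spec h.2).1 z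

lemma mk_rep (h : Mer) : mk h.rep h.rep_mero = h := Subtype.ext (Classical.choose_spec h.2).2

lemma ev_codiscrete {p : ℂ → Prop} :
    (∀ᶠ z in codiscrete ℂ, p z) ↔ ∀ z : ℂ, ∀ᶠ w in 𝓝[≠] z, p w := by
  rw [Filter.Eventually, mem_codiscrete]
  refine forall_congr' fun z => ?_
  rw [Filter.disjoint_principal_right, compl_compl]
  rfl

lemma mk_eq {f g : ℂ → ℂ} {hf : ∀ z, MeromorphicAt f z} {hg : ∀ z, MeromorphicAt g z} :
    mk f hf = mk g hg ↔ ∀ z : ℂ, f =ᶠ[𝓝[≠] z] g := by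
  refine Iff.trans ?_ (ev_codiscrete (p := fun w => f w = g w))
  constructor
  · intro h
    exact Germ.coe_eq.1 (congrArg Subtype.val h)
  · intro h
    exact Subtype.ext (Germ.coe_eq.2 h)

lemma rep_mk (f : ℂ → ℂ) (hf : ∀ z, MeromorphicAt f z) (z : ℂ) : (mk f hf).rep =ᶠ[𝓝[≠] z] f :=
  mk_eq.1 (mk_rep (mk f hf)) z

lemma mk_ind {p : Mer → Prop} (H : ∀ f hf, p (mk f hf)) (h : Mer) : p h := by
  rw [← mk_rep h]; exact H _ _

lemma mk_mul {f g : ℂ → ℂ} (hf : ∀ z, MeromorphicAt f z) (hg : ∀ z, MeromorphicAt g z) :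
    mk f hf * mk g hg = mk (f * g) (fun z => (hf z).mul (hg z)) := rfl
lemma mk_add {f g : ℂ → ℂ} (hf : ∀ z, MeromorphicAt f z) (hg : ∀ z, MeromorphicAt g z) :
    mk f hf + mk g hg = mk (f + g) (fun z => (hf z).add (hg z)) := rfl
lemma mk_sub {f g : ℂ → ℂ} (hf : ∀ z, MeromorphicAt f z) (hg : ∀ z, MeromorphicAt g z) :
    mk f hf - mk g hg = mk (f - g) (fun z => (hf z).sub (hg z)) := rfl
lemma mk_neg {f : ℂ → ℂ} (hf : ∀ z, MeromorphicAt f z) :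
    - mk f hf = mk (-f) (fun z => (hf z).neg) := rfl
lemma mk_zero : (0 : Mer) = mk (fun _ => 0) (fun z => MeromorphicAt.const 0 z) := rfl
lemma mk_one : (1 : Mer) = mk (fun _ => 1) (fun z => MeromorphicAt.const 1 z) := rfl

instance : Inv Mer := ⟨fun h => mk (h.rep)⁻¹ (fun z => (h.rep_mero z).inv)⟩

lemma mk_inv {f : ℂ → ℂ} (hf : ∀ z, MeromorphicAt f z) :
    (mk f hf)⁻¹ = mk (f⁻¹) (fun z => (hf z).inv) := by
  refine mk_eq.2 fun z => ?_
  filter_upwards [rep_mk f hf z] with w hw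
  simp [hw]

/-- order at a point -/
def ord (z : ℂ) (h : Mer) : WithTop ℤ := meromorphicOrderAt h.rep z

lemma ord_mk {f : ℂ → ℂ} (hf : ∀ z, MeromorphicAt f z) (z : ℂ) :
    ord z (mk f hf) = meromorphicOrderAt f z := meromorphicOrderAt_congr (rep_mk f hf z)

lemma ord_top_imp {h : Mer} {z : ℂ} (hz : ord z h = ⊤) : h = 0 := by
  by_contra hne
  rw [← mk_rep h, mk_zero, mk_eq] at hne
  push Not at hne
  obtain ⟨w, hw⟩ := hne
  have h1 : meromorphicOrderAt h.rep w ≠ ⊤ := by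
    intro h2
    exact hw (meromorphicOrderAt_eq_top_iff.1 h2)
  have := MeromorphicOn.meromorphicOrderAt_ne_top_of_isPreconnected (f := h.rep) (U := Set.univ)
    (fun z _ => h.rep_mero z) (y := z) isPreconnected_univ (Set.mem_univ w) (Set.mem_univ z) h1
  exact this hz

lemma ord_zero (z : ℂ) : ord z 0 = ⊤ := by
  rw [mk_zero, ord_mk, meromorphicOrderAt_eq_top_iff]
  simp

lemma ord_eq_top {h : Mer} {z : ℂ} : ord z h = ⊤ ↔ h = 0 :=
  ⟨ord_top_imp, fun h => h ▸ ord_zero z⟩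

lemma zero_ne_one' : (0 : Mer) ≠ 1 := by
  intro h
  rw [mk_zero, mk_one, mk_eq] at h
  have := (h 0).exists
  simp at this

instance : Field Mer where
  __ := (inferInstance : CommRing Mer)
  inv h := h⁻¹
  exists_pair_ne := ⟨0, 1, zero_ne_one'⟩
  mul_inv_cancel h hne := by
    have key : ∀ z, ∀ᶠ w in 𝓝[≠] z, h.rep w ≠ 0 := fun z =>
      (meromorphicOrderAt_ne_top_iff_eventually_ne_zero (h.rep_mero z)).1
        (fun h1 => hne (ord_top_imp h1))
    conv_lhs => rw [← mk_rep h]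
    rw [mk_inv, mk_mul, mk_one]
    refine mk_eq.2 fun z => ?_
    filter_upwards [key z] with w hw
    simp [hw]
  inv_zero := by
    rw [mk_zero, mk_inv]
    refine mk_eq.2 fun z => ?_
    filter_upwards with w
    simp
  nnqsmul := _
  nnqsmul_def _ _ := rfl
  qsmul := _
  qsmul_def _ _ := rfl

lemma mk_div {f g : ℂ → ℂ} (hf : ∀ z, MeromorphicAt f z) (hg : ∀ z, MeromorphicAt g z) :
    mk f hf / mk g hg = mk (f / g) (fun z => (hf z).div (hg z)) := by
  rw [div_eq_mul_inv, mk_inv, mk_mul]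
  congr 1

/-- constants -/
def C : ℂ →+* Mer where
  toFun c := mk (fun _ => c) (fun z => MeromorphicAt.const c z)
  map_one' := rfl
  map_mul' _ _ := rfl
  map_zero' := rfl
  map_add' _ _ := rfl

lemma C_def (c : ℂ) : C c = mk (fun _ => c) (fun z => MeromorphicAt.const c z) := rfl

lemma C_inj {a b : ℂ} (h : C a = C b) : a = b := C.injective h

/-- the coordinate -/
def Z : Mer := mk id (fun z => MeromorphicAt.id z)

instance : CharZero Mer := ⟨by
  intro a b h
  have h1 : C (a : ℂ) = C (b : ℂ) := by simpa using h
  exact_mod_cast C_inj h1⟩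

/-- derivative -/
def D (h : Mer) : Mer := mk (deriv h.rep) (fun z => (h.rep_mero z).deriv)

lemma D_mk {f : ℂ → ℂ} (hf : ∀ z, MeromorphicAt f z) :
    D (mk f hf) = mk (deriv f) (fun z => (hf z).deriv) :=
  mk_eq.2 fun z => (rep_mk f hf z).nhdsNE_deriv

lemma D_add (h k : Mer) : D (h + k) = D h + D k := by
  induction h using mk_ind with | _ f hf
  induction k using mk_ind with | _ g hg
  rw [mk_add, D_mk, D_mk, D_mk, mk_add]
  refine mk_eq.2 fun z => ?_
  filter_upwards [(hf z).eventually_analyticAt, (hg z).eventually_analyticAt] with w h1 h2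
  exact deriv_add h1.differentiableAt h2.differentiableAt

lemma D_mul (h k : Mer) : D (h * k) = D h * k + h * D k := by
  induction h using mk_ind with | _ f hf
  induction k using mk_ind with | _ g hg
  rw [mk_mul, D_mk, D_mk, D_mk, mk_mul, mk_mul, mk_add]
  refine mk_eq.2 fun z => ?_
  filter_upwards [(hf z).eventually_analyticAt, (hg z).eventually_analyticAt] with w h1 h2
  exact deriv_mul h1.differentiableAt h2.differentiableAt

@[simp] lemma D_C (c : ℂ) : D (C c) = 0 := by
  rw [C_def, D_mk, mk_zero]
  refine mk_eq.2 fun z => ?_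
  filter_upwards with w
  simp

@[simp] lemma D_Z : D Z = 1 := by
  rw [Z, D_mk, mk_one]
  refine mk_eq.2 fun z => ?_
  filter_upwards with w
  simp

@[simp] lemma D_zero : D 0 = 0 := by
  have := D_C 0
  rwa [C.map_zero] at this
@[simp] lemma D_one : D 1 = 0 := by
  have := D_C 1
  rwa [C.map_one] at this
lemma D_neg (h : Mer) : D (-h) = - D h := by
  have := D_add h (-h)
  rw [add_neg_cancel, D_zero] at this
  exact (neg_eq_of_add_eq_zero_right this.symm).symm
lemma D_sub (h k : Mer) : D (h - k) = D h - D k := by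
  rw [sub_eq_add_neg, D_add, D_neg, sub_eq_add_neg]
@[simp] lemma D_nat (n : ℕ) : D (n : Mer) = 0 := by
  have := D_C n; simpa using this
@[simp] lemma D_ofNat (n : ℕ) [n.AtLeastTwo] : D (OfNat.ofNat n : Mer) = 0 := D_nat n
lemma D_inv {h : Mer} (hh : h ≠ 0) : D h⁻¹ = - D h / h ^ 2 := by
  have h1 := D_mul h h⁻¹
  rw [mul_inv_cancel₀ hh, D_one] at h1
  field_simp
  field_simp at h1
  linear_combination -h1
lemma D_div (h : Mer) {k : Mer} (hk : k ≠ 0) : D (h / k) = (D h * k - h * D k) / k ^ 2 := by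
  rw [div_eq_mul_inv, D_mul, D_inv hk]
  field_simp
  ring
lemma D_sq (h : Mer) : D (h ^ 2) = 2 * h * D h := by
  rw [pow_two, D_mul]; ring
lemma D_cube (h : Mer) : D (h ^ 3) = 3 * h ^ 2 * D h := by
  rw [pow_succ, D_mul, D_sq]; ring

end Mer
end


open Complex Filter Topology MeasureTheory
open scoped Classical

noncomputable section
namespace Mer

lemma ord_mul (z : ℂ) (h k : Mer) : ord z (h * k) = ord z h + ord z k := by
  induction h using mk_ind with | _ f hf
  induction k using mk_ind with | _ g hg
  rw [mk_mul, ord_mk, ord_mk, ord_mk, meromorphicOrderAt_mul (hf z) (hg z)]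

lemma ord_add (z : ℂ) (h k : Mer) : min (ord z h) (ord z k) ≤ ord z (h + k) := by
  induction h using mk_ind with | _ f hf
  induction k using mk_ind with | _ g hg
  rw [mk_add, ord_mk, ord_mk, ord_mk]
  exact meromorphicOrderAt_add (hf z) (hg z)

lemma ord_neg (z : ℂ) (h : Mer) : ord z (-h) = ord z h := by
  induction h using mk_ind with | _ f hf
  rw [mk_neg, ord_mk, ord_mk]
  exact (meromorphicOrderAt_neg).symm

lemma ord_inv (z : ℂ) (h : Mer) (hh : h ≠ 0) : ord z (h⁻¹) = - ord z h := by
  induction h using mk_ind with | _ f hf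
  rw [mk_inv, ord_mk, ord_mk, meromorphicOrderAt_inv]

lemma ord_C (z : ℂ) {c : ℂ} (hc : c ≠ 0) : ord z (C c) = 0 := by
  rw [C_def, ord_mk, meromorphicOrderAt_const]
  simp [hc]

/-- integer valued order (junk 0 at the zero function) -/
def v (z : ℂ) (h : Mer) : ℤ := (ord z h).untopD 0

lemma coe_v (z : ℂ) {h : Mer} (hh : h ≠ 0) : ((v z h : ℤ) : WithTop ℤ) = ord z h := by
  have : ord z h ≠ ⊤ := fun h1 => hh (ord_top_imp h1)
  lift ord z h to ℤ using this with n hn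
  simp [v, ← hn]

lemma v_zero (z : ℂ) : v z 0 = 0 := by simp [v, ord_zero]

lemma v_mul (z : ℂ) {h k : Mer} (hh : h ≠ 0) (hk : k ≠ 0) : v z (h * k) = v z h + v z k := by
  have h1 := ord_mul z h k
  rw [← coe_v z hh, ← coe_v z hk, ← coe_v z (mul_ne_zero hh hk)] at h1
  exact_mod_cast h1

lemma v_C (z : ℂ) (c : ℂ) : v z (C c) = 0 := by
  by_cases hc : c = 0
  · simp [hc, v_zero]
  · have h0 : C c ≠ 0 := fun h => hc (C_inj (by rw [h, C.map_zero]))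
    have := coe_v z h0
    rw [ord_C z hc] at this
    exact_mod_cast this

lemma v_one (z : ℂ) : v z 1 = 0 := by rw [← C.map_one, v_C]

lemma v_inv (z : ℂ) (h : Mer) : v z h⁻¹ = - v z h := by
  by_cases hh : h = 0
  · simp [hh, v_zero]
  have h1 := v_mul z hh (inv_ne_zero hh)
  rw [mul_inv_cancel₀ hh, v_one] at h1
  omega

lemma v_div (z : ℂ) {h k : Mer} (hh : h ≠ 0) (hk : k ≠ 0) : v z (h / k) = v z h - v z k := by
  rw [div_eq_mul_inv, v_mul z hh (inv_ne_zero hk), v_inv]; ring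

lemma v_neg (z : ℂ) (h : Mer) : v z (-h) = v z h := by rw [v, v, ord_neg]

lemma v_pow (z : ℂ) (h : Mer) (n : ℕ) : v z (h ^ n) = n * v z h := by
  by_cases hh : h = 0
  · rcases n with _ | n
    · simp [v_one]
    · simp [hh, v_zero]
  induction n with
  | zero => simp [v_one]
  | succ n ih => rw [pow_succ, v_mul z (pow_ne_zero n hh) hh, ih]; push_cast; ring

/-- order at least n -/
def og (z : ℂ) (n : ℤ) (h : Mer) : Prop := h = 0 ∨ n ≤ v z h

lemma og_iff_ord {z : ℂ} {n : ℤ} {h : Mer} : og z n h ↔ (n : WithTop ℤ) ≤ ord z h := by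
  by_cases hh : h = 0
  · simp [og, hh, ord_zero]
  · simp only [og, hh, false_or, ← coe_v z hh]
    exact_mod_cast Iff.rfl

lemma og_v {z : ℂ} {n : ℤ} {h : Mer} (H : og z n h) (hh : h ≠ 0) : n ≤ v z h :=
  H.resolve_left hh
lemma og_of_v {z : ℂ} {n : ℤ} {h : Mer} (H : n ≤ v z h) : og z n h := Or.inr H
lemma og_zero (z : ℂ) (n : ℤ) : og z n 0 := Or.inl rfl
lemma og_mono {z : ℂ} {n m : ℤ} {h : Mer} (H : og z n h) (hm : m ≤ n) : og z m h :=
  H.imp id (fun h => hm.trans h)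
lemma og_add {z : ℂ} {n : ℤ} {h k : Mer} (H : og z n h) (K : og z n k) : og z n (h + k) := by
  rw [og_iff_ord] at *
  exact (le_min H K).trans (ord_add z h k)
lemma og_neg {z : ℂ} {n : ℤ} {h : Mer} (H : og z n h) : og z n (-h) := by
  rw [og_iff_ord] at *
  rwa [ord_neg]
lemma og_sub {z : ℂ} {n : ℤ} {h k : Mer} (H : og z n h) (K : og z n k) : og z n (h - k) := by
  rw [sub_eq_add_neg]; exact og_add H (og_neg K)
lemma og_mul {z : ℂ} {n m : ℤ} {h k : Mer} (H : og z n h) (K : og z m k) :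
    og z (n + m) (h * k) := by
  by_cases h1 : h = 0
  · exact Or.inl (by rw [h1, zero_mul])
  by_cases h2 : k = 0
  · exact Or.inl (by rw [h2, mul_zero])
  exact Or.inr (by rw [v_mul z h1 h2]; have := og_v H h1; have := og_v K h2; omega)
lemma og_mul0 {z : ℂ} {n : ℤ} {h k : Mer} (H : og z 0 h) (K : og z n k) : og z n (h * k) := by
  simpa using og_mul H K
lemma og_C (z c : ℂ) : og z 0 (C c) := og_of_v (by rw [v_C])
lemma og_one (z : ℂ) : og z 0 1 := og_of_v (by rw [v_one])
lemma og_nat (z : ℂ) (n : ℕ) : og z 0 (n : Mer) := by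
  have := og_C z n; simpa using this
lemma og_ofNat (z : ℂ) (n : ℕ) [n.AtLeastTwo] : og z 0 (OfNat.ofNat n : Mer) := og_nat z n
lemma og_pow0 {z : ℂ} {h : Mer} (H : og z 0 h) (n : ℕ) : og z 0 (h ^ n) := by
  induction n with
  | zero => simpa using og_one z
  | succ n ih => rw [pow_succ]; exact og_mul0 ih H
lemma og_inv0 {z : ℂ} {h : Mer} (H : v z h = 0) : og z 0 h⁻¹ := og_of_v (by rw [v_inv, H]; simp)

lemma v_add_of_lt {z : ℂ} {n : ℤ} {h k : Mer} (hh : h ≠ 0) (hn : v z h < n) (K : og z n k) :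
    h + k ≠ 0 ∧ v z (h + k) = v z h := by
  have h1 : h + k ≠ 0 := by
    intro h1
    have h2 : h = -k := by linear_combination h1
    have := og_v (h2 ▸ og_neg K) hh
    omega
  refine ⟨h1, le_antisymm ?_ ?_⟩
  · by_contra h2
    push Not at h2
    have h3 : og z (v z h + 1) (h + k - k) :=
      og_sub (og_of_v (by omega)) (og_mono K (by omega))
    rw [add_sub_cancel_right] at h3
    have := og_v h3 hh
    omega
  · exact og_v (og_add (og_of_v le_rfl) (og_mono K hn.le)) h1

/-- residue (value) -/
lemma exists_val {z : ℂ} {h : Mer} (H : og z 0 h) : ∃ c : ℂ, og z 1 (h - C c) := by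
  induction h using mk_ind with | _ f hf
  rw [og_iff_ord, ord_mk] at H
  obtain ⟨c, hc⟩ := tendsto_nhds_of_meromorphicOrderAt_nonneg (hf z) (by exact_mod_cast H)
  refine ⟨c, ?_⟩
  rw [og_iff_ord, C_def, mk_sub, ord_mk]
  have h1 : MeromorphicAt (f - fun _ => c) z := (hf z).sub (MeromorphicAt.const c z)
  have h2 : 0 < meromorphicOrderAt (f - fun _ => c) z := by
    rw [← tendsto_zero_iff_meromorphicOrderAt_pos h1]
    have := hc.sub_const c
    rw [sub_self] at this
    exact this
  cases h3 : meromorphicOrderAt (f - fun _ => c) z with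
  | top => exact le_top
  | coe n =>
    rw [h3] at h2
    have h4 : 0 < n := by exact_mod_cast h2
    exact_mod_cast h4

lemma v_D {z : ℂ} {h : Mer} (hv : v z h ≠ 0) : D h ≠ 0 ∧ v z (D h) = v z h - 1 := by
  have hh : h ≠ 0 := by rintro rfl; exact hv (v_zero z)
  have h0 := coe_v z hh
  induction h using mk_ind with | _ f hf
  rw [ord_mk] at h0
  have h1 := meromorphicOrderAt_deriv_eq_sub_one (x := z) (f := f) (n := v z (mk f hf))
    (by exact_mod_cast hv) h0.symm
  have h2 : ord z (D (mk f hf)) = ((v z (mk f hf) - 1 : ℤ) : WithTop ℤ) := by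
    rw [D_mk, ord_mk, h1]
  have h3 : D (mk f hf) ≠ 0 := by
    intro h4
    rw [h4, ord_zero] at h2
    exact WithTop.top_ne_coe h2
  refine ⟨h3, ?_⟩
  rw [← coe_v z h3] at h2
  exact_mod_cast h2

lemma og_D0 {z : ℂ} {h : Mer} (H : og z 0 h) : og z 0 (D h) := by
  obtain ⟨c, hc⟩ := exists_val H
  have h1 : D h = D (h - C c) := by rw [D_sub, D_C, sub_zero]
  rw [h1]
  rcases hc with hc | hc
  · rw [hc, D_zero]; exact og_zero _ _
  · have := (v_D (z := z) (h := h - C c) (by omega)).2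
    exact og_of_v (by omega)

lemma og_D {z : ℂ} {n : ℤ} {h : Mer} (H : og z n h) : og z (n - 1) (D h) := by
  rcases H with rfl | H
  · rw [D_zero]; exact og_zero _ _
  by_cases h0 : v z h = 0
  · exact og_mono (og_D0 (og_of_v h0.ge)) (by omega)
  · exact og_of_v (by rw [(v_D h0).2]; omega)

lemma const_of_D {h : Mer} (H : D h = 0) : ∃ c, h = C c := by
  have h0 : v 0 h = 0 := by
    by_contra h1
    exact (v_D h1).1 H
  obtain ⟨c, hc⟩ := exists_val (z := 0) (h := h) (og_of_v h0.ge)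
  refine ⟨c, ?_⟩
  rcases hc with hc | hc
  · linear_combination hc
  · exfalso
    refine (v_D (z := 0) (h := h - C c) (by omega)).1 ?_
    rw [D_sub, D_C, H, sub_zero]

lemma og_logD {h : Mer} (z : ℂ) : og z (-1) (D h / h) := by
  by_cases hh : h = 0
  · rw [hh]; simp only [div_zero]; exact og_zero _ _
  by_cases h0 : D h = 0
  · rw [h0, zero_div]; exact og_zero _ _
  refine og_of_v ?_
  rw [v_div z h0 hh]
  have := og_v (og_D (og_of_v (le_refl (v z h)))) h0
  omega

lemma og_logD0 {h : Mer} {z : ℂ} (hz : v z h = 0) : og z 0 (D h / h) := by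
  rw [div_eq_mul_inv]
  exact og_mul0 (og_D0 (og_of_v hz.ge)) (og_inv0 hz)

/-- nonzero functions have isolated zeros and poles -/
lemma v_zero_codiscrete {h : Mer} (hh : h ≠ 0) (z : ℂ) : ∀ᶠ w in 𝓝[≠] z, v w h = 0 := by
  have := MeromorphicOn.codiscreteWithin_setOfPred_meromorphicOrderAt_eq_zero_or_top
    (f := h.rep) (U := Set.univ) (fun z _ => h.rep_mero z)
  rw [mem_codiscreteWithin_iff_forall_mem_nhdsNE] at this
  have h1 := this (fun u _ hu => hh (ord_top_imp hu)) z (Set.mem_univ z)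
  filter_upwards [h1] with w hw
  rcases hw with hw | hw
  · rcases hw.2 with hw | hw
    · have hw' : ord w h = 0 := hw
      simp [v, hw']
    · exact absurd (ord_top_imp hw) hh
  · simp at hw

/-! ### the involution -/

lemma analyticAt_mtilde {f : ℂ → ℂ} {z : ℂ} (hf : AnalyticAt ℂ f (starRingEnd ℂ z)) :
    AnalyticAt ℂ (mtilde f) z := by
  rw [Complex.analyticAt_iff_eventually_differentiableAt] at hf ⊢
  have hc : Tendsto (starRingEnd ℂ) (𝓝 z) (𝓝 (starRingEnd ℂ z)) :=
    Complex.continuous_conj.continuousAt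
  filter_upwards [hc.eventually hf] with w hw
  have := hw.conj_conj
  simp only [Complex.conj_conj] at this
  exact this

lemma mero_mtilde {f : ℂ → ℂ} {z : ℂ} (hf : MeromorphicAt f (starRingEnd ℂ z)) :
    MeromorphicAt (mtilde f) z := by
  obtain ⟨n, hn⟩ := hf
  refine ⟨n, ?_⟩
  have := analyticAt_mtilde hn
  have h2 : (fun w => (w - z) ^ n • mtilde f w) =
      mtilde (fun w => (w - (starRingEnd ℂ) z) ^ n • f w) := by
    ext w
    simp [mtilde]
  rw [h2]
  exact this

lemma conj_nhdsNE (z : ℂ) : Tendsto (starRingEnd ℂ) (𝓝[≠] z) (𝓝[≠] (starRingEnd ℂ z)) := by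
  refine tendsto_nhdsWithin_iff.2 ⟨(Complex.continuous_conj.continuousAt.tendsto).mono_left
    nhdsWithin_le_nhds, ?_⟩
  filter_upwards [self_mem_nhdsWithin] with w hw
  exact fun h => hw ((starRingEnd ℂ).injective h)

/-- the involution -/
def til (h : Mer) : Mer := mk (mtilde h.rep) (fun _ => mero_mtilde (h.rep_mero _))

lemma til_mk {f : ℂ → ℂ} (hf : ∀ z, MeromorphicAt f z) :
    til (mk f hf) = mk (mtilde f) (fun _ => mero_mtilde (hf _)) := by
  refine mk_eq.2 fun z => ?_
  filter_upwards [(conj_nhdsNE z).eventually (rep_mk f hf (starRingEnd ℂ z))] with w hw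
  simp [mtilde, hw]

lemma til_til (h : Mer) : til (til h) = h := by
  induction h using mk_ind with | _ f hf
  rw [til_mk, til_mk]
  refine mk_eq.2 fun z => ?_
  filter_upwards with w
  simp [mtilde]

lemma til_mul (h k : Mer) : til (h * k) = til h * til k := by
  induction h using mk_ind with | _ f hf
  induction k using mk_ind with | _ g hg
  rw [mk_mul, til_mk, til_mk, til_mk, mk_mul]
  refine mk_eq.2 fun z => ?_
  filter_upwards with w
  simp [mtilde]

lemma til_add (h k : Mer) : til (h + k) = til h + til k := by
  induction h using mk_ind with | _ f hf
  induction k using mk_ind with | _ g hg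
  rw [mk_add, til_mk, til_mk, til_mk, mk_add]
  refine mk_eq.2 fun z => ?_
  filter_upwards with w
  simp [mtilde]

lemma til_C (c : ℂ) : til (C c) = C (starRingEnd ℂ c) := by
  rw [C_def, til_mk, C_def]
  rfl

/-- the involution as a ring hom -/
def tilH : Mer →+* Mer where
  toFun := til
  map_one' := by
    show til 1 = 1
    rw [← C.map_one, til_C]; simp
  map_mul' := til_mul
  map_zero' := by
    show til 0 = 0
    have := til_C 0
    simpa using this
  map_add' := til_add

lemma til_div (h k : Mer) : til (h / k) = til h / til k := map_div₀ tilH h k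
lemma til_inv (h : Mer) : til (h⁻¹) = (til h)⁻¹ := map_inv₀ tilH h
lemma til_sub (h k : Mer) : til (h - k) = til h - til k := map_sub tilH h k
lemma til_one : til 1 = 1 := tilH.map_one
lemma til_zero : til 0 = 0 := tilH.map_zero
lemma til_pow (h : Mer) (n : ℕ) : til (h ^ n) = til h ^ n := map_pow tilH h n
lemma til_inj {h k : Mer} (H : til h = til k) : h = k := tilH.injective H

lemma til_D (h : Mer) : til (D h) = D (til h) := by
  induction h using mk_ind with | _ f hf
  rw [D_mk, til_mk, til_mk, D_mk]
  refine mk_eq.2 fun z => ?_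
  filter_upwards with w
  have h1 : mtilde f = (starRingEnd ℂ) ∘ f ∘ (starRingEnd ℂ) := rfl
  rw [h1, deriv_conj_conj]
  rfl

lemma og_til {z : ℂ} {n : ℤ} {h : Mer} (H : og (starRingEnd ℂ z) n h) : og z n (til h) := by
  by_cases hh : h = 0
  · rw [hh, til_zero]; exact og_zero _ _
  -- divide by (Z - z)^n
  have key : ∀ k : Mer, og (starRingEnd ℂ z) 0 k → og z 0 (til k) := by
    intro k hk
    induction k using mk_ind with | _ f hf
    rw [og_iff_ord, ord_mk] at hk
    obtain ⟨c, hc⟩ := tendsto_nhds_of_meromorphicOrderAt_nonneg (hf _) (by exact_mod_cast hk)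
    rw [til_mk, og_iff_ord, ord_mk]
    have h2 : MeromorphicAt (mtilde f) z := mero_mtilde (hf _)
    have h3 : 0 ≤ meromorphicOrderAt (mtilde f) z := by
      rw [← tendsto_nhds_iff_meromorphicOrderAt_nonneg h2]
      refine ⟨starRingEnd ℂ c, ?_⟩
      exact (Complex.continuous_conj.continuousAt.tendsto.comp hc).comp (conj_nhdsNE z)
    exact_mod_cast h3
  have hX : ∀ a : ℂ, v a (Z - C a) = 1 ∧ Z - C a ≠ 0 := by
    intro a
    have h1 : ord a (Z - C a) = 1 := by
      rw [Z, C_def, mk_sub, ord_mk]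
      have : (id - fun _ => a : ℂ → ℂ) = (fun x => x - a) := rfl
      rw [this]
      have := meromorphicOrderAt_id_sub_const (𝕜 := ℂ) (x := a)
      exact this
    have h2 : Z - C a ≠ 0 := by
      intro h; rw [h, ord_zero] at h1; exact absurd h1 (by simp)
    refine ⟨?_, h2⟩
    simp [v, h1]
  set a := starRingEnd ℂ z with ha
  have h1 : og a 0 (h * (Z - C a) ^ (-n)) := by
    refine og_of_v ?_
    have h3 : ∀ m : ℤ, v a ((Z - C a) ^ m) = m := by
      intro m
      cases m with
      | ofNat m => simp [v_pow, (hX a).1]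
      | negSucc m => rw [zpow_negSucc, v_inv, v_pow, (hX a).1]; simp; omega
    rw [v_mul a hh (zpow_ne_zero _ (hX a).2), h3]
    have := og_v H hh
    omega
  have h2 := key _ h1
  have h4 : til (Z - C a) = Z - C z := by
    rw [til_sub, til_C, ha, Complex.conj_conj, Z, til_mk]
    congr 1
    refine mk_eq.2 fun z => ?_
    filter_upwards with w
    simp [mtilde]
  rw [til_mul, show til ((Z - C a) ^ (-n)) = til (Z - C a) ^ (-n) from map_zpow₀ tilH _ _, h4]
    at h2
  refine og_of_v ?_
  have h5 : til h ≠ 0 := fun h => hh (til_inj (by rw [h, til_zero]))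
  have h6 := og_v h2 (mul_ne_zero h5 (zpow_ne_zero _ (hX z).2))
  have h3 : ∀ m : ℤ, v z ((Z - C z) ^ m) = m := by
    intro m
    cases m with
    | ofNat m => simp [v_pow, (hX z).1]
    | negSucc m => rw [zpow_negSucc, v_inv, v_pow, (hX z).1]; simp; omega
  rw [v_mul z h5 (zpow_ne_zero _ (hX z).2), h3] at h6
  omega

lemma til_ne_zero {h : Mer} (hh : h ≠ 0) : til h ≠ 0 :=
  fun H => hh (til_inj (by rw [H, til_zero]))

lemma v_til (z : ℂ) (h : Mer) : v z (til h) = v (starRingEnd ℂ z) h := by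
  by_cases hh : h = 0
  · rw [hh, til_zero, v_zero, v_zero]
  refine le_antisymm ?_ ?_
  · have h1 : og (starRingEnd ℂ z) (v z (til h)) (til (til h)) :=
      og_til (by rw [Complex.conj_conj]; exact og_of_v le_rfl)
    rw [til_til] at h1
    exact og_v h1 hh
  · exact og_v (og_til (og_of_v le_rfl)) (til_ne_zero hh)

end Mer
end


open Complex Filter Topology MeasureTheory
open scoped Classical

noncomputable section

lemma nv_logDeriv_le {g : ℂ → ℂ} {r ρ : ℝ} (hr : 0 ≤ r) (hρ : r < ρ)
    (hg : AnalyticOnNhd ℂ g (Metric.closedBall 0 ρ)) (h0 : ∀ u ∈ Metric.closedBall 0 ρ, g u ≠ 0)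
    {w : ℂ} (hw : ‖w‖ ≤ r) :
    ‖deriv g w / g w‖ ≤ 2 * ρ / (ρ - r) ^ 2 * Real.circleAverage (fun z => |Real.log ‖g z‖|) 0 ρ := by
  have hρ0 : 0 < ρ := lt_of_le_of_lt hr hρ
  set u : ℂ → ℝ := fun z => Real.log ‖g z‖ with hu
  have hcont : ContinuousOn u (Metric.closedBall 0 ρ) := by
    intro z hz
    exact ((hg z hz).continuousAt.norm.log (norm_ne_zero_iff.2 (h0 z hz))).continuousWithinAt
  have hci : CircleIntegrable u 0 ρ := by
    apply ContinuousOn.circleIntegrable hρ0.le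
    exact hcont.mono Metric.sphere_subset_closedBall
  have hciC : CircleIntegrable (fun z => (u z : ℂ)) 0 ρ := by
    apply ContinuousOn.circleIntegrable hρ0.le
    exact (continuous_ofReal.comp_continuousOn hcont).mono Metric.sphere_subset_closedBall
  set H : ℂ → ℂ := fun w => Real.circleAverage (fun ζ ↦ herglotzRieszKernel 0 w ζ • (u ζ : ℂ)) 0 ρ with hH
  have hre : ∀ w ∈ Metric.ball (0:ℂ) ρ, (H w).re = Real.log ‖g w‖ := by
    intro w hw
    have h1 := re_circleAverage_herglotzRieszKernel_smul hci hw
    rw [InnerProductSpace.HarmonicOnNhd.circleAverage_re_herglotzRieszKernel_smul] at h1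
    · exact h1
    · intro z hz
      exact (hg z hz).harmonicAt_log_norm (h0 z hz)
    · exact hw
  have hd : ∀ w ∈ Metric.ball (0:ℂ) ρ, HasDerivAt H (Real.circleAverage (fun ζ ↦ (2 * ζ / (ζ - w) ^ 2) • (u ζ : ℂ)) 0 ρ) w :=
    fun w hw => hasDerivAt_circleAverage_herglotzRieszKernel_smul hciC hw
  set q : ℂ → ℂ := fun w => g w * exp (-H w) with hq
  have hqn : ∀ w ∈ Metric.ball (0:ℂ) ρ, ‖q w‖ = 1 := by
    intro w hw
    have hgw := h0 w (Metric.ball_subset_closedBall hw)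
    simp only [hq, norm_mul, norm_exp, neg_re, hre w hw, Real.exp_neg]
    rw [Real.exp_log (norm_pos_iff.2 hgw)]
    exact mul_inv_cancel₀ (norm_ne_zero_iff.2 hgw)
  have hwb : w ∈ Metric.ball (0:ℂ) ρ := by simp; linarith
  have hqd : DifferentiableOn ℂ q (Metric.ball 0 ρ) := by
    intro z hz
    exact ((hg z (Metric.ball_subset_closedBall hz)).differentiableAt.mul
      ((hd z hz).differentiableAt.neg.cexp)).differentiableWithinAt
  have hqc := Complex.eqOn_of_isPreconnected_of_isMaxOn_norm (convex_ball (0:ℂ) ρ).isPreconnected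
    Metric.isOpen_ball hqd hwb (by
      intro z hz; simp only [Function.comp, Set.mem_ofPred_eq]; rw [hqn z hz, hqn w hwb])
  have hder : HasDerivAt q (deriv g w * exp (-H w) + g w * (exp (-H w) * -(Real.circleAverage (fun ζ ↦ (2 * ζ / (ζ - w) ^ 2) • (u ζ : ℂ)) 0 ρ))) w :=
    (hg w (Metric.ball_subset_closedBall hwb)).differentiableAt.hasDerivAt.mul ((hd w hwb).neg.cexp)
  have hder0 : HasDerivAt q 0 w := by
    refine (hasDerivAt_const w (q w)).congr_of_eventuallyEq ?_
    filter_upwards [Metric.isOpen_ball.mem_nhds hwb] with z hz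
    exact hqc hz
  have heq := hder.unique hder0
  have hgw := h0 w (Metric.ball_subset_closedBall hwb)
  have key : deriv g w / g w = Real.circleAverage (fun ζ ↦ (2 * ζ / (ζ - w) ^ 2) • (u ζ : ℂ)) 0 ρ := by
    rw [div_eq_iff hgw]
    have he := exp_ne_zero (-H w)
    apply mul_left_cancel₀ he
    linear_combination heq
  rw [key, Real.circleAverage_def, Real.circleAverage_def, norm_smul, smul_eq_mul]
  rw [Real.norm_of_nonneg (by positivity)]
  have : ‖∫ θ in (0:ℝ)..2 * Real.pi, (2 * circleMap 0 ρ θ / (circleMap 0 ρ θ - w) ^ 2) • (u (circleMap 0 ρ θ) : ℂ)‖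
      ≤ ∫ θ in (0:ℝ)..2 * Real.pi, 2 * ρ / (ρ - r) ^ 2 * |u (circleMap 0 ρ θ)| := by
    apply intervalIntegral.norm_integral_le_of_norm_le Real.two_pi_pos.le
    · refine Filter.Eventually.of_forall fun θ _ => ?_
      rw [norm_smul, norm_div, norm_mul, norm_pow, norm_real]
      have h1 : ‖circleMap 0 ρ θ‖ = ρ := by simp [abs_of_pos hρ0]
      have h2 : ρ - r ≤ ‖circleMap 0 ρ θ - w‖ := by
        have := norm_sub_norm_le (circleMap 0 ρ θ) w
        rw [h1] at this; linarith
      rw [h1, Real.norm_eq_abs]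
      have h3 : 0 < ρ - r := by linarith
      simp only [Complex.norm_ofNat]
      gcongr
    · exact (hci.abs).const_mul _
  rw [intervalIntegral.integral_const_mul] at this
  calc _ ≤ (2 * Real.pi)⁻¹ * _ := mul_le_mul_of_nonneg_left this (by positivity)
    _ = _ := by ring

def sinh_half (θ : ℝ) : ℝ := |Real.sin θ| ^ (-(1/2) : ℝ)

lemma sinh_half_per : Function.Periodic sinh_half Real.pi := by
  intro θ; simp [sinh_half, Real.sin_add_pi]

lemma sinh_half_int0 : IntervalIntegrable sinh_half volume 0 Real.pi := by
  have h1 : IntervalIntegrable (fun x : ℝ => x ^ (-(1/2) : ℝ)) volume 0 Real.pi :=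
    intervalIntegral.intervalIntegrable_rpow' (by norm_num)
  have h2 : IntervalIntegrable (fun x : ℝ => (Real.pi - x) ^ (-(1/2) : ℝ)) volume 0 Real.pi := by
    have := (h1.comp_sub_left Real.pi).symm
    simpa using this
  have h3 := (h1.add h2).const_mul ((2 / Real.pi) ^ (-(1/2) : ℝ))
  refine h3.mono_fun ?_ ?_
  · apply Measurable.aestronglyMeasurable
    unfold sinh_half
    exact (Real.measurable_sin.abs).pow_const _
  · rw [Filter.EventuallyLE, ae_restrict_iff' measurableSet_uIoc]
    filter_upwards [(measure_eq_zero_iff_ae_notMem.1 (measure_singleton (Real.pi))) ] with θ hne hθ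
    rw [Set.uIoc_of_le Real.pi_pos.le] at hθ
    have hlt : θ < Real.pi := lt_of_le_of_ne hθ.2 (by simpa using hne)
    have hp := Real.pi_pos
    have ht : 0 < θ := hθ.1
    have hs : 0 < Real.sin θ := Real.sin_pos_of_pos_of_lt_pi ht hlt
    rw [Real.norm_of_nonneg (by unfold sinh_half; positivity)]
    have hπθ : 0 < Real.pi - θ := by linarith
    rw [Real.norm_of_nonneg (by positivity)]
    unfold sinh_half
    rw [abs_of_pos hs]
    rcases le_total θ (Real.pi / 2) with h | h
    · have := Real.mul_le_sin ht.le h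
      calc _ ≤ (2 / Real.pi * θ) ^ (-(1/2) : ℝ) := Real.rpow_le_rpow_of_nonpos (by positivity) this (by norm_num)
        _ = (2 / Real.pi) ^ (-(1/2) : ℝ) * θ ^ (-(1/2) : ℝ) := Real.mul_rpow (by positivity) ht.le
        _ ≤ _ := by
          apply mul_le_mul_of_nonneg_left _ (by positivity)
          have : 0 ≤ (Real.pi - θ) ^ (-(1/2) : ℝ) := by positivity
          linarith
    · have := Real.mul_le_sin hπθ.le (by linarith)
      rw [Real.sin_pi_sub] at this
      calc _ ≤ (2 / Real.pi * (Real.pi - θ)) ^ (-(1/2) : ℝ) := Real.rpow_le_rpow_of_nonpos (by positivity) this (by norm_num)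
        _ = (2 / Real.pi) ^ (-(1/2) : ℝ) * (Real.pi - θ) ^ (-(1/2) : ℝ) := Real.mul_rpow (by positivity) hπθ.le
        _ ≤ _ := by
          apply mul_le_mul_of_nonneg_left _ (by positivity)
          have : 0 ≤ θ ^ (-(1/2) : ℝ) := by positivity
          linarith

lemma sinh_half_int (a b : ℝ) : IntervalIntegrable sinh_half volume a b :=
  sinh_half_per.intervalIntegrable (t := 0) Real.pi_pos.ne' (by simpa using sinh_half_int0) a b

def sqK : ℝ := 1 + (2 * Real.pi)⁻¹ * (2 * ∫ θ in (0:ℝ)..2 * Real.pi, sinh_half θ)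

lemma inv_sqrt_avg {r : ℝ} (hr : 1/2 ≤ r) (c : ℂ) :
    CircleIntegrable (fun z => ‖z - c‖ ^ (-(1/2) : ℝ)) 0 r ∧
      Real.circleAverage (fun z => ‖z - c‖ ^ (-(1/2) : ℝ)) 0 r ≤ sqK := by
  have hr0 : 0 < r := by linarith
  set α := arg c
  have hb : ∀ᵐ θ : ℝ, ‖circleMap 0 r θ - c‖ ^ (-(1/2) : ℝ) ≤ 2 * sinh_half (θ - α) := by
    have hnull : ∀ᵐ θ : ℝ, Real.sin (θ - α) ≠ 0 := by
      have hc : (Set.range (fun n : ℤ => (n : ℝ) * Real.pi + α)).Countable := Set.countable_range _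
      filter_upwards [measure_eq_zero_iff_ae_notMem.1 (hc.measure_zero volume)] with θ hθ h0
      obtain ⟨n, hn⟩ := Real.sin_eq_zero_iff.1 h0
      exact hθ ⟨n, by simp only []; linarith⟩
    filter_upwards [hnull] with θ hθ
    have h1 : r * |Real.sin (θ - α)| ≤ ‖circleMap 0 r θ - c‖ := by
      have h2 : (circleMap 0 r θ - c) * exp (-(α * I)) = r * exp ((θ - α : ℝ) * I) - ‖c‖ := by
        have h3 : c * exp (-(α * I)) = ‖c‖ := by
          conv_lhs => rw [← norm_mul_exp_arg_mul_I c]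
          rw [mul_assoc, ← exp_add]; simp [α]
        rw [sub_mul, h3]
        simp only [circleMap, zero_add]
        rw [mul_assoc, ← exp_add]; push_cast; ring_nf
      have h4 : ‖circleMap 0 r θ - c‖ = ‖(r * exp ((θ - α : ℝ) * I) - ‖c‖ : ℂ)‖ := by
        rw [← h2, norm_mul]
        have : ‖exp (-(α * I))‖ = 1 := by
          have := norm_exp_ofReal_mul_I (-α); push_cast at this; rwa [neg_mul] at this
        rw [this, mul_one]
      rw [h4]
      refine le_trans (le_of_eq ?_) (abs_im_le_norm _)
      rw [sub_im, mul_im, exp_ofReal_mul_I_im, exp_ofReal_mul_I_re]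
      simp [abs_mul, abs_of_pos hr0]
    have hpos : 0 < |Real.sin (θ - α)| := abs_pos.2 hθ
    have h5 : (1/4) * |Real.sin (θ - α)| ≤ ‖circleMap 0 r θ - c‖ := by nlinarith
    calc _ ≤ ((1/4) * |Real.sin (θ - α)|) ^ (-(1/2) : ℝ) := Real.rpow_le_rpow_of_nonpos (by positivity) h5 (by norm_num)
      _ = (1/4 : ℝ) ^ (-(1/2) : ℝ) * |Real.sin (θ - α)| ^ (-(1/2) : ℝ) := Real.mul_rpow (by positivity) hpos.le
      _ = 2 * sinh_half (θ - α) := by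
        congr 1
        rw [show (1/4 : ℝ) = (2:ℝ)^(-2:ℝ) by rw [Real.rpow_neg (by norm_num)]; norm_num, ← Real.rpow_mul (by norm_num)]; norm_num
  have hi : IntervalIntegrable (fun θ => 2 * sinh_half (θ - α)) volume 0 (2 * Real.pi) := by
    have := (sinh_half_int (0 - α) (2 * Real.pi - α)).comp_sub_right α
    apply IntervalIntegrable.const_mul
    simpa using this
  have hci : CircleIntegrable (fun z => ‖z - c‖ ^ (-(1/2) : ℝ)) 0 r := by
    refine hi.mono_fun ?_ ?_
    · apply Measurable.aestronglyMeasurable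
      have : Measurable (circleMap 0 r) := (continuous_circleMap 0 r).measurable
      exact ((this.sub_const c).norm).pow_const _
    · filter_upwards [ae_restrict_of_ae hb] with θ hθ
      rw [Real.norm_of_nonneg (by positivity), Real.norm_of_nonneg (le_trans (by positivity) hθ)]
      exact hθ
  refine ⟨hci, ?_⟩
  rw [Real.circleAverage_def, smul_eq_mul, sqK]
  have h6 : ∫ θ in (0:ℝ)..2 * Real.pi, ‖circleMap 0 r θ - c‖ ^ (-(1/2) : ℝ) ≤ ∫ θ in (0:ℝ)..2 * Real.pi, 2 * sinh_half (θ - α) :=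
    intervalIntegral.integral_mono_ae Real.two_pi_pos.le hci hi hb
  have h7 : ∫ θ in (0:ℝ)..2 * Real.pi, 2 * sinh_half (θ - α) = 2 * ∫ θ in (0:ℝ)..2 * Real.pi, sinh_half θ := by
    rw [intervalIntegral.integral_const_mul, intervalIntegral.integral_comp_sub_right (fun x => sinh_half x)]
    congr 1
    have hper : Function.Periodic sinh_half (2 * Real.pi) := by
      have := sinh_half_per.nsmul 2; simpa using this
    have := hper.intervalIntegral_add_eq (0 - α) 0
    rw [zero_add] at this
    rw [← this]; congr 1; ring
  rw [h7] at h6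
  have := mul_le_mul_of_nonneg_left h6 (by positivity : 0 ≤ (2 * Real.pi)⁻¹)
  linarith

lemma sqK_pos : 1 ≤ sqK := by
  unfold sqK
  have : 0 ≤ ∫ θ in (0:ℝ)..2 * Real.pi, sinh_half θ := 
    intervalIntegral.integral_nonneg Real.two_pi_pos.le (fun x _ => by unfold sinh_half; positivity)
  have := Real.pi_pos
  have : 0 ≤ (2 * Real.pi)⁻¹ * (2 * ∫ θ in (0:ℝ)..2 * Real.pi, sinh_half θ) := by positivity
  linarith
end


open Complex Filter Topology MeasureTheory
open scoped Classical

noncomputable section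

open Real (posLog) in
/-- logarithmic weight -/
def Wt (r : ℝ) (z : ℂ) : ℝ := if z = 0 then Real.posLog r + 1 else Real.posLog (r / ‖z‖)

def mF (r : ℝ) (F : ℂ → ℂ) : ℝ := Real.circleAverage (fun z => Real.posLog ‖F z‖) 0 r

def oF (F : ℂ → ℂ) (z : ℂ) : ℤ := (meromorphicOrderAt F z).untop₀

def NF (r : ℝ) (F : ℂ → ℂ) : ℝ := ∑ᶠ z, ((max (-(oF F z)) 0 : ℤ) : ℝ) * Wt r z

structure GoodF (r : ℝ) (F : ℂ → ℂ) : Prop where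
  mero : ∀ z ∈ Metric.closedBall (0:ℂ) r, MeromorphicAt F z
  ntop : ∀ z ∈ Metric.closedBall (0:ℂ) r, meromorphicOrderAt F z ≠ ⊤

lemma Wt_nonneg (r : ℝ) (z : ℂ) : 0 ≤ Wt r z := by
  unfold Wt; split_ifs
  · have := Real.posLog_nonneg (x := r); linarith
  · exact Real.posLog_nonneg

lemma Wt_out {r : ℝ} (hr : 0 < r) {z : ℂ} (hz : r ≤ ‖z‖) : Wt r z = 0 := by
  have h0 : 0 < ‖z‖ := lt_of_lt_of_le hr hz
  rw [Wt, if_neg (norm_pos_iff.1 h0), Real.posLog_eq_zero_iff, abs_of_pos (by positivity)]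
  rw [div_le_one h0]; exact hz

lemma Wt_mono {r ρ : ℝ} (hr : 0 < r) (h : r ≤ ρ) (z : ℂ) : Wt r z ≤ Wt ρ z := by
  unfold Wt; split_ifs
  · have := Real.posLog_le_posLog hr.le h; linarith
  · exact Real.posLog_le_posLog (by positivity) (by gcongr)

lemma Wt_lower {ρ R : ℝ} (hρ : 0 < ρ) (h : ρ < R) {z : ℂ} (hz : ‖z‖ ≤ ρ) : (R - ρ) / R ≤ Wt R z := by
  have hR : 0 < R := by linarith
  unfold Wt; split_ifs with h0
  · have := Real.posLog_nonneg (x := R)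
    have : (R - ρ) / R ≤ 1 := by rw [div_le_one hR]; linarith
    linarith
  · have hz0 : 0 < ‖z‖ := norm_pos_iff.2 h0
    have h1 : R / ρ ≤ R / ‖z‖ := by gcongr
    have h2 : 0 < ‖z‖ / R := by positivity
    have h3 := Real.log_le_sub_one_of_pos h2
    have h4 : Real.log (R / ‖z‖) = - Real.log (‖z‖ / R) := by
      rw [← Real.log_inv, inv_div]
    have h5 : Real.log (R / ‖z‖) ≤ Real.posLog (R / ‖z‖) := by
      rw [Real.posLog_apply]; exact le_max_right _ _
    have h6 : ‖z‖ / R ≤ ρ / R := by gcongr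
    have h7 : (R - ρ) / R = 1 - ρ / R := by field_simp
    linarith

lemma GoodF.mono {r ρ : ℝ} {F : ℂ → ℂ} (h : GoodF ρ F) (hr : r ≤ ρ) : GoodF r F :=
  ⟨fun z hz => h.1 z (Metric.closedBall_subset_closedBall hr hz),
   fun z hz => h.2 z (Metric.closedBall_subset_closedBall hr hz)⟩

lemma GoodF.inv {r : ℝ} {F : ℂ → ℂ} (h : GoodF r F) : GoodF r F⁻¹ :=
  ⟨fun z hz => (h.1 z hz).inv, fun z hz => by
    rw [meromorphicOrderAt_inv]
    intro h1
    have := h.2 z hz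
    cases hh : meromorphicOrderAt F z with
    | top => exact this hh
    | coe n => rw [hh] at h1; cases h1⟩

lemma oF_inv (F : ℂ → ℂ) (z : ℂ) : oF F⁻¹ z = - oF F z := by
  unfold oF; rw [meromorphicOrderAt_inv]; simp

/-- finite set of zeros and poles in the closed ball -/
def spF (r : ℝ) (F : ℂ → ℂ) : Finset ℂ :=
  ((MeromorphicOn.divisor F (Metric.closedBall 0 r)).finiteSupport (isCompact_closedBall 0 r)).toFinset

lemma mem_spF {r : ℝ} {F : ℂ → ℂ} (h : GoodF r F) {z : ℂ} :
    z ∈ spF r F ↔ ‖z‖ ≤ r ∧ oF F z ≠ 0 := by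
  unfold spF
  rw [Set.Finite.mem_toFinset, Function.mem_support, MeromorphicOn.divisor_def]
  by_cases hz : ‖z‖ ≤ r
  · rw [if_pos ⟨h.1, by simpa using hz⟩]; simp [hz, oF]
  · rw [if_neg (by simp [hz])]; simp [hz]

lemma NF_eq {r : ℝ} (hr : 0 < r) {F : ℂ → ℂ} (h : GoodF r F) :
    NF r F = ∑ z ∈ spF r F, ((max (-(oF F z)) 0 : ℤ) : ℝ) * Wt r z := by
  unfold NF
  apply finsum_eq_sum_of_support_subset
  intro z hz
  rw [Finset.mem_coe, mem_spF h]
  rw [Function.mem_support] at hz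
  constructor
  · by_contra hc
    exact hz (by rw [Wt_out hr (by linarith), mul_zero])
  · intro hc; exact hz (by rw [hc]; simp)

lemma spF_inv {r : ℝ} {F : ℂ → ℂ} (h : GoodF r F) : spF r F⁻¹ = spF r F := by
  ext z; rw [mem_spF h, mem_spF h.inv, oF_inv]; simp

lemma NF_nonneg (r : ℝ) (F : ℂ → ℂ) : 0 ≤ NF r F := by
  apply finsum_nonneg
  intro z
  apply mul_nonneg _ (Wt_nonneg _ _)
  exact_mod_cast le_max_right _ _

lemma mF_nonneg (r : ℝ) (F : ℂ → ℂ) : 0 ≤ mF r F :=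
  Real.circleAverage_nonneg_of_nonneg (fun _ _ => Real.posLog_nonneg)

lemma GoodF.ci {r : ℝ} (hr : 0 < r) {F : ℂ → ℂ} (h : ∀ z ∈ Metric.closedBall (0:ℂ) r, MeromorphicAt F z) :
    CircleIntegrable (fun z => Real.posLog ‖F z‖) 0 r :=
  MeromorphicOn.circleIntegrable_posLog_norm_of_nonneg
    (fun z hz => h z (Metric.sphere_subset_closedBall hz)) hr.le

lemma GoodF.cil {r : ℝ} (hr : 0 < r) {F : ℂ → ℂ} (h : ∀ z ∈ Metric.closedBall (0:ℂ) r, MeromorphicAt F z) :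
    CircleIntegrable (fun z => Real.log ‖F z‖) 0 r :=
  MeromorphicOn.circleIntegrable_log_norm_of_nonneg
    (fun z hz => h z (Metric.sphere_subset_closedBall hz)) hr.le

/-- First fundamental theorem -/
lemma fft {r : ℝ} (hr : 1/2 ≤ r) {F : ℂ → ℂ} (h : GoodF r F) :
    mF r F⁻¹ + NF r F⁻¹ ≤ mF r F + NF r F +
      (2 * |(oF F 0 : ℝ)| + |Real.log ‖meromorphicTrailingCoeffAt F 0‖|) := by
  have hr0 : 0 < r := by linarith
  have habs : |r| = r := abs_of_pos hr0
  have h1 : mF r F - mF r F⁻¹ = Real.circleAverage (fun z => Real.log ‖F z‖) 0 r := by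
    unfold mF
    rw [← Real.circleAverage_sub (GoodF.ci hr0 h.1) (GoodF.ci hr0 h.inv.1)]
    congr 1
    ext z
    simp only [Pi.sub_apply, Pi.inv_apply, norm_inv]
    exact Real.posLog_sub_posLog_inv
  have hj := MeromorphicOn.circleAverage_log_norm (c := 0) (R := r) hr0.ne' (f := F)
    (by rw [habs]; exact h.1)
  rw [habs] at hj
  have h0r : (0:ℂ) ∈ Metric.closedBall (0:ℂ) r := by simp [hr0.le]
  have hd : ∀ u ∈ Metric.closedBall (0:ℂ) r, MeromorphicOn.divisor F (Metric.closedBall 0 r) u = oF F u :=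
    fun u hu => MeromorphicOn.divisor_apply h.1 hu
  rw [finsum_eq_sum_of_support_subset (s := spF r F)] at hj
  swap
  · intro u hu
    unfold spF
    rw [Finset.mem_coe, Set.Finite.mem_toFinset]
    intro hc
    exact hu (by simp only [hc]; simp)
  have hN : NF r F⁻¹ - NF r F = ∑ z ∈ spF r F, (oF F z : ℝ) * Wt r z := by
    rw [NF_eq hr0 h, NF_eq hr0 h.inv, spF_inv h, ← Finset.sum_sub_distrib]
    apply Finset.sum_congr rfl
    intro z _
    rw [oF_inv, ← sub_mul, neg_neg]
    congr 1
    have : max (oF F z) 0 - max (-oF F z) 0 = oF F z := by omega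
    exact_mod_cast this
  have hS : ∑ z ∈ spF r F, (oF F z : ℝ) * Wt r z
      - ∑ u ∈ spF r F, ((MeromorphicOn.divisor F (Metric.closedBall 0 r) u : ℤ):ℝ) * Real.log (r * ‖0 - u‖⁻¹)
      = (oF F 0 : ℝ) * (Real.posLog r + 1) := by
    rw [← Finset.sum_sub_distrib]
    have : ∀ z ∈ spF r F, (oF F z : ℝ) * Wt r z -
        ((MeromorphicOn.divisor F (Metric.closedBall 0 r) z : ℤ):ℝ) * Real.log (r * ‖0 - z‖⁻¹) =
        if z = 0 then (oF F 0 : ℝ) * (Real.posLog r + 1) else 0 := by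
      intro z hz
      have hz1 := ((mem_spF h).1 hz).1
      rw [hd z (by simpa using hz1)]
      split_ifs with h0
      · subst h0; simp [Wt]
      · have hz0 : 0 < ‖z‖ := norm_pos_iff.2 h0
        rw [Wt, if_neg h0, zero_sub, norm_neg, ← div_eq_mul_inv, Real.posLog_eq_log]
        · ring
        · rw [abs_of_pos (by positivity), le_div_iff₀ hz0]; linarith
    rw [Finset.sum_congr rfl this, Finset.sum_ite_eq']
    split_ifs with h0
    · rfl
    · rw [mem_spF h] at h0
      push Not at h0
      have := h0 (by simpa using hr0.le)
      rw [this]; simp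
  rw [hd 0 h0r] at hj
  have hlog : |Real.log r - (Real.posLog r + 1)| ≤ 2 := by
    have h3 : Real.log (1/2) ≤ Real.log r := Real.log_le_log (by norm_num) hr
    have h4 : -1 ≤ Real.log (1/2) := by
      rw [one_div, Real.log_inv]; have := Real.log_two_lt_d9; linarith
    rw [Real.posLog_apply, abs_le]
    rcases max_cases 0 (Real.log r) with h | h <;> constructor <;> linarith [h.1]
  have hm : |(oF F 0 : ℝ) * (Real.log r - (Real.posLog r + 1))| ≤ 2 * |(oF F 0 : ℝ)| := by
    rw [abs_mul, mul_comm]; gcongr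
  have e1 := neg_abs_le ((oF F 0 : ℝ) * (Real.log r - (Real.posLog r + 1)))
  have e2 := neg_abs_le (Real.log ‖meromorphicTrailingCoeffAt F 0‖)
  have e3 : (oF F 0 : ℝ) * (Real.log r - (Real.posLog r + 1)) = (oF F 0 : ℝ) * Real.log r - (oF F 0 : ℝ) * (Real.posLog r + 1) := by ring
  linarith

/-- count -/
lemma count_le {ρ R : ℝ} (hρ : 0 < ρ) (hR : ρ < R) {F : ℂ → ℂ} (h : GoodF R F) :
    ∑ z ∈ spF ρ F, |(oF F z : ℝ)| ≤ R / (R - ρ) * (NF R F + NF R F⁻¹) := by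
  have hR0 : 0 < R := by linarith
  have hs : NF R F + NF R F⁻¹ = ∑ z ∈ spF R F, |(oF F z : ℝ)| * Wt R z := by
    rw [NF_eq hR0 h, NF_eq hR0 h.inv, spF_inv h, ← Finset.sum_add_distrib]
    apply Finset.sum_congr rfl
    intro z _
    rw [oF_inv, ← add_mul, neg_neg]
    congr 1
    have : max (-oF F z) 0 + max (oF F z) 0 = |oF F z| := by
      rcases abs_cases (oF F z) with h | h <;> omega
    exact_mod_cast this
  have hd : 0 < R - ρ := by linarith
  rw [hs, Finset.mul_sum]
  have hsub : spF ρ F ⊆ spF R F := by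
    intro z hz
    rw [mem_spF (h.mono hR.le)] at hz
    rw [mem_spF h]; exact ⟨by linarith [hz.1], hz.2⟩
  refine le_trans ?_ (Finset.sum_le_sum_of_subset_of_nonneg hsub ?_)
  · apply Finset.sum_le_sum
    intro z hz
    have hz1 := ((mem_spF (h.mono hR.le)).1 hz).1
    have := Wt_lower hρ hR hz1
    have h1 : 1 ≤ R / (R - ρ) * Wt R z := by
      calc 1 = R / (R - ρ) * ((R - ρ) / R) := by field_simp
        _ ≤ _ := by gcongr
    nlinarith [abs_nonneg (oF F z : ℝ)]
  · intro z _ _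
    have := Wt_nonneg R z
    positivity

lemma factF {ρ : ℝ} (hρ : 0 < ρ) {F : ℂ → ℂ} (h : GoodF ρ F) :
    ∃ g : ℂ → ℂ, AnalyticOnNhd ℂ g (Metric.closedBall 0 ρ) ∧ (∀ u ∈ Metric.closedBall 0 ρ, g u ≠ 0) ∧
      ∀ z ∈ Metric.closedBall (0:ℂ) ρ, F =ᶠ[𝓝[≠] z] fun w => (∏ u ∈ spF ρ F, (w - u) ^ (oF F u)) * g w := by
  have hfin := (MeromorphicOn.divisor F (Metric.closedBall 0 ρ)).finiteSupport (isCompact_closedBall 0 ρ)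
  obtain ⟨g, h1, h2, h3⟩ := MeromorphicOn.extract_zeros_poles (U := Metric.closedBall 0 ρ) (f := F) h.1 (fun u => h.2 u u.2) hfin
  refine ⟨g, h1, fun u hu => h2 ⟨u, hu⟩, fun z hz => ?_⟩
  have hpp : Preperfect (Metric.closedBall (0:ℂ) ρ) := by
    apply IsPreconnected.preperfect_of_nontrivial _ (convex_closedBall _ _).isPreconnected
    exact ⟨0, by simp [hρ.le], (ρ:ℂ), by simp [abs_of_pos hρ], by exact_mod_cast hρ.ne⟩
  have heq : ((∏ᶠ u, (· - u) ^ (MeromorphicOn.divisor F (Metric.closedBall 0 ρ)) u) • g : ℂ → ℂ) = fun w => (∏ u ∈ spF ρ F, (w - u) ^ (oF F u)) * g w := by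
    ext w
    rw [Function.FactorizedRational.finprod_eq_fun hfin]
    simp only [Pi.smul_apply', smul_eq_mul]
    congr 1
    rw [finprod_eq_prod_of_mulSupport_subset (s := spF ρ F)]
    · apply Finset.prod_congr rfl
      intro u hu
      have := ((mem_spF h).1 hu).1
      rw [MeromorphicOn.divisor_apply h.1 (by simpa using this)]; rfl
    · intro u hu
      unfold spF
      rw [Finset.mem_coe, Set.Finite.mem_toFinset]
      intro hc
      exact hu (by simp only [hc]; simp)
  rw [heq] at h3
  refine MeromorphicAt.eventuallyEq_nhdsNE_of_eventuallyEq_codiscreteWithin_preperfect (h.1 z hz) ?_ hz hpp h3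
  have := (h1 z hz).meromorphicAt
  fun_prop

lemma mF_congr {r : ℝ} (hr : 0 < r) {F G : ℂ → ℂ} (h : ∀ z, ‖z‖ = r → F =ᶠ[𝓝[≠] z] G) : mF r F = mF r G := by
  apply Real.circleAverage_congr_codiscreteWithin _ hr.ne'
  rw [Filter.EventuallyEq, Filter.Eventually, mem_codiscreteWithin_iff_forall_mem_nhdsNE]
  intro z hz
  rw [abs_of_pos hr] at hz
  filter_upwards [h z (by simpa using hz)] with w hw
  left; simp [hw]

end


open Complex Filter Topology MeasureTheory
open scoped Classical

noncomputable section

lemma abs_log_eq (x : ℝ) : |Real.log x| = Real.posLog x + Real.posLog x⁻¹ := by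
  rw [← Real.half_mul_log_add_log_abs, ← Real.half_mul_log_add_log_abs, Real.log_inv, abs_neg]; ring

lemma ci_log_sub (c : ℂ) (r : ℝ) : CircleIntegrable (fun z => Real.log ‖z - c‖) 0 r :=
  circleIntegrable_log_norm_sub_const r

lemma ci_abs_log_sub (c : ℂ) (r : ℝ) : CircleIntegrable (fun z => |Real.log ‖z - c‖|) 0 r :=
  (ci_log_sub c r).abs

lemma ci_cmul {f : ℂ → ℝ} {r : ℝ} (a : ℝ) (h : CircleIntegrable f 0 r) : CircleIntegrable (fun z => a * f z) 0 r :=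
  IntervalIntegrable.const_mul h a

lemma ci_cabs {f : ℂ → ℝ} {r : ℝ} (h : CircleIntegrable f 0 r) : CircleIntegrable (fun z => |f z|) 0 r := h.abs

lemma ne_ev {z u : ℂ} : ∀ᶠ w in 𝓝[≠] z, w ≠ u := by
  by_cases huz : u = z
  · rw [huz]; exact self_mem_nhdsWithin
  · have h : ∀ᶠ w in 𝓝 z, w ≠ u := isOpen_ne.mem_nhds (Ne.symm huz)
    exact h.filter_mono nhdsWithin_le_nhds

lemma avg_abs_log {r ρ : ℝ} (hr : 1/2 ≤ r) (h : r ≤ ρ) {c : ℂ} (hc : ‖c‖ ≤ ρ) :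
    Real.circleAverage (fun z => |Real.log ‖z - c‖|) 0 r ≤ 4 * (1 + Real.posLog ρ) := by
  have hr0 : 0 < r := by linarith
  have h1 := circleAverage_log_norm_sub_const_eq_log_radius_add_posLog (a := c) (c := 0) hr0.ne'
  have hci := ci_log_sub c r
  have h2 : Real.circleAverage (fun z => |Real.log ‖z - c‖|) 0 r + Real.circleAverage (fun z => Real.log ‖z - c‖) 0 r
      ≤ 2 * Real.posLog (2 * ρ) := by
    rw [← Real.circleAverage_fun_add (ci_cabs hci) hci]
    apply Real.circleAverage_mono_on_of_le_circle (hci.abs.add hci)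
    intro z hz
    rw [abs_of_pos hr0] at hz
    have hz' : ‖z‖ = r := by simpa using hz
    have h3 := Real.half_mul_log_add_log_abs (x := ‖z - c‖)
    have h4 : Real.posLog ‖z - c‖ ≤ Real.posLog (2 * ρ) := by
      apply Real.posLog_le_posLog (norm_nonneg _)
      have := norm_sub_le z c
      linarith
    change |Real.log ‖z - c‖| + Real.log ‖z - c‖ ≤ _
    linarith
  have h5 : Real.posLog (2 * ρ) ≤ Real.posLog 2 + Real.posLog ρ := Real.posLog_mul
  have h6 : Real.posLog 2 = Real.log 2 := Real.posLog_eq_log (by norm_num)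
  have h7 := Real.log_two_lt_d9
  have h8 : Real.log (1/2) ≤ Real.log r := Real.log_le_log (by norm_num) hr
  rw [one_div, Real.log_inv] at h8
  have h9 : 0 ≤ Real.posLog (r⁻¹ * ‖0 - c‖) := Real.posLog_nonneg
  have h10 : 0 ≤ Real.posLog ρ := Real.posLog_nonneg
  linarith

lemma avg_log_g {ρ : ℝ} (hρ : 1/2 ≤ ρ) {F g : ℂ → ℂ} (h : GoodF ρ F) (hg : AnalyticOnNhd ℂ g (Metric.closedBall 0 ρ))
    (h0 : ∀ u ∈ Metric.closedBall 0 ρ, g u ≠ 0)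
    (hF : ∀ z ∈ Metric.closedBall (0:ℂ) ρ, F =ᶠ[𝓝[≠] z] fun w => (∏ u ∈ spF ρ F, (w - u) ^ (oF F u)) * g w) :
    Real.circleAverage (fun z => |Real.log ‖g z‖|) 0 ρ ≤ mF ρ F + mF ρ F⁻¹ +
      (∑ z ∈ spF ρ F, |(oF F z : ℝ)|) * (4 * (1 + Real.posLog ρ)) := by
  have hρ0 : 0 < ρ := by linarith
  have hcg : CircleIntegrable (fun z => |Real.log ‖g z‖|) 0 ρ :=
    (GoodF.cil hρ0 (fun z hz => (hg z hz).meromorphicAt)).abs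
  have hcF : CircleIntegrable (fun z => Real.log ‖F z‖) 0 ρ := GoodF.cil hρ0 h.1
  have hcs : CircleIntegrable (fun z => ∑ u ∈ spF ρ F, |(oF F u : ℝ)| * |Real.log ‖z - u‖|) 0 ρ := by
    apply CircleIntegrable.fun_sum
    intro u hu
    exact (ci_log_sub u ρ).abs.const_mul _
  have hcs2 : CircleIntegrable (fun z => ∑ u ∈ spF ρ F, (oF F u : ℝ) * Real.log ‖z - u‖) 0 ρ := by
    apply CircleIntegrable.fun_sum
    intro u hu
    exact (ci_log_sub u ρ).const_mul _
  have e1 : Real.circleAverage (fun z => |Real.log ‖g z‖|) 0 ρ =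
      Real.circleAverage (fun z => |Real.log ‖F z‖ - ∑ u ∈ spF ρ F, (oF F u : ℝ) * Real.log ‖z - u‖|) 0 ρ := by
    apply Real.circleAverage_congr_codiscreteWithin _ hρ0.ne'
    rw [Filter.EventuallyEq, Filter.Eventually, mem_codiscreteWithin_iff_forall_mem_nhdsNE]
    intro z hz
    rw [abs_of_pos hρ0] at hz
    have hzc := Metric.sphere_subset_closedBall hz
    have hgz : ∀ᶠ w in 𝓝[≠] z, g w ≠ 0 :=
      ((hg z hzc).continuousAt.eventually_ne (h0 z hzc)).filter_mono nhdsWithin_le_nhds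
    have hu : ∀ᶠ w in 𝓝[≠] z, ∀ u ∈ spF ρ F, w ≠ u := by
      rw [Filter.eventually_all_finset]
      intro u _
      exact ne_ev
    filter_upwards [hF z hzc, hgz, hu] with w hw hgw huw
    left
    simp only [Set.mem_ofPred_eq]
    have hne : ∀ u ∈ spF ρ F, ‖w - u‖ ≠ 0 := fun u hu => norm_ne_zero_iff.2 (sub_ne_zero.2 (huw u hu))
    have : Real.log ‖F w‖ = ∑ u ∈ spF ρ F, (oF F u : ℝ) * Real.log ‖w - u‖ + Real.log ‖g w‖ := by
      rw [hw, norm_mul, norm_prod, Real.log_mul _ (norm_ne_zero_iff.2 hgw), Real.log_prod]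
      · congr 1
        apply Finset.sum_congr rfl
        intro u hu
        rw [norm_zpow, Real.log_zpow]
      · intro u hu; rw [norm_zpow]; exact zpow_ne_zero _ (hne u hu)
      · rw [Finset.prod_ne_zero_iff]; intro u hu; rw [norm_zpow]; exact zpow_ne_zero _ (hne u hu)
    rw [this]; ring_nf
  rw [e1]
  have e2 : mF ρ F + mF ρ F⁻¹ = Real.circleAverage (fun z => |Real.log ‖F z‖|) 0 ρ := by
    unfold mF
    rw [← Real.circleAverage_fun_add (GoodF.ci hρ0 h.1) (GoodF.ci hρ0 h.inv.1)]
    congr 1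
    ext z; simp only [Pi.inv_apply, norm_inv]; rw [abs_log_eq]
  rw [e2]
  have e3 : Real.circleAverage (fun z => ∑ u ∈ spF ρ F, |(oF F u : ℝ)| * |Real.log ‖z - u‖|) 0 ρ ≤
      (∑ z ∈ spF ρ F, |(oF F z : ℝ)|) * (4 * (1 + Real.posLog ρ)) := by
    rw [Real.circleAverage_fun_sum (fun u hu => ci_cmul |(oF F u : ℝ)| (ci_abs_log_sub u ρ)), Finset.sum_mul]
    apply Finset.sum_le_sum
    intro u hu
    have := Real.circleAverage_fun_smul (a := |(oF F u : ℝ)|) (f := fun z => |Real.log ‖z - u‖|) (c := 0) (R := ρ)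
    simp only [smul_eq_mul] at this
    rw [this]
    exact mul_le_mul_of_nonneg_left (avg_abs_log hρ le_rfl ((mem_spF h).1 hu).1) (abs_nonneg _)
  refine le_trans ?_ (add_le_add_right e3 _)
  rw [← Real.circleAverage_fun_add (ci_cabs hcF) hcs]
  apply Real.circleAverage_mono (hcF.sub hcs2).abs (hcF.abs.add hcs)
  intro z _
  refine (abs_sub _ _).trans (add_le_add le_rfl ?_)
  refine (Finset.abs_sum_le_sum_abs _ _).trans (Finset.sum_le_sum fun u _ => ?_)
  rw [abs_mul]

lemma logsqrt_ineq {X B : ℝ} (hX : 0 ≤ X) (hB : 0 ≤ B) :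
    Real.posLog X ≤ 2 * (Real.log (1 + B) + (X ^ (1/2 : ℝ) - B) / (1 + B)) := by
  set Y := X ^ (1/2 : ℝ)
  have hY : 0 ≤ Y := by positivity
  have hXY : X = Y ^ 2 := by
    simp only [Y]; rw [← Real.rpow_natCast, ← Real.rpow_mul hX]; norm_num
  have h1 : Real.posLog X ≤ 2 * Real.log (1 + Y) := by
    rw [Real.posLog_apply]
    apply max_le
    · have := Real.log_nonneg (show 1 ≤ 1 + Y by linarith); linarith
    · rcases eq_or_lt_of_le hY with h | h
      · rw [hXY, ← h]; simp
      · rw [hXY, Real.log_pow]; push_cast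
        have := Real.log_le_log h (show Y ≤ 1 + Y by linarith)
        linarith
  have h2 : Real.log (1 + Y) ≤ Real.log (1 + B) + (Y - B) / (1 + B) := by
    have h3 := Real.log_le_sub_one_of_pos (show 0 < (1 + Y) / (1 + B) by positivity)
    rw [Real.log_div (by positivity) (by positivity)] at h3
    have h4 : (1 + Y) / (1 + B) - 1 = (Y - B) / (1 + B) := by field_simp; ring
    linarith
  linarith

lemma rpow_half_sum (s : Finset ℂ) (f : ℂ → ℝ) (hf : ∀ u, 0 ≤ f u) :
    (∑ u ∈ s, f u) ^ (1/2 : ℝ) ≤ ∑ u ∈ s, (f u) ^ (1/2 : ℝ) := by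
  induction s using Finset.induction_on with
  | empty => simp
  | insert a s ha ih =>
    rw [Finset.sum_insert ha, Finset.sum_insert ha]
    refine (Real.rpow_add_le_add_rpow (hf a) (Finset.sum_nonneg fun u _ => hf u) (by norm_num) (by norm_num)).trans ?_
    linarith

/-- lemma on the logarithmic derivative, structural form -/
lemma lld {r ρ : ℝ} (hr : 1/2 ≤ r) (hρ : r < ρ) {F : ℂ → ℂ} (h : GoodF ρ F) :
    mF r (fun z => deriv F z / F z) ≤ 2 * Real.log (1 + ((2 * ρ / (ρ - r) ^ 2 * (mF ρ F + mF ρ F⁻¹ +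
      (∑ z ∈ spF ρ F, |(oF F z : ℝ)|) * (4 * (1 + Real.posLog ρ)))) ^ (1/2 : ℝ)
      + sqK * ∑ z ∈ spF ρ F, |(oF F z : ℝ)|)) := by
  have hr0 : 0 < r := by linarith
  have hρ0 : 0 < ρ := by linarith
  obtain ⟨g, hg, h0, hF⟩ := factF hρ0 h
  set S := spF ρ F
  set n := ∑ z ∈ S, |(oF F z : ℝ)|
  set A := 2 * ρ / (ρ - r) ^ 2 * (mF ρ F + mF ρ F⁻¹ + n * (4 * (1 + Real.posLog ρ))) with hA
  have hn : 0 ≤ n := Finset.sum_nonneg fun _ _ => abs_nonneg _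
  have hA0 : 0 ≤ A := by
    have := mF_nonneg ρ F
    have := mF_nonneg ρ F⁻¹
    have := Real.posLog_nonneg (x := ρ)
    positivity
  set X : ℂ → ℂ := fun z => ∑ u ∈ S, (oF F u : ℂ) / (z - u) + deriv g z / g z with hX
  have hrρ : ∀ z : ℂ, ‖z‖ = r → z ∈ Metric.closedBall (0:ℂ) ρ := fun z hz => by simp; linarith
  have e1 : mF r (fun z => deriv F z / F z) = mF r X := by
    apply mF_congr hr0
    intro z hz
    have hzc := hrρ z hz
    have hzb : z ∈ Metric.ball (0:ℂ) ρ := by simp; linarith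
    have hgz : ∀ᶠ w in 𝓝[≠] z, w ∈ Metric.ball (0:ℂ) ρ :=
      mem_nhdsWithin_of_mem_nhds (Metric.isOpen_ball.mem_nhds hzb)
    have hu : ∀ᶠ w in 𝓝[≠] z, ∀ u ∈ S, w ≠ u := by
      rw [Filter.eventually_all_finset]
      intro u _
      exact ne_ev
    filter_upwards [hF z hzc, (hF z hzc).nhdsNE_deriv, hgz, hu] with w h1 h2 h3 h4
    rw [h1, h2]
    have hwc := Metric.ball_subset_closedBall h3
    have hne : ∀ u ∈ S, w - u ≠ 0 := fun u hu => sub_ne_zero.2 (h4 u hu)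
    have hz1 : ∀ u ∈ S, (fun z : ℂ => (z - u) ^ (oF F u)) w ≠ 0 := fun u hu => zpow_ne_zero _ (hne u hu)
    have hz2 : ∀ u ∈ S, DifferentiableAt ℂ (fun z : ℂ => (z - u) ^ (oF F u)) w := fun u hu =>
      (differentiableAt_id.sub_const u).zpow (Or.inl (hne u hu))
    have := logDeriv_mul (f := fun w => ∏ u ∈ S, (w - u) ^ (oF F u)) (g := g) w
      (Finset.prod_ne_zero_iff.2 hz1) (h0 w hwc) (DifferentiableAt.fun_finsetProd hz2) (hg w hwc).differentiableAt
    rw [logDeriv_apply, logDeriv_prod (𝕜 := ℂ) (f := fun u z => (z - u) ^ oF F u) hz1 hz2, logDeriv_apply] at this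
    rw [this, hX]
    congr 1
    apply Finset.sum_congr rfl
    intro u hu
    rw [logDeriv_fun_zpow (f := fun z => z - u) (by fun_prop), logDeriv_apply]
    simp [div_eq_mul_inv]
  have hXm : ∀ z ∈ Metric.closedBall (0:ℂ) r, MeromorphicAt X z := by
    intro z hz
    have hgz := hg z (Metric.closedBall_subset_closedBall hρ.le hz)
    have := hgz.meromorphicAt
    have := hgz.deriv.meromorphicAt
    fun_prop
  rw [e1]
  set B := A ^ (1/2 : ℝ) + sqK * n with hB
  have hB0 : 0 ≤ B := by have := sqK_pos; positivity
  have hcs : CircleIntegrable (fun z => ∑ u ∈ S, |(oF F u : ℝ)| * ‖z - u‖ ^ (-(1/2) : ℝ)) 0 r := by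
    apply CircleIntegrable.fun_sum
    intro u hu
    exact (inv_sqrt_avg hr u).1.const_mul _
  have havg : Real.circleAverage (fun z => ∑ u ∈ S, |(oF F u : ℝ)| * ‖z - u‖ ^ (-(1/2) : ℝ)) 0 r ≤ sqK * n := by
    rw [Real.circleAverage_fun_sum (fun u hu => ci_cmul |(oF F u : ℝ)| (inv_sqrt_avg hr u).1), mul_comm, Finset.sum_mul]
    apply Finset.sum_le_sum
    intro u hu
    have := Real.circleAverage_fun_smul (a := |(oF F u : ℝ)|) (f := fun z => ‖z - u‖ ^ (-(1/2) : ℝ)) (c := 0) (R := r)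
    simp only [smul_eq_mul] at this
    rw [this]
    exact mul_le_mul_of_nonneg_left (inv_sqrt_avg hr u).2 (abs_nonneg _)
  set q : ℂ → ℝ := fun z => ∑ u ∈ S, |(oF F u : ℝ)| * ‖z - u‖ ^ (-(1/2) : ℝ) with hq
  have hcc : CircleIntegrable (fun z => (2 * Real.log (1 + B) + 2 * (A ^ (1/2 : ℝ) - B) / (1 + B)) + (2 / (1 + B)) * q z) 0 r :=
    (circleIntegrable_const _ _ _).add (hcs.const_mul _)
  have hpt : ∀ z ∈ Metric.sphere (0:ℂ) |r|, Real.posLog ‖X z‖ ≤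
      (2 * Real.log (1 + B) + 2 * (A ^ (1/2 : ℝ) - B) / (1 + B)) + (2 / (1 + B)) * q z := by
    intro z hz
    rw [abs_of_pos hr0] at hz
    have hz' : ‖z‖ = r := by simpa using hz
    have h1 : ‖X z‖ ≤ A + ∑ u ∈ S, |(oF F u : ℝ)| * ‖z - u‖⁻¹ := by
      have h2 := nv_logDeriv_le hr0.le hρ hg h0 hz'.le
      have h3 := avg_log_g (by linarith) h hg h0 hF
      have h4 : ‖deriv g z / g z‖ ≤ A := h2.trans (by rw [hA]; gcongr)
      refine (norm_add_le _ _).trans ?_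
      rw [add_comm]
      refine add_le_add h4 ((norm_sum_le _ _).trans (Finset.sum_le_sum fun u _ => ?_))
      rw [norm_div, div_eq_mul_inv]
      apply le_of_eq; congr 1
      rw [← Complex.norm_intCast]
    have h5 : ‖X z‖ ^ (1/2 : ℝ) ≤ A ^ (1/2 : ℝ) + q z := by
      have hnn : ∀ u, 0 ≤ |(oF F u : ℝ)| * ‖z - u‖⁻¹ := fun u => by positivity
      calc _ ≤ (A + ∑ u ∈ S, |(oF F u : ℝ)| * ‖z - u‖⁻¹) ^ (1/2 : ℝ) := Real.rpow_le_rpow (norm_nonneg _) h1 (by norm_num)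
        _ ≤ A ^ (1/2 : ℝ) + (∑ u ∈ S, |(oF F u : ℝ)| * ‖z - u‖⁻¹) ^ (1/2 : ℝ) :=
          Real.rpow_add_le_add_rpow hA0 (Finset.sum_nonneg fun u _ => hnn u) (by norm_num) (by norm_num)
        _ ≤ A ^ (1/2 : ℝ) + ∑ u ∈ S, (|(oF F u : ℝ)| * ‖z - u‖⁻¹) ^ (1/2 : ℝ) := by
          gcongr; exact rpow_half_sum _ _ hnn
        _ ≤ _ := by
          refine add_le_add le_rfl (Finset.sum_le_sum fun u hu => ?_)
          rw [Real.mul_rpow (abs_nonneg _) (by positivity), Real.inv_rpow (norm_nonneg _), ← Real.rpow_neg (norm_nonneg _)]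
          gcongr
          have habsor : |(oF F u : ℝ)| = 0 ∨ 1 ≤ |(oF F u : ℝ)| := by
            by_cases h : oF F u = 0
            · left; simp [h]
            · right; exact_mod_cast Int.one_le_abs h
          rcases habsor with h | h
          · rw [h]; simp
          · calc _ ≤ |(oF F u : ℝ)| ^ (1:ℝ) := Real.rpow_le_rpow_of_exponent_le h (by norm_num)
              _ = _ := Real.rpow_one _
    refine (logsqrt_ineq (norm_nonneg (X z)) hB0).trans ?_
    have h6 : (‖X z‖ ^ (1/2 : ℝ) - B) / (1 + B) ≤ (A ^ (1/2 : ℝ) + q z - B) / (1 + B) := by gcongr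
    have h7 : (A ^ (1/2 : ℝ) + q z - B) / (1 + B) = (A ^ (1/2 : ℝ) - B) / (1 + B) + q z / (1 + B) := by ring
    have h8 : 2 / (1 + B) * q z = 2 * (q z / (1 + B)) := by ring
    have h9 : 2 * (A ^ (1/2 : ℝ) - B) / (1 + B) = 2 * ((A ^ (1/2 : ℝ) - B) / (1 + B)) := by ring
    linarith
  unfold mF
  refine (Real.circleAverage_mono (GoodF.ci hr0 hXm) hcc hpt).trans ?_
  rw [Real.circleAverage_fun_add (circleIntegrable_const _ _ _) (ci_cmul _ hcs), Real.circleAverage_const]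
  have := Real.circleAverage_fun_smul (a := 2 / (1 + B)) (f := q) (c := 0) (R := r)
  simp only [smul_eq_mul] at this
  rw [this]
  have h10 : 2 / (1 + B) * Real.circleAverage q 0 r ≤ 2 / (1 + B) * (sqK * n) := by gcongr
  have h11 : 2 * (A ^ (1/2 : ℝ) - B) / (1 + B) + 2 / (1 + B) * (sqK * n) = 0 := by rw [hB]; ring
  linarith

/-- local boundedness of the proximity function -/
lemma mF_bdd {r ρ : ℝ} (hr : 1/2 ≤ r) (hρ : r ≤ ρ) {F : ℂ → ℂ} (h : GoodF ρ F) :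
    ∃ B, ∀ t, r ≤ t → t ≤ ρ → mF t F ≤ B := by
  have hρ0 : 0 < ρ := by linarith
  obtain ⟨g, hg, h0, hF⟩ := factF hρ0 h
  have hgc : ContinuousOn g (Metric.closedBall 0 ρ) := fun z hz => (hg z hz).continuousAt.continuousWithinAt
  obtain ⟨G, hG⟩ := (isCompact_closedBall (0:ℂ) ρ).exists_bound_of_continuousOn hgc
  refine ⟨Real.posLog G + (∑ z ∈ spF ρ F, |(oF F z : ℝ)|) * (4 * (1 + Real.posLog ρ)), fun t ht1 ht2 => ?_⟩
  have ht0 : 0 < t := by linarith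
  have hmem : ∀ z : ℂ, ‖z‖ = t → z ∈ Metric.closedBall (0:ℂ) ρ := fun z hz => by simp; linarith
  rw [mF_congr ht0 (fun z hz => hF z (hmem z hz))]
  have hcs : CircleIntegrable (fun z => ∑ u ∈ spF ρ F, |(oF F u : ℝ)| * |Real.log ‖z - u‖|) 0 t := by
    apply CircleIntegrable.fun_sum
    intro u hu
    exact (ci_log_sub u t).abs.const_mul _
  have e3 : Real.circleAverage (fun z => ∑ u ∈ spF ρ F, |(oF F u : ℝ)| * |Real.log ‖z - u‖|) 0 t ≤
      (∑ z ∈ spF ρ F, |(oF F z : ℝ)|) * (4 * (1 + Real.posLog ρ)) := by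
    rw [Real.circleAverage_fun_sum (fun u hu => ci_cmul |(oF F u : ℝ)| (ci_abs_log_sub u t)), Finset.sum_mul]
    apply Finset.sum_le_sum
    intro u hu
    have := Real.circleAverage_fun_smul (a := |(oF F u : ℝ)|) (f := fun z => |Real.log ‖z - u‖|) (c := 0) (R := t)
    simp only [smul_eq_mul] at this
    rw [this]
    exact mul_le_mul_of_nonneg_left (avg_abs_log (by linarith) ht2 ((mem_spF h).1 hu).1) (abs_nonneg _)
  have hci : CircleIntegrable (fun z => Real.posLog ‖(∏ u ∈ spF ρ F, (z - u) ^ (oF F u)) * g z‖) 0 t := by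
    apply GoodF.ci ht0
    intro z hz
    have := (hg z (Metric.closedBall_subset_closedBall ht2 hz)).meromorphicAt
    fun_prop
  have : mF t (fun w => (∏ u ∈ spF ρ F, (w - u) ^ (oF F u)) * g w) ≤
      Real.circleAverage (fun z => Real.posLog G + ∑ u ∈ spF ρ F, |(oF F u : ℝ)| * |Real.log ‖z - u‖|) 0 t := by
    apply Real.circleAverage_mono hci ((circleIntegrable_const _ _ _).add hcs)
    intro z hz
    rw [abs_of_pos ht0] at hz
    rw [norm_mul, mul_comm]
    refine Real.posLog_mul.trans (add_le_add ?_ ?_)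
    · exact Real.posLog_le_posLog (norm_nonneg _) (hG z (hmem z (by simpa using hz)))
    · rw [norm_prod]
      refine (Real.posLog_prod _ _).trans (Finset.sum_le_sum fun u _ => ?_)
      rw [norm_zpow, Real.posLog_apply, Real.log_zpow, ← abs_mul]
      exact max_le (abs_nonneg _) (le_abs_self _)
  rw [Real.circleAverage_fun_add (circleIntegrable_const _ _ _) hcs, Real.circleAverage_const] at this
  linarith

end


open Complex Filter Topology MeasureTheory
open scoped Classical

noncomputable section

/-- a domain (image of discs under ψ) on which growth is measured -/
structure Dom where
  rad : Set ℝ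
  half : ∀ r ∈ rad, 1/2 ≤ r
  oc : ∀ r ∈ rad, ∀ t, 1/2 ≤ t → t ≤ r → t ∈ rad
  ψ : ℂ → ℂ
  an : ∀ r ∈ rad, ∀ z, ‖z‖ ≤ r → AnalyticAt ℂ ψ z
  dpos : ∀ r ∈ rad, ∀ z, ‖z‖ ≤ r → 1/2 ≤ ‖deriv ψ z‖
  base : ℝ → ℝ
  base_one : ∀ r ∈ rad, 1 ≤ base r
  base_mono : ∀ r ∈ rad, ∀ ρ ∈ rad, r ≤ ρ → base r ≤ base ρ
  base_log : ∀ r ∈ rad, Real.posLog r ≤ base r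
  zB : ∃ C, ∀ r ∈ rad, mF r ψ ≤ C * base r

namespace Dom
variable (D : Dom)

def mm (r : ℝ) (h : Mer) : ℝ := mF r (h.rep ∘ D.ψ)
def nn (r : ℝ) (h : Mer) : ℝ := NF r (h.rep ∘ D.ψ)
def tt (r : ℝ) (h : Mer) : ℝ := D.mm r h + D.nn r h

variable {D}

lemma dne {r : ℝ} (hr : r ∈ D.rad) {z : ℂ} (hz : ‖z‖ ≤ r) : deriv D.ψ z ≠ 0 := by
  intro h; have := D.dpos r hr z hz; rw [h] at this; norm_num at this

lemma r0 {r : ℝ} (hr : r ∈ D.rad) : 0 < r := by have := D.half r hr; linarith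

lemma b0 {r : ℝ} (hr : r ∈ D.rad) : 0 < D.base r := by have := D.base_one r hr; linarith

lemma tend {r : ℝ} (hr : r ∈ D.rad) {z : ℂ} (hz : ‖z‖ ≤ r) : Tendsto D.ψ (𝓝[≠] z) (𝓝[≠] (D.ψ z)) :=
  (D.an r hr z hz).differentiableAt.hasDerivAt.tendsto_nhdsNE (dne hr hz)

lemma comp_ev {r : ℝ} (hr : r ∈ D.rad) {z : ℂ} (hz : ‖z‖ ≤ r) {F G : ℂ → ℂ} (h : ∀ w, F =ᶠ[𝓝[≠] w] G) :
    F ∘ D.ψ =ᶠ[𝓝[≠] z] G ∘ D.ψ := (tend hr hz).eventually (h (D.ψ z))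

lemma oF_comp {r : ℝ} (hr : r ∈ D.rad) {z : ℂ} (hz : ‖z‖ ≤ r) (h : Mer) : oF (h.rep ∘ D.ψ) z = Mer.v (D.ψ z) h := by
  unfold oF Mer.v Mer.ord
  rw [meromorphicOrderAt_comp_of_deriv_ne_zero (D.an r hr z hz) (dne hr hz)]
  rfl

lemma mero {r : ℝ} (hr : r ∈ D.rad) (h : Mer) : ∀ z ∈ Metric.closedBall (0:ℂ) r, MeromorphicAt (h.rep ∘ D.ψ) z :=
  fun z hz => (h.rep_mero _).comp_analyticAt (D.an r hr z (by simpa using hz))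

lemma good {r : ℝ} (hr : r ∈ D.rad) {h : Mer} (hh : h ≠ 0) : GoodF r (h.rep ∘ D.ψ) :=
  ⟨mero hr h, fun z hz => by
    have hz' : ‖z‖ ≤ r := by simpa using hz
    rw [meromorphicOrderAt_comp_of_deriv_ne_zero (D.an r hr z hz') (dne hr hz')]
    exact fun h1 => hh (Mer.ord_top_imp (z := D.ψ z) h1)⟩

/-- pole multiplicity as a real number -/
def pm (z : ℂ) (h : Mer) : ℝ := ((max (-(Mer.v z h)) 0 : ℤ) : ℝ)

lemma pm_nonneg (z : ℂ) (h : Mer) : 0 ≤ pm z h := by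
  unfold pm; exact_mod_cast le_max_right _ _

lemma sum_le_nn {r : ℝ} (hr : r ∈ D.rad) (h : Mer) (S : Finset ℂ) (hS : ∀ z ∈ S, ‖z‖ ≤ r) :
    ∑ z ∈ S, pm (D.ψ z) h * Wt r z ≤ D.nn r h := by
  by_cases hh : h = 0
  · rw [Finset.sum_eq_zero]
    · exact NF_nonneg _ _
    · intro z _; simp [pm, hh, Mer.v_zero]
  unfold nn
  rw [NF_eq (r0 hr) (good hr hh)]
  have e : ∀ z, ‖z‖ ≤ r → ((max (-(oF (h.rep ∘ D.ψ) z)) 0 : ℤ) : ℝ) = pm (D.ψ z) h := by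
    intro z hz; rw [oF_comp hr hz]; rfl
  have e2 : ∑ z ∈ spF r (h.rep ∘ D.ψ), ((max (-(oF (h.rep ∘ D.ψ) z)) 0 : ℤ) : ℝ) * Wt r z =
      ∑ z ∈ spF r (h.rep ∘ D.ψ), pm (D.ψ z) h * Wt r z :=
    Finset.sum_congr rfl (fun z hz => by rw [e z ((mem_spF (good hr hh)).1 hz).1])
  rw [e2]
  rw [← Finset.sum_filter_add_sum_filter_not S (fun z => z ∈ spF r (h.rep ∘ D.ψ))]
  rw [Finset.sum_eq_zero (s := S.filter (fun z => ¬ z ∈ spF r (h.rep ∘ D.ψ)))]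
  · rw [add_zero]
    apply Finset.sum_le_sum_of_subset_of_nonneg
    · intro z hz; exact (Finset.mem_filter.1 hz).2
    · intro z _ _; exact mul_nonneg (pm_nonneg _ _) (Wt_nonneg _ _)
  · intro z hz
    rw [Finset.mem_filter, mem_spF (good hr hh)] at hz
    have : oF (h.rep ∘ D.ψ) z = 0 := by
      by_contra h1; exact hz.2 ⟨hS z hz.1, h1⟩
    rw [← e z (hS z hz.1), this]; simp

lemma nn_le {r : ℝ} (hr : r ∈ D.rad) (h : Mer) {B : ℝ}
    (hB : ∀ S : Finset ℂ, (∀ z ∈ S, ‖z‖ ≤ r) → ∑ z ∈ S, pm (D.ψ z) h * Wt r z ≤ B) : D.nn r h ≤ B := by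
  by_cases hh : h = 0
  · have h0 : D.nn r h = 0 := by
      unfold nn NF
      rw [finsum_eq_zero_of_forall_eq_zero]
      intro z
      by_cases hz : ‖z‖ ≤ r
      · rw [oF_comp hr hz, hh, Mer.v_zero]; simp
      · rw [Wt_out (r0 hr) (not_le.1 hz).le, mul_zero]
    rw [h0]; simpa using hB ∅
  unfold nn
  rw [NF_eq (r0 hr) (good hr hh)]
  rw [Finset.sum_congr rfl (fun z hz => by rw [oF_comp hr ((mem_spF (good hr hh)).1 hz).1])]
  exact hB _ (fun z hz => ((mem_spF (good hr hh)).1 hz).1)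

/-- comparison of pole counting functions -/
lemma nn_le_comb {r : ℝ} (hr : r ∈ D.rad) {h k : Mer} {a b : ℝ} (l : Mer) (ha : 0 ≤ a) (hb : 0 ≤ b)
    (H : ∀ z, ‖z‖ ≤ r → pm (D.ψ z) h ≤ a * pm (D.ψ z) k + b * pm (D.ψ z) l) :
    D.nn r h ≤ a * D.nn r k + b * D.nn r l := by
  apply nn_le hr
  intro S hS
  calc _ ≤ ∑ z ∈ S, (a * pm (D.ψ z) k + b * pm (D.ψ z) l) * Wt r z :=
        Finset.sum_le_sum fun z hz => mul_le_mul_of_nonneg_right (H z (hS z hz)) (Wt_nonneg _ _)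
    _ = a * ∑ z ∈ S, pm (D.ψ z) k * Wt r z + b * ∑ z ∈ S, pm (D.ψ z) l * Wt r z := by
        rw [Finset.mul_sum, Finset.mul_sum, ← Finset.sum_add_distrib]
        apply Finset.sum_congr rfl; intro z _; ring
    _ ≤ _ := add_le_add (mul_le_mul_of_nonneg_left (sum_le_nn hr k S hS) ha)
        (mul_le_mul_of_nonneg_left (sum_le_nn hr l S hS) hb)

lemma nn_nonneg (r : ℝ) (h : Mer) : 0 ≤ D.nn r h := NF_nonneg _ _
lemma mm_nonneg (r : ℝ) (h : Mer) : 0 ≤ D.mm r h := mF_nonneg _ _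
lemma tt_nonneg (r : ℝ) (h : Mer) : 0 ≤ D.tt r h := add_nonneg (mm_nonneg _ _) (nn_nonneg _ _)

/-- proximity comparison -/
lemma mF_le {r : ℝ} (hr : 0 < r) {F : ℂ → ℂ} {q : ℂ → ℝ} (hF : ∀ z ∈ Metric.closedBall (0:ℂ) r, MeromorphicAt F z)
    (hq : CircleIntegrable q 0 r) (H : ∀ z, ‖z‖ = r → Real.posLog ‖F z‖ ≤ q z) : mF r F ≤ Real.circleAverage q 0 r := by
  apply Real.circleAverage_mono (GoodF.ci hr hF) hq
  intro z hz; rw [abs_of_pos hr] at hz; exact H z (by simpa using hz)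

lemma mF_mul {r : ℝ} (hr : 0 < r) {F G : ℂ → ℂ} (hF : ∀ z ∈ Metric.closedBall (0:ℂ) r, MeromorphicAt F z)
    (hG : ∀ z ∈ Metric.closedBall (0:ℂ) r, MeromorphicAt G z) : mF r (fun z => F z * G z) ≤ mF r F + mF r G := by
  unfold mF
  rw [← Real.circleAverage_fun_add (GoodF.ci hr hF) (GoodF.ci hr hG)]
  apply mF_le hr (fun z hz => (hF z hz).mul (hG z hz)) ((GoodF.ci hr hF).add (GoodF.ci hr hG))
  intro z _
  change Real.posLog ‖F z * G z‖ ≤ Real.posLog ‖F z‖ + Real.posLog ‖G z‖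
  rw [norm_mul]; exact Real.posLog_mul

lemma mF_add {r : ℝ} (hr : 0 < r) {F G : ℂ → ℂ} (hF : ∀ z ∈ Metric.closedBall (0:ℂ) r, MeromorphicAt F z)
    (hG : ∀ z ∈ Metric.closedBall (0:ℂ) r, MeromorphicAt G z) :
    mF r (fun z => F z + G z) ≤ mF r F + mF r G + Real.log 2 := by
  have hs : CircleIntegrable (fun z => Real.posLog ‖F z‖ + Real.posLog ‖G z‖) 0 r := (GoodF.ci hr hF).add (GoodF.ci hr hG)
  unfold mF
  rw [← Real.circleAverage_fun_add (GoodF.ci hr hF) (GoodF.ci hr hG), ← Real.circleAverage_const (Real.log 2) 0 r,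
    ← Real.circleAverage_fun_add hs (circleIntegrable_const _ _ _)]
  apply mF_le hr (fun z hz => (hF z hz).add (hG z hz)) (hs.add (circleIntegrable_const _ _ _))
  intro z _
  change Real.posLog ‖F z + G z‖ ≤ Real.posLog ‖F z‖ + Real.posLog ‖G z‖ + Real.log 2
  have := Real.posLog_norm_add_le (F z) (G z)
  linarith

lemma mm_congr {r : ℝ} (hr : r ∈ D.rad) {h : Mer} {F : ℂ → ℂ} (H : ∀ z, ‖z‖ ≤ r → h.rep ∘ D.ψ =ᶠ[𝓝[≠] z] F) :
    D.mm r h = mF r F := mF_congr (r0 hr) fun z hz => H z hz.le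

lemma rep_mul (h k : Mer) (w : ℂ) : (h * k).rep =ᶠ[𝓝[≠] w] h.rep * k.rep := by
  conv_lhs => rw [← Mer.mk_rep h, ← Mer.mk_rep k, Mer.mk_mul]
  exact Mer.rep_mk _ _ w

lemma rep_add (h k : Mer) (w : ℂ) : (h + k).rep =ᶠ[𝓝[≠] w] h.rep + k.rep := by
  conv_lhs => rw [← Mer.mk_rep h, ← Mer.mk_rep k, Mer.mk_add]
  exact Mer.rep_mk _ _ w

lemma rep_inv (h : Mer) (w : ℂ) : (h⁻¹).rep =ᶠ[𝓝[≠] w] (h.rep)⁻¹ := by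
  conv_lhs => rw [← Mer.mk_rep h, Mer.mk_inv]
  exact Mer.rep_mk _ _ w

lemma rep_neg (h : Mer) (w : ℂ) : (-h).rep =ᶠ[𝓝[≠] w] -h.rep := by
  conv_lhs => rw [← Mer.mk_rep h, Mer.mk_neg]
  exact Mer.rep_mk _ _ w

lemma rep_C (c : ℂ) (w : ℂ) : (Mer.C c).rep =ᶠ[𝓝[≠] w] fun _ => c := by
  rw [Mer.C_def]; exact Mer.rep_mk _ _ w

lemma rep_D (h : Mer) (w : ℂ) : (Mer.D h).rep =ᶠ[𝓝[≠] w] deriv h.rep := by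
  conv_lhs => rw [← Mer.mk_rep h, Mer.D_mk]
  exact Mer.rep_mk _ _ w

lemma rep_Z (w : ℂ) : (Mer.Z).rep =ᶠ[𝓝[≠] w] fun z => z := Mer.rep_mk _ _ w

lemma mm_mul {r : ℝ} (hr : r ∈ D.rad) (h k : Mer) : D.mm r (h * k) ≤ D.mm r h + D.mm r k := by
  rw [mm_congr hr (fun z hz => comp_ev hr hz (rep_mul h k))]
  exact mF_mul (r0 hr) (mero hr h) (mero hr k)

lemma mm_add {r : ℝ} (hr : r ∈ D.rad) (h k : Mer) : D.mm r (h + k) ≤ D.mm r h + D.mm r k + Real.log 2 := by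
  rw [mm_congr hr (fun z hz => comp_ev hr hz (rep_add h k))]
  exact mF_add (r0 hr) (mero hr h) (mero hr k)

lemma mm_neg {r : ℝ} (hr : r ∈ D.rad) (h : Mer) : D.mm r (-h) = D.mm r h := by
  rw [mm_congr hr (fun z hz => comp_ev hr hz (rep_neg h))]
  unfold mm mF
  congr 1; ext z; simp

lemma mm_C {r : ℝ} (hr : r ∈ D.rad) (c : ℂ) : D.mm r (Mer.C c) = Real.posLog ‖c‖ := by
  rw [mm_congr hr (fun z hz => comp_ev hr hz (rep_C c))]
  exact Real.circleAverage_const (Real.posLog ‖c‖) 0 r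

lemma pm_mul (z : ℂ) (h k : Mer) : pm z (h * k) ≤ pm z h + pm z k := by
  by_cases hh : h = 0
  · subst hh; have := pm_nonneg z k; simp [pm, Mer.v_zero] at this ⊢
  by_cases hk : k = 0
  · subst hk; have := pm_nonneg z h; simp [pm, Mer.v_zero] at this ⊢
  unfold pm; rw [Mer.v_mul z hh hk]; norm_cast; omega

lemma pm_le_iff (z : ℂ) (h : Mer) (n : ℕ) : pm z h ≤ n ↔ Mer.og z (-n) h := by
  unfold pm Mer.og
  by_cases hh : h = 0
  · simp [hh, Mer.v_zero]
  · simp only [hh, false_or]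
    constructor
    · intro h1; have h2 : max (-(Mer.v z h)) 0 ≤ (n:ℤ) := by exact_mod_cast h1
      omega
    · intro h1; have h2 : max (-(Mer.v z h)) 0 ≤ (n:ℤ) := by omega
      exact_mod_cast h2

lemma pm_nat (z : ℂ) (h : Mer) : ∃ n : ℕ, pm z h = n := by
  refine ⟨(max (-(Mer.v z h)) 0).toNat, ?_⟩
  unfold pm
  have : ((max (-(Mer.v z h)) 0).toNat : ℤ) = max (-(Mer.v z h)) 0 := Int.toNat_of_nonneg (le_max_right _ _)
  exact_mod_cast this.symm

lemma og_of_pm (z : ℂ) (h : Mer) : ∃ n : ℕ, pm z h = n ∧ Mer.og z (-n) h := by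
  obtain ⟨n, hn⟩ := pm_nat z h
  exact ⟨n, hn, (pm_le_iff z h n).1 hn.le⟩

lemma pm_add (z : ℂ) (h k : Mer) : pm z (h + k) ≤ pm z h + pm z k := by
  obtain ⟨a, ha, ha'⟩ := og_of_pm z h
  obtain ⟨b, hb, hb'⟩ := og_of_pm z k
  rw [ha, hb, ← Nat.cast_add, pm_le_iff]
  exact Mer.og_add (Mer.og_mono ha' (by push_cast; omega)) (Mer.og_mono hb' (by push_cast; omega))

lemma pm_neg (z : ℂ) (h : Mer) : pm z (-h) = pm z h := by unfold pm; rw [Mer.v_neg]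

lemma pm_C (z c : ℂ) : pm z (Mer.C c) = 0 := by unfold pm; rw [Mer.v_C]; simp

lemma nn_C {r : ℝ} (hr : r ∈ D.rad) (c : ℂ) : D.nn r (Mer.C c) = 0 := by
  apply le_antisymm _ (nn_nonneg _ _)
  apply nn_le hr; intro S _; simp [pm_C]

lemma nn_mul {r : ℝ} (hr : r ∈ D.rad) (h k : Mer) : D.nn r (h * k) ≤ D.nn r h + D.nn r k := by
  simpa using nn_le_comb hr (k := h) k zero_le_one zero_le_one (fun z _ => by simpa using pm_mul (D.ψ z) h k)

lemma nn_add {r : ℝ} (hr : r ∈ D.rad) (h k : Mer) : D.nn r (h + k) ≤ D.nn r h + D.nn r k := by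
  simpa using nn_le_comb hr (k := h) k zero_le_one zero_le_one (fun z _ => by simpa using pm_add (D.ψ z) h k)

lemma nn_neg {r : ℝ} (hr : r ∈ D.rad) (h : Mer) : D.nn r (-h) = D.nn r h := by
  apply le_antisymm <;> apply nn_le hr <;> intro S hS
  · simpa [pm_neg] using sum_le_nn hr h S hS
  · simpa [pm_neg] using sum_le_nn hr (-h) S hS

lemma tt_mul {r : ℝ} (hr : r ∈ D.rad) (h k : Mer) : D.tt r (h * k) ≤ D.tt r h + D.tt r k := by
  have := mm_mul hr h k; have := nn_mul hr h k; unfold tt; linarith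

lemma tt_add {r : ℝ} (hr : r ∈ D.rad) (h k : Mer) : D.tt r (h + k) ≤ D.tt r h + D.tt r k + Real.log 2 := by
  have := mm_add hr h k; have := nn_add hr h k; unfold tt; linarith

lemma tt_neg {r : ℝ} (hr : r ∈ D.rad) (h : Mer) : D.tt r (-h) = D.tt r h := by
  unfold tt; rw [mm_neg hr, nn_neg hr]

lemma tt_C {r : ℝ} (hr : r ∈ D.rad) (c : ℂ) : D.tt r (Mer.C c) = Real.posLog ‖c‖ := by
  unfold tt; rw [mm_C hr, nn_C hr, add_zero]

lemma mm_inv {r : ℝ} (hr : r ∈ D.rad) (h : Mer) : D.mm r h⁻¹ = mF r (h.rep ∘ D.ψ)⁻¹ :=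
  mm_congr hr (fun z hz => comp_ev hr hz (rep_inv h))

lemma nn_inv {r : ℝ} (hr : r ∈ D.rad) (h : Mer) : D.nn r h⁻¹ = NF r (h.rep ∘ D.ψ)⁻¹ := by
  unfold nn NF
  apply finsum_congr
  intro z
  by_cases hz : ‖z‖ ≤ r
  · rw [oF_comp hr hz, oF_inv, oF_comp hr hz, Mer.v_inv]
  · rw [Wt_out (r0 hr) (not_le.1 hz).le, mul_zero, mul_zero]

lemma tt_inv (h : Mer) : ∃ C, ∀ r ∈ D.rad, D.tt r h⁻¹ ≤ D.tt r h + C := by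
  by_cases hh : h = 0
  · refine ⟨0, fun r hr => ?_⟩
    rw [hh, inv_zero]; simp
  refine ⟨2 * |(oF (h.rep ∘ D.ψ) 0 : ℝ)| + |Real.log ‖meromorphicTrailingCoeffAt (h.rep ∘ D.ψ) 0‖|, fun r hr => ?_⟩
  unfold tt
  rw [mm_inv hr, nn_inv hr]
  exact fft (D.half r hr) (good hr hh)

end Dom
end


open Complex Filter Topology MeasureTheory
open scoped Classical

noncomputable section
namespace Dom
variable {D : Dom}

/-- the gauge -/
def ga (D : Dom) (γ : ℝ → ℝ) (r ρ : ℝ) : ℝ := D.base ρ + |γ ρ| + Real.posLog (1 / (ρ - r))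

/-- functions bounded by the gauge -/
def Bd (D : Dom) (γ : ℝ → ℝ) (φ : ℝ → ℝ) : Prop :=
  ∃ C, 0 ≤ C ∧ ∀ r ∈ D.rad, ∀ ρ ∈ D.rad, r < ρ → φ r ≤ C * D.ga γ r ρ

lemma ga_one {γ : ℝ → ℝ} {r ρ : ℝ} (hρ : ρ ∈ D.rad) : 1 ≤ D.ga γ r ρ := by
  have := D.base_one ρ hρ; have := abs_nonneg (γ ρ); have := Real.posLog_nonneg (x := 1 / (ρ - r))
  unfold ga; linarith

lemma ga_mid {γ : ℝ → ℝ} {r s ρ : ℝ} (hρ : ρ ∈ D.rad) (hr : r < ρ) (hs : (ρ - r) / 4 ≤ ρ - s) :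
    D.ga γ s ρ ≤ 3 * D.ga γ r ρ := by
  have h1 : Real.posLog (1 / (ρ - s)) ≤ Real.posLog (4 * (1 / (ρ - r))) := by
    apply Real.posLog_le_posLog
    · have : 0 < ρ - s := by linarith
      positivity
    · have h0 : 0 < ρ - r := by linarith
      have : 4 * (1 / (ρ - r)) = 1 / ((ρ - r) / 4) := by field_simp
      rw [this]
      apply one_div_le_one_div_of_le _ hs
      linarith
  have h2 : Real.posLog (4 * (1 / (ρ - r))) ≤ Real.posLog 4 + Real.posLog (1 / (ρ - r)) := Real.posLog_mul
  have h3 : Real.posLog 4 ≤ 2 := by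
    rw [Real.posLog_eq_log (by norm_num), show (4:ℝ) = 2 ^ 2 by norm_num, Real.log_pow]
    have := Real.log_two_lt_d9; push_cast; linarith
  have := ga_one (γ := γ) (r := r) hρ
  unfold ga at *
  linarith

lemma Bd.add {γ φ χ} (h : D.Bd γ φ) (k : D.Bd γ χ) : D.Bd γ (fun r => φ r + χ r) := by
  obtain ⟨a, ha, h⟩ := h; obtain ⟨b, hb, k⟩ := k
  refine ⟨a + b, by linarith, fun r hr ρ hρ hh => ?_⟩
  have := h r hr ρ hρ hh; have := k r hr ρ hρ hh
  linarith

lemma Bd.cmul {γ φ} {c : ℝ} (hc : 0 ≤ c) (h : D.Bd γ φ) : D.Bd γ (fun r => c * φ r) := by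
  obtain ⟨a, ha, h⟩ := h
  refine ⟨c * a, by positivity, fun r hr ρ hρ hh => ?_⟩
  rw [mul_assoc]
  exact mul_le_mul_of_nonneg_left (h r hr ρ hρ hh) hc

lemma Bd.const (γ) (c : ℝ) : D.Bd γ (fun _ => c) := by
  refine ⟨|c|, abs_nonneg _, fun r hr ρ hρ hh => ?_⟩
  have := ga_one (γ := γ) (r := r) hρ
  have := le_abs_self c
  nlinarith [abs_nonneg c]

lemma Bd.mono {γ φ χ} (h : D.Bd γ φ) (H : ∀ r ∈ D.rad, χ r ≤ φ r) : D.Bd γ χ := by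
  obtain ⟨a, ha, h⟩ := h
  exact ⟨a, ha, fun r hr ρ hρ hh => (H r hr).trans (h r hr ρ hρ hh)⟩

lemma Bd.gauge {γ γ' φ} (h : D.Bd γ φ) (H : ∃ K, 0 ≤ K ∧ ∀ ρ ∈ D.rad, |γ ρ| ≤ K * (1 + |γ' ρ|)) : D.Bd γ' φ := by
  obtain ⟨a, ha, h⟩ := h; obtain ⟨K, hK, H⟩ := H
  refine ⟨a * (1 + K), by positivity, fun r hr ρ hρ hh => (h r hr ρ hρ hh).trans ?_⟩
  rw [mul_assoc]
  apply mul_le_mul_of_nonneg_left _ ha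
  have h1 := H ρ hρ
  have h2 := D.base_one ρ hρ
  have h3 := Real.posLog_nonneg (x := 1 / (ρ - r))
  have h4 := abs_nonneg (γ' ρ)
  unfold ga
  nlinarith [mul_nonneg hK h3, mul_le_mul_of_nonneg_left h2 hK]

lemma Bd.zero_gauge {γ φ} (h : D.Bd 0 φ) : D.Bd γ φ := h.gauge ⟨0, le_rfl, fun ρ _ => by simp⟩

/-- `h` has size bounded by the gauge -/
def InG (D : Dom) (γ : ℝ → ℝ) (h : Mer) : Prop := D.Bd γ (fun r => D.tt r h)

lemma InG.mm {γ h} (H : D.InG γ h) : D.Bd γ (fun r => D.mm r h) :=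
  Bd.mono H fun r _ => by have := nn_nonneg (D := D) r h; simp only [tt]; linarith
lemma InG.nn {γ h} (H : D.InG γ h) : D.Bd γ (fun r => D.nn r h) :=
  Bd.mono H fun r _ => by have := mm_nonneg (D := D) r h; simp only [tt]; linarith
lemma InG.mk {γ h} (H : D.Bd γ (fun r => D.mm r h)) (K : D.Bd γ (fun r => D.nn r h)) : D.InG γ h := H.add K

lemma InG.add {γ h k} (H : D.InG γ h) (K : D.InG γ k) : D.InG γ (h + k) :=
  ((Bd.add H K).add (Bd.const γ (Real.log 2))).mono fun _ hr => tt_add hr h k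
lemma InG.mul {γ h k} (H : D.InG γ h) (K : D.InG γ k) : D.InG γ (h * k) :=
  (Bd.add H K).mono fun _ hr => tt_mul hr h k
lemma InG.neg {γ h} (H : D.InG γ h) : D.InG γ (-h) := Bd.mono H fun _ hr => (tt_neg hr h).le
lemma InG.C (γ) (c : ℂ) : D.InG γ (Mer.C c) := (Bd.const γ (Real.posLog ‖c‖)).mono fun _ hr => (tt_C hr c).le
lemma InG.inv {γ h} (H : D.InG γ h) : D.InG γ h⁻¹ := by
  obtain ⟨c, hc⟩ := tt_inv (D := D) h
  exact (Bd.add H (Bd.const γ c)).mono hc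

lemma InG.Z (γ) : D.InG γ Mer.Z := by
  apply Bd.zero_gauge
  have h1 : ∀ r ∈ D.rad, D.mm r Mer.Z = mF r D.ψ := fun r hr =>
    mm_congr hr (fun z hz => comp_ev hr hz rep_Z)
  have h2 : ∀ r ∈ D.rad, D.nn r Mer.Z = 0 := fun r hr => by
    apply le_antisymm _ (nn_nonneg _ _)
    apply nn_le hr; intro S hS
    apply le_of_eq
    apply Finset.sum_eq_zero
    intro z hz
    have : pm (D.ψ z) Mer.Z = 0 := by
      apply le_antisymm _ (pm_nonneg _ _)
      have := (pm_le_iff (D.ψ z) Mer.Z 0).2 (by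
        rw [Mer.og_iff_ord, Mer.Z, Mer.ord_mk]
        have : AnalyticAt ℂ (id : ℂ → ℂ) (D.ψ z) := analyticAt_id
        simpa using this.meromorphicOrderAt_nonneg)
      simpa using this
    rw [this, zero_mul]
  obtain ⟨C, hC⟩ := D.zB
  refine ⟨|C|, abs_nonneg _, fun r hr ρ hρ hh => ?_⟩
  simp only [tt]; rw [h1 r hr, h2 r hr, add_zero]
  have h3 := hC r hr
  have h4 := D.base_mono r hr ρ hρ hh.le
  have h5 := Real.posLog_nonneg (x := 1 / (ρ - r))
  have h6 := le_abs_self C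
  have h7 := b0 hr
  have h8 := abs_nonneg C
  unfold ga; simp only [Pi.zero_apply, abs_zero, add_zero]
  nlinarith [mul_nonneg h8 h5]

/-- logarithmic derivative, crude product bound -/
lemma lld_crude {x y G c K n A m sq : ℝ} (hx : 1 ≤ x) (hy : 1 ≤ y) (hG : 1 ≤ G) (hc : 0 ≤ c) (hsq : 0 ≤ sq)
    (hn0 : 0 ≤ n) (hn : n ≤ 4 * c * x * y * G) (hm : m ≤ c * G) (hA0 : 0 ≤ A)
    (hA : A ≤ 32 * x * y ^ 2 * (m + n * (4 * x))) (hK : K = 2 + 544 * c + 4 * c * sq) :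
    1 + (A ^ (1/2:ℝ) + sq * n) ≤ K * (x ^ 3 * y ^ 3 * G) := by
  have h1 : A ^ (1/2:ℝ) ≤ 1 + A := by
    have h := Real.rpow_le_rpow hA0 (show A ≤ (1 + A) by linarith) (show (0:ℝ) ≤ 1/2 by norm_num)
    refine h.trans ?_
    calc _ ≤ (1 + A) ^ (1:ℝ) := Real.rpow_le_rpow_of_exponent_le (by linarith) (by norm_num)
      _ = _ := Real.rpow_one _
  have e1 : x * y * G ≤ x ^ 3 * y ^ 3 * G := by
    gcongr
    · exact le_self_pow₀ hx (by norm_num)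
    · exact le_self_pow₀ hy (by norm_num)
  have e2 : x * y ^ 2 * G ≤ x ^ 3 * y ^ 3 * G := by
    gcongr
    · exact le_self_pow₀ hx (by norm_num)
    · norm_num
  have e3 : 1 ≤ x ^ 3 * y ^ 3 * G := by
    have := one_le_pow₀ hx (n := 3); have := one_le_pow₀ hy (n := 3)
    have : 1 ≤ x ^ 3 * y ^ 3 := one_le_mul_of_one_le_of_one_le ‹_› ‹_›
    exact one_le_mul_of_one_le_of_one_le this hG
  set W := x ^ 3 * y ^ 3 * G with hW
  have h2 : n ≤ 4 * c * W := by
    calc n ≤ 4 * c * (x * y * G) := by linarith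
      _ ≤ _ := by gcongr
  have h3 : A ≤ 544 * c * W := by
    calc A ≤ 32 * x * y ^ 2 * (c * G + (4 * c * x * y * G) * (4 * x)) := hA.trans (by gcongr)
      _ = 32 * c * (x * y ^ 2 * G) + 512 * c * W := by rw [hW]; ring
      _ ≤ 32 * c * W + 512 * c * W := by gcongr
      _ = _ := by ring
  have h4 : sq * n ≤ 4 * c * sq * W := by
    calc sq * n ≤ sq * (4 * c * W) := by gcongr
      _ = _ := by ring
  rw [hK]; linarith

lemma logD_mm {r : ℝ} (hr : r ∈ D.rad) (h : Mer) :
    D.mm r (Mer.D h / h) ≤ mF r (fun z => deriv (h.rep ∘ D.ψ) z / (h.rep ∘ D.ψ) z) + Real.log 2 := by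
  have e : ∀ z, ‖z‖ ≤ r → (Mer.D h / h).rep ∘ D.ψ =ᶠ[𝓝[≠] z]
      fun z => (deriv (h.rep ∘ D.ψ) z / (h.rep ∘ D.ψ) z) * (deriv D.ψ z)⁻¹ := by
    intro z hz
    have h1 : ∀ w, (Mer.D h / h).rep =ᶠ[𝓝[≠] w] fun x => deriv h.rep x / h.rep x := by
      intro w
      rw [div_eq_mul_inv]
      filter_upwards [rep_mul (Mer.D h) h⁻¹ w, rep_D h w, rep_inv h w] with x e1 e2 e3
      rw [e1, Pi.mul_apply, e2, e3, Pi.inv_apply]; rfl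
    have h2 := (tend hr hz).eventually (h.rep_mero (D.ψ z)).eventually_analyticAt
    have h3 : ∀ᶠ w in 𝓝[≠] z, AnalyticAt ℂ D.ψ w := (D.an r hr z hz).eventually_analyticAt.filter_mono nhdsWithin_le_nhds
    have h4 : ∀ᶠ w in 𝓝[≠] z, deriv D.ψ w ≠ 0 :=
      ((D.an r hr z hz).deriv.continuousAt.eventually_ne (dne hr hz)).filter_mono nhdsWithin_le_nhds
    filter_upwards [comp_ev hr hz h1, h2, h3, h4] with w e1 e2 e3 e4
    rw [e1, deriv_comp w e2.differentiableAt e3.differentiableAt]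
    simp only [Function.comp]
    field_simp
  rw [mm_congr hr e]
  have hm := mero hr h
  have h1 : mF r (fun z => (deriv D.ψ z)⁻¹) ≤ Real.log 2 := by
    rw [← Real.circleAverage_const (Real.log 2) 0 r]
    apply mF_le (r0 hr) (fun z hz => (D.an r hr z (by simpa using hz)).deriv.meromorphicAt.inv) (circleIntegrable_const _ _ _)
    intro z hz
    rw [← Real.posLog_eq_log (x := 2) (by norm_num)]
    apply Real.posLog_le_posLog (norm_nonneg _)
    change ‖(deriv D.ψ z)⁻¹‖ ≤ 2
    rw [norm_inv]
    have := D.dpos r hr z hz.le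
    rw [inv_le_comm₀ (by linarith) (by norm_num)]; linarith
  refine (mF_mul (r0 hr) (fun z hz => (hm z hz).deriv.div (hm z hz))
    (fun z hz => (D.an r hr z (by simpa using hz)).deriv.meromorphicAt.inv)).trans ?_
  exact add_le_add le_rfl h1

lemma ga_alg {a g p : ℝ} (ha : 1 ≤ a) (hg : 0 ≤ g) (hp : 0 ≤ p) : a + g + p ≤ (1 + g) * (a * (1 + p)) := by
  have h1 : p ≤ a * p := le_mul_of_one_le_left hp ha
  have h2 : g ≤ g * a := le_mul_of_one_le_right hg ha
  have h3 : 0 ≤ g * (a * p) := by positivity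
  nlinarith

set_option maxHeartbeats 1000000 in
lemma lld_G {γ h} (hh : h ≠ 0) (H : D.InG γ h) : D.Bd (fun ρ => Real.posLog (γ ρ)) (fun r => D.mm r (Mer.D h / h)) := by
  obtain ⟨c₀, hc₀, H⟩ := H
  obtain ⟨c₁, H1⟩ := tt_inv (D := D) h
  set c := 6 * c₀ + |c₁| with hcdef
  have hc : 0 ≤ c := by positivity
  set K := 2 + 544 * c + 4 * c * sqK with hK
  have hsq : 0 ≤ sqK := by have := sqK_pos; linarith
  have hK2 : 2 ≤ K := by rw [hK]; have : 0 ≤ c * sqK := by positivity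
                         linarith
  refine ⟨2 * (Real.log K + 20), by have := Real.log_nonneg (show 1 ≤ K by linarith); positivity, fun r hr ρ hρ hh1 => ?_⟩
  set δ := ρ - r with hδ
  have hδ0 : 0 < δ := by linarith
  have hρ0 := r0 hρ
  have hr0' := r0 hr
  set s := r + δ / 4 with hs
  set s' := r + δ / 2 with hs'
  have hsρ : s < ρ := by rw [hs]; linarith
  have hsρ' : s' < ρ := by rw [hs']; linarith
  have hrh := D.half r hr
  have hsr : s ∈ D.rad := D.oc ρ hρ s (by linarith) hsρ.le
  have hsr' : s' ∈ D.rad := D.oc ρ hρ s' (by linarith) hsρ'.le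
  set F := h.rep ∘ D.ψ with hF
  set G := D.ga γ r ρ with hG
  have hG1 : 1 ≤ G := ga_one hρ
  have t1 : ∀ t ∈ D.rad, (ρ - r) / 4 ≤ ρ - t → D.tt t h + D.tt t h⁻¹ ≤ c * G := by
    intro t ht h1
    have h2 := H t ht ρ hρ (by linarith)
    have h3 := ga_mid (γ := γ) hρ hh1 h1
    have h4 := H1 t ht
    have h5 : c₀ * D.ga γ t ρ ≤ c₀ * (3 * G) := by gcongr
    have h6 := le_abs_self c₁
    have h7 : |c₁| ≤ |c₁| * G := le_mul_of_one_le_right (abs_nonneg _) hG1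
    rw [hcdef]; linarith
  have hgood := good hsr hh
  have hgood' := good hsr' hh
  have hn := count_le (r0 hsr) (show s < s' by linarith) hgood'
  have hm : mF s F + mF s F⁻¹ ≤ c * G := by
    have h1 := t1 s hsr (by rw [hs]; linarith)
    unfold tt at h1
    rw [mm_inv hsr] at h1
    have := nn_nonneg (D := D) s h; have := nn_nonneg (D := D) s h⁻¹
    have : D.mm s h = mF s F := rfl
    linarith
  have hN : NF s' F + NF s' F⁻¹ ≤ c * G := by
    have h1 := t1 s' hsr' (by rw [hs']; linarith)
    unfold tt at h1
    rw [nn_inv hsr'] at h1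
    have := mm_nonneg (D := D) s' h; have := mm_nonneg (D := D) s' h⁻¹
    have : D.nn s' h = NF s' F := rfl
    linarith
  set x := 1 + ρ with hx
  set y := 1 + 1 / δ with hy
  have hy1 : 1 / δ ≤ y := by rw [hy]; linarith
  have hy0 : 0 < 1 / δ := by positivity
  set n := ∑ z ∈ spF s F, |(oF F z : ℝ)| with hndef
  have hn0 : 0 ≤ n := Finset.sum_nonneg fun _ _ => abs_nonneg _
  have hn' : n ≤ 4 * c * x * y * G := by
    have e : s' / (s' - s) = 4 * s' * (1 / δ) := by
      have : s' - s = δ / 4 := by rw [hs, hs']; ring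
      rw [this]; field_simp
    rw [e] at hn
    calc n ≤ 4 * s' * (1 / δ) * (c * G) := hn.trans (by have := r0 hsr'; gcongr)
      _ ≤ 4 * x * y * (c * G) := by gcongr; linarith
      _ = _ := by ring
  have hlog : 1 + Real.posLog s ≤ x := by
    have h1 : Real.posLog s ≤ s := by
      rw [Real.posLog_apply]; apply max_le (r0 hsr).le
      have := Real.log_le_sub_one_of_pos (r0 hsr); linarith
    linarith
  have L := lld hrh (show r < s by linarith) hgood
  set A := 2 * s / (s - r) ^ 2 * (mF s F + mF s F⁻¹ + n * (4 * (1 + Real.posLog s))) with hA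
  have hA0 : 0 ≤ A := by
    have := mF_nonneg s F; have := mF_nonneg s F⁻¹; have := Real.posLog_nonneg (x := s); have := r0 hsr
    positivity
  have hA' : A ≤ 32 * x * y ^ 2 * ((mF s F + mF s F⁻¹) + n * (4 * x)) := by
    have e : 2 * s / (s - r) ^ 2 = 32 * s * (1 / δ) ^ 2 := by
      have : s - r = δ / 4 := by rw [hs]; ring
      rw [this]; field_simp; ring
    rw [hA, e]
    have := mF_nonneg s F; have := mF_nonneg s F⁻¹; have := Real.posLog_nonneg (x := s); have := r0 hsr
    gcongr
    linarith
  have hfin := lld_crude (K := K) (sq := sqK) (show 1 ≤ x by linarith) (show 1 ≤ y by linarith) hG1 hc hsq hn0 hn' hm hA0 hA' hK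
  have hL2 : Real.log (1 + (A ^ (1/2:ℝ) + sqK * n)) ≤ Real.log K + (3 * Real.log x + 3 * Real.log y + Real.log G) := by
    have hp : 0 < 1 + (A ^ (1/2:ℝ) + sqK * n) := by positivity
    refine (Real.log_le_log hp hfin).trans (le_of_eq ?_)
    rw [Real.log_mul (by positivity) (by positivity), Real.log_mul (by positivity) (by positivity),
      Real.log_mul (by positivity) (by positivity), Real.log_pow, Real.log_pow]
    push_cast; ring
  have b1 := D.base_one ρ hρ
  have b2 := D.base_log ρ hρ
  have hl2 : Real.log 2 ≤ 1 := by have := Real.log_two_lt_d9; linarith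
  have hp1 : ∀ t : ℝ, 0 < t → Real.log (1 + t) ≤ 1 + Real.posLog t := by
    intro t ht
    have h1 := Real.posLog_norm_add_le (1:ℝ) t
    simp only [norm_one, Real.norm_eq_abs, abs_of_pos ht, abs_of_pos (show 0 < 1 + t by linarith)] at h1
    rw [Real.posLog_eq_log (x := 1 + t) (by rw [abs_of_pos] <;> linarith)] at h1
    have : Real.posLog 1 = 0 := by simp
    linarith
  have hlx := hp1 ρ hρ0
  have hly := hp1 (1 / δ) hy0
  have hlG : Real.log G ≤ D.base ρ + Real.posLog (γ ρ) + Real.posLog (1 / δ) + 2 := by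
    have p0 := Real.posLog_nonneg (x := 1/δ)
    have h3 : G ≤ (1 + |γ ρ|) * (D.base ρ * (1 + Real.posLog (1 / δ))) := by
      rw [hG]; unfold ga; rw [← hδ]
      exact ga_alg b1 (abs_nonneg _) p0
    have h4 := Real.log_le_log (by linarith) h3
    rw [Real.log_mul (by positivity) (by positivity), Real.log_mul (by positivity) (by positivity)] at h4
    have h5 : Real.log (1 + |γ ρ|) ≤ 1 + Real.posLog (γ ρ) := by
      by_cases h0 : γ ρ = 0
      · rw [h0]; simp
      · have := hp1 |γ ρ| (abs_pos.2 h0)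
        rwa [Real.posLog_apply, Real.log_abs, ← Real.posLog_apply] at this
    have h6 := Real.log_le_sub_one_of_pos (show 0 < D.base ρ by linarith)
    have h7 := Real.log_le_sub_one_of_pos (show 0 < 1 + Real.posLog (1/δ) by linarith)
    linarith
  have hfinal := logD_mm hr h
  have p0 := Real.posLog_nonneg (x := 1/δ)
  have p1 := Real.posLog_nonneg (x := γ ρ)
  have hlK := Real.log_nonneg (show 1 ≤ K by linarith)
  unfold ga
  rw [← hδ, abs_of_nonneg p1]
  have : Real.log K ≤ Real.log K * (D.base ρ + Real.posLog (γ ρ) + Real.posLog (1/δ)) :=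
    le_mul_of_one_le_right hlK (by linarith)
  have e5 : 2 * (Real.log K + 20) * (D.base ρ + Real.posLog (γ ρ) + Real.posLog (1/δ)) =
    2 * (Real.log K * (D.base ρ + Real.posLog (γ ρ) + Real.posLog (1/δ))) + 40 * (D.base ρ + Real.posLog (γ ρ) + Real.posLog (1/δ)) := by ring
  rw [e5]
  have hL3 := L.trans (mul_le_mul_of_nonneg_left hL2 (show (0:ℝ) ≤ 2 by norm_num))
  rw [← hx] at hlx
  rw [← hy] at hly
  refine hfinal.trans ?_
  clear_value x y G A n
  linarith

lemma pm_D (z : ℂ) (h : Mer) : pm z (Mer.D h) ≤ 2 * pm z h := by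
  obtain ⟨a, ha, ha'⟩ := og_of_pm z h
  by_cases h0 : a = 0
  · rw [ha, h0]; subst h0
    have := (pm_le_iff z (Mer.D h) 0).2 (by simpa using Mer.og_D0 (by simpa using ha'))
    simpa using this
  · rw [ha]
    have := (pm_le_iff z (Mer.D h) (a + 1)).2 (Mer.og_mono (Mer.og_D ha') (by push_cast; omega))
    refine this.trans ?_
    have : 1 ≤ (a:ℝ) := by exact_mod_cast Nat.one_le_iff_ne_zero.2 h0
    push_cast; linarith

lemma posLog_gauge (γ : ℝ → ℝ) (ρ : ℝ) : |Real.posLog (γ ρ)| ≤ 1 * (1 + |γ ρ|) := by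
  rw [abs_of_nonneg Real.posLog_nonneg, Real.posLog_apply]
  apply max_le (by positivity)
  rw [← Real.log_abs]
  rcases eq_or_lt_of_le (abs_nonneg (γ ρ)) with h | h
  · rw [← h]; simp
  · have := Real.log_le_sub_one_of_pos h; linarith

lemma InG.der {γ h} (H : D.InG γ h) : D.InG γ (Mer.D h) := by
  by_cases hh : h = 0
  · rw [hh, Mer.D_zero]; rw [hh] at H; exact H
  apply InG.mk
  · have h1 := (lld_G hh H).gauge (γ' := γ) ⟨1, zero_le_one, fun ρ _ => posLog_gauge γ ρ⟩
    apply (h1.add H.mm).mono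
    intro r hr
    have := mm_mul hr (Mer.D h / h) h
    rwa [div_mul_cancel₀ _ hh] at this
  · apply (H.nn.cmul (show (0:ℝ) ≤ 2 by norm_num)).mono
    intro r hr
    have := nn_le_comb hr (h := Mer.D h) (k := h) 0 (show (0:ℝ) ≤ 2 by norm_num) le_rfl (fun z _ => by simpa using pm_D (D.ψ z) h)
    simpa using this

/-- the differential field attached to a gauge -/
def cls (D : Dom) (γ : ℝ → ℝ) : Subfield Mer where
  carrier := {h | D.InG γ h}
  mul_mem' := InG.mul
  one_mem' := by simpa using InG.C (D := D) γ 1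
  add_mem' := InG.add
  zero_mem' := by simpa using InG.C (D := D) γ 0
  neg_mem' := InG.neg
  inv_mem' _ := InG.inv

lemma mem_cls {γ h} : h ∈ D.cls γ ↔ D.InG γ h := Iff.rfl
lemma cls_D {γ h} (H : h ∈ D.cls γ) : Mer.D h ∈ D.cls γ := InG.der H
lemma cls_C (γ) (c : ℂ) : Mer.C c ∈ D.cls γ := InG.C γ c
lemma cls_Z (γ) : Mer.Z ∈ D.cls γ := InG.Z γ
lemma cls_zero_le (γ) : D.cls 0 ≤ D.cls γ := fun _ h => Bd.zero_gauge h

end Dom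
end


open Complex Filter Topology MeasureTheory
open scoped Classical

noncomputable section

lemma Mer.v_Z_sub1 (c : ℂ) : Mer.v c (Mer.Z - Mer.C c) = 1 ∧ Mer.Z - Mer.C c ≠ 0 := by
  have h1 : Mer.ord c (Mer.Z - Mer.C c) = 1 := by
    rw [Mer.Z, Mer.C_def, Mer.mk_sub, Mer.ord_mk]
    exact meromorphicOrderAt_id_sub_const (𝕜 := ℂ) (x := c)
  have h2 : Mer.Z - Mer.C c ≠ 0 := by
    intro h; rw [h, Mer.ord_zero] at h1; exact absurd h1 (by decide)
  refine ⟨?_, h2⟩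
  have := Mer.coe_v c h2
  rw [h1] at this
  exact_mod_cast this

lemma Mer.v_Z_sub (c : ℂ) : 0 < Mer.v c (Mer.Z - Mer.C c) := by rw [(Mer.v_Z_sub1 c).1]; norm_num

namespace Dom
variable {D : Dom}

lemma tt_bdd (x : Mer) {ρ : ℝ} (hρ : ρ ∈ D.rad) : ∃ B, ∀ t, 1/2 ≤ t → t ≤ ρ → D.tt t x ≤ B := by
  by_cases hx : x = 0
  · refine ⟨Real.posLog ‖(0:ℂ)‖, fun t h1 h2 => ?_⟩
    rw [hx, ← Mer.C.map_zero, tt_C (D.oc ρ hρ t h1 h2)]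
  obtain ⟨B, hB⟩ := mF_bdd (r := 1/2) le_rfl (D.half ρ hρ) (good hρ hx)
  refine ⟨B + D.nn ρ x, fun t h1 h2 => ?_⟩
  have ht := D.oc ρ hρ t h1 h2
  apply add_le_add (hB t h1 h2)
  apply nn_le ht
  intro S hS
  refine le_trans (Finset.sum_le_sum fun z _ => ?_) (sum_le_nn hρ x S (fun z hz => (hS z hz).trans h2))
  exact mul_le_mul_of_nonneg_left (Wt_mono (r0 ht) h2 z) (pm_nonneg _ _)

/-- maximal characteristic -/
def ts (D : Dom) (x : Mer) (ρ : ℝ) : ℝ := sSup ((fun t => D.tt t x) '' Set.Icc (1/2) ρ)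

lemma le_ts (x : Mer) {ρ t : ℝ} (hρ : ρ ∈ D.rad) (h1 : 1/2 ≤ t) (h2 : t ≤ ρ) : D.tt t x ≤ D.ts x ρ := by
  obtain ⟨B, hB⟩ := tt_bdd (D := D) x hρ
  apply le_csSup
  · exact ⟨B, by rintro _ ⟨s, hs, rfl⟩; exact hB s hs.1 hs.2⟩
  · exact ⟨t, ⟨h1, h2⟩, rfl⟩

lemma ts_le (x : Mer) {ρ B : ℝ} (hρ : ρ ∈ D.rad) (hB : ∀ t, 1/2 ≤ t → t ≤ ρ → D.tt t x ≤ B) : D.ts x ρ ≤ B := by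
  apply csSup_le
  · exact ⟨_, ρ, ⟨D.half ρ hρ, le_rfl⟩, rfl⟩
  · rintro _ ⟨s, hs, rfl⟩; exact hB s hs.1 hs.2

lemma ts_nonneg (x : Mer) {ρ : ℝ} (hρ : ρ ∈ D.rad) : 0 ≤ D.ts x ρ :=
  (tt_nonneg _ _).trans (le_ts x hρ (D.half ρ hρ) le_rfl)

def cT (D : Dom) (x : Mer) : Subfield Mer := D.cls (D.ts x)
def cS (D : Dom) (x : Mer) : Subfield Mer := D.cls (fun ρ => Real.posLog (D.ts x ρ))

lemma self_cT (x : Mer) : x ∈ D.cT x := by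
  refine ⟨1, zero_le_one, fun r hr ρ hρ h => ?_⟩
  have h1 := le_ts x hρ (D.half r hr) h.le
  have := le_abs_self (D.ts x ρ); have := Real.posLog_nonneg (x := 1 / (ρ - r)); have := b0 hρ
  unfold ga; linarith

lemma cS_le_cT (x : Mer) : D.cS x ≤ D.cT x := fun _ h =>
  Bd.gauge h ⟨1, zero_le_one, fun ρ _ => posLog_gauge _ ρ⟩

lemma growth_aux {C1 : ℝ} (hC1 : 0 ≤ C1) (φ : ℝ → ℝ)
    (hb : ∀ ρ ∈ D.rad, ∃ B, ∀ t, 1/2 ≤ t → t ≤ ρ → φ t ≤ B)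
    (H : ∀ r ∈ D.rad, ∀ ρ ∈ D.rad, r < ρ → φ r ≤ 1/2 * φ ρ + C1 * (D.base ρ + Real.posLog (1 / (ρ - r)))) :
    ∀ r ∈ D.rad, ∀ ρ ∈ D.rad, r < ρ → φ r ≤ 6 * C1 * (D.base ρ + Real.posLog (1 / (ρ - r))) := by
  intro r hr ρ hρ hh
  set δ := ρ - r with hδ
  have hδ0 : 0 < δ := by linarith
  set g := D.base ρ + Real.posLog (1 / δ) with hg
  have hg1 : 1 ≤ g := by
    have := D.base_one ρ hρ; have := Real.posLog_nonneg (x := 1/δ); linarith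
  set q : ℕ → ℝ := fun n => (1/2:ℝ) ^ n with hq
  have hq0 : ∀ n, 0 < q n := fun n => by positivity
  have hqs : ∀ n, q (n + 1) = q n / 2 := fun n => by simp only [hq]; rw [pow_succ]; ring
  have hq1 : ∀ n, q n ≤ 1 := fun n => pow_le_one₀ (by norm_num) (by norm_num)
  have hrn : ∀ n, r ≤ ρ - δ * q n := fun n => by nlinarith [hq1 n]
  have hrn2 : ∀ n, ρ - δ * q n ≤ ρ := fun n => by nlinarith [hq0 n]
  have hm : ∀ n, ρ - δ * q n ∈ D.rad := fun n => D.oc ρ hρ _ ((D.half r hr).trans (hrn n)) (hrn2 n)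
  have step : ∀ n, φ (ρ - δ * q n) ≤ 1/2 * φ (ρ - δ * q (n + 1)) + C1 * (g + n + 1) := by
    intro n
    have h1 := H _ (hm n) _ (hm (n + 1)) (by rw [hqs]; nlinarith [hq0 n])
    refine h1.trans (add_le_add le_rfl (mul_le_mul_of_nonneg_left ?_ hC1))
    have h2 := D.base_mono _ (hm (n + 1)) ρ hρ (hrn2 _)
    have h3 : (ρ - δ * q (n + 1) - (ρ - δ * q n)) = δ * q (n + 1) := by rw [hqs]; ring
    rw [h3]
    have h4 : 1 / (δ * q (n + 1)) = (2:ℝ) ^ (n + 1) * (1 / δ) := by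
      simp only [hq]; rw [one_div_pow]; field_simp
    rw [h4]
    have h5 : Real.posLog ((2:ℝ) ^ (n + 1) * (1 / δ)) ≤ Real.posLog ((2:ℝ) ^ (n + 1)) + Real.posLog (1 / δ) := Real.posLog_mul
    have h6 : Real.posLog ((2:ℝ) ^ (n + 1)) ≤ n + 1 := by
      rw [Real.posLog_eq_log (by rw [abs_of_pos (by positivity)]; exact one_le_pow₀ (by norm_num)), Real.log_pow]
      have := Real.log_two_lt_d9
      push_cast
      nlinarith [(Nat.cast_nonneg n : (0:ℝ) ≤ n)]
    rw [hg]; linarith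
  have ind : ∀ n : ℕ, φ r ≤ q n * φ (ρ - δ * q n) + C1 * (2 * g + 4 - q n * (2 * g + 2 * n + 4)) := by
    intro n
    induction n with
    | zero => simp only [hq]; simp; rw [hδ]; simp
    | succ n ih =>
      refine ih.trans ?_
      have := mul_le_mul_of_nonneg_left (step n) (hq0 n).le
      rw [hqs]; push_cast
      rw [hqs] at this
      nlinarith
  obtain ⟨B, hB⟩ := hb ρ hρ
  have fin : ∀ n : ℕ, φ r ≤ q n * |B| + C1 * (2 * g + 4) := by
    intro n
    refine (ind n).trans (add_le_add ?_ ?_)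
    · apply mul_le_mul_of_nonneg_left _ (hq0 n).le
      exact (hB _ ((D.half r hr).trans (hrn n)) (hrn2 n)).trans (le_abs_self B)
    · apply mul_le_mul_of_nonneg_left _ hC1
      have : 0 ≤ q n * (2 * g + 2 * n + 4) := by have := hq0 n; positivity
      linarith
  have lim : Tendsto (fun n => q n * |B| + C1 * (2 * g + 4)) atTop (𝓝 (0 * |B| + C1 * (2 * g + 4))) :=
    ((tendsto_pow_atTop_nhds_zero_of_lt_one (by norm_num) (by norm_num)).mul_const _).add_const _
  have := ge_of_tendsto' lim fin
  nlinarith [mul_le_mul_of_nonneg_left hg1 hC1]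

/-- growth lemma -/
lemma growth {x : Mer} (H : x ∈ D.cS x) : x ∈ D.cls 0 := by
  obtain ⟨C, hC, H⟩ := H
  set a := 2 * C + 1 with ha
  have ha0 : 0 < a := by positivity
  have hlog : ∀ t, 0 ≤ t → C * Real.posLog t ≤ 1/2 * t + C * Real.posLog a := by
    intro t ht
    have h0 := Real.posLog_nonneg (x := a)
    rcases eq_or_lt_of_le ht with h | h
    · rw [← h]; simp; positivity
    have h1 : Real.posLog t ≤ Real.posLog (t / a) + Real.posLog a := by
      have := Real.posLog_mul (x := t / a) (y := a)
      rwa [div_mul_cancel₀ _ ha0.ne'] at this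
    have h2 : Real.posLog (t / a) ≤ t / a := by
      rw [Real.posLog_apply]; apply max_le (by positivity)
      have := Real.log_le_sub_one_of_pos (show 0 < t / a by positivity); linarith
    have h3 : C * (t / a) ≤ 1/2 * t := by
      rw [mul_div_assoc', div_le_iff₀ ha0, ha]; nlinarith
    have h4 := mul_le_mul_of_nonneg_left (h1.trans (add_le_add h2 le_rfl)) hC
    linarith
  have key := growth_aux (D := D) (C1 := C + C * Real.posLog a) (by have := Real.posLog_nonneg (x := a); positivity) (D.ts x)
    (fun ρ hρ => ⟨D.ts x ρ, fun t h1 h2 => ts_le x (D.oc ρ hρ t h1 h2) (fun s hs1 hs2 => le_ts x hρ hs1 (hs2.trans h2))⟩) ?_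
  · refine ⟨6 * (C + C * Real.posLog a), by have := Real.posLog_nonneg (x := a); positivity, fun r hr ρ hρ h => ?_⟩
    have := key r hr ρ hρ h
    have h2 := le_ts x hr (D.half r hr) le_rfl
    unfold ga; simp only [Pi.zero_apply, abs_zero, add_zero]
    exact h2.trans this
  · intro r hr ρ hρ hh
    apply ts_le x hr
    intro t h1 h2
    have h3 := H t (D.oc r hr t h1 h2) ρ hρ (by linarith)
    have h4 := hlog _ (ts_nonneg (D := D) x hρ)
    have h5 : Real.posLog (1 / (ρ - t)) ≤ Real.posLog (1 / (ρ - r)) := by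
      apply Real.posLog_le_posLog
      · have : 0 < ρ - t := by linarith
        positivity
      · apply one_div_le_one_div_of_le <;> linarith
    simp only [ga, abs_of_nonneg Real.posLog_nonneg] at h3
    have h6 := mul_le_mul_of_nonneg_left h5 hC
    have h7 := D.base_one ρ hρ
    have h8 := Real.posLog_nonneg (x := a)
    have h9 := Real.posLog_nonneg (x := 1 / (ρ - r))
    have h10 : 0 ≤ C * Real.posLog a := by positivity
    have h11 : C * Real.posLog a ≤ C * Real.posLog a * (D.base ρ + Real.posLog (1 / (ρ - r))) :=
      le_mul_of_one_le_right h10 (by linarith)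
    nlinarith

/-- sets of points with small counting function -/
def few (D : Dom) (γ : ℝ → ℝ) (P : Set ℂ) : Prop :=
  ∃ C, 0 ≤ C ∧ ∀ r ∈ D.rad, ∀ ρ ∈ D.rad, r < ρ → ∀ S : Finset ℂ, (∀ z ∈ S, ‖z‖ ≤ r ∧ D.ψ z ∈ P) →
    ∑ z ∈ S, Wt r z ≤ C * D.ga γ r ρ

lemma few.mono {γ P Q} (h : D.few γ P) (hQ : Q ⊆ P) : D.few γ Q := by
  obtain ⟨C, hC, h⟩ := h
  exact ⟨C, hC, fun r hr ρ hρ hh S hS => h r hr ρ hρ hh S (fun z hz => ⟨(hS z hz).1, hQ (hS z hz).2⟩)⟩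

lemma few.union {γ P Q} (h : D.few γ P) (k : D.few γ Q) : D.few γ (P ∪ Q) := by
  obtain ⟨C, hC, h⟩ := h; obtain ⟨E, hE, k⟩ := k
  refine ⟨C + E, by positivity, fun r hr ρ hρ hh S hS => ?_⟩
  rw [← Finset.sum_filter_add_sum_filter_not S (fun z => D.ψ z ∈ P), add_mul]
  apply add_le_add
  · apply h r hr ρ hρ hh
    intro z hz; rw [Finset.mem_filter] at hz
    exact ⟨(hS z hz.1).1, hz.2⟩
  · apply k r hr ρ hρ hh
    intro z hz; rw [Finset.mem_filter] at hz
    exact ⟨(hS z hz.1).1, (hS z hz.1).2.resolve_left hz.2⟩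

lemma few.gauge {γ P} (h : D.few 0 P) : D.few γ P := by
  obtain ⟨C, hC, h⟩ := h
  refine ⟨C, hC, fun r hr ρ hρ hh S hS => (h r hr ρ hρ hh S hS).trans ?_⟩
  apply mul_le_mul_of_nonneg_left _ hC
  have := abs_nonneg (γ ρ)
  unfold ga; simp

lemma few_poles' {γ h} (H : D.Bd γ (fun r => D.nn r h)) : D.few γ {z | Mer.v z h < 0} := by
  obtain ⟨C, hC, H⟩ := H
  refine ⟨C, hC, fun r hr ρ hρ hh S hS => le_trans ?_ (H r hr ρ hρ hh)⟩
  refine le_trans (Finset.sum_le_sum fun z hz => ?_) (sum_le_nn hr h S (fun z hz => (hS z hz).1))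
  have h1 : 1 ≤ pm (D.ψ z) h := by
    have := (hS z hz).2
    simp only [Set.mem_ofPred_eq] at this
    unfold pm
    have : (1:ℤ) ≤ max (-(Mer.v (D.ψ z) h)) 0 := by omega
    exact_mod_cast this
  exact le_mul_of_one_le_left (Wt_nonneg _ _) h1

lemma few_poles {γ h} (H : h ∈ D.cls γ) : D.few γ {z | Mer.v z h < 0} := few_poles' (InG.nn H)

lemma few_zeros {γ h} (H : h ∈ D.cls γ) : D.few γ {z | 0 < Mer.v z h} := by
  apply (few_poles ((D.cls γ).inv_mem H)).mono
  intro z hz; simp only [Set.mem_ofPred_eq, Mer.v_inv] at *; omega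

lemma few_inter {γ P} (h : D.few γ (P ∩ {w | ∃ r ∈ D.rad, ∃ z, ‖z‖ ≤ r ∧ D.ψ z = w})) : D.few γ P := by
  obtain ⟨C, hC, h⟩ := h
  exact ⟨C, hC, fun r hr ρ hρ hh S hS => h r hr ρ hρ hh S fun z hz => ⟨(hS z hz).1, (hS z hz).2, r, hr, z, (hS z hz).1, rfl⟩⟩

lemma few_finite {P : Set ℂ} (hP : P.Finite) (γ) : D.few γ P := by
  apply few.gauge
  induction P, hP using Set.Finite.induction_on with
  | empty => exact ⟨0, le_rfl, fun r hr ρ hρ hh S hS => by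
      have : S = ∅ := Finset.eq_empty_of_forall_notMem (fun z hz => (hS z hz).2)
      rw [this]; simp⟩
  | insert _ _ ih =>
    rename_i c P _ _
    have : insert c P = {c} ∪ P := rfl
    rw [this]
    apply few.union _ ih
    have hz : Mer.Z - Mer.C c ∈ D.cls 0 := (D.cls 0).sub_mem (cls_Z 0) (cls_C 0 c)
    apply (few_zeros hz).mono
    intro z hz
    rw [Set.mem_singleton_iff] at hz
    rw [hz]
    exact Mer.v_Z_sub c

/-- bounding a counting function -/
lemma nn_bd {γ h s} {P : Set ℂ} (hP : D.few γ P) (hs : D.Bd γ (fun r => D.nn r s)) {k : ℝ} (hk : 0 ≤ k)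
    (h1 : ∀ z ∈ P, pm z h ≤ k + k * pm z s) (h2 : ∀ z ∉ P, pm z h ≤ k * pm z s) : D.Bd γ (fun r => D.nn r h) := by
  obtain ⟨C, hC, hP⟩ := hP; obtain ⟨E, hE, hs⟩ := hs
  refine ⟨k * C + k * E, by positivity, fun r hr ρ hρ hh => ?_⟩
  apply nn_le hr
  intro S hS
  set S1 := S.filter (fun z => D.ψ z ∈ P) with hS1
  have a1 := hP r hr ρ hρ hh S1 (fun z hz => by rw [hS1, Finset.mem_filter] at hz; exact ⟨hS z hz.1, hz.2⟩)
  have a2 := (sum_le_nn hr s S hS).trans (hs r hr ρ hρ hh)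
  have a3 : ∑ z ∈ S, pm (D.ψ z) h * Wt r z ≤ ∑ z ∈ S, ((if D.ψ z ∈ P then k * Wt r z else 0) + k * (pm (D.ψ z) s * Wt r z)) := by
    apply Finset.sum_le_sum
    intro z _
    have w := Wt_nonneg r z
    split_ifs with h
    · nlinarith [mul_le_mul_of_nonneg_right (h1 _ h) w]
    · nlinarith [mul_le_mul_of_nonneg_right (h2 _ h) w]
  rw [Finset.sum_add_distrib, ← Finset.sum_filter, ← Finset.mul_sum, ← Finset.mul_sum] at a3
  refine a3.trans ?_
  rw [add_mul, mul_assoc, mul_assoc]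
  exact add_le_add (mul_le_mul_of_nonneg_left a1 hk) (mul_le_mul_of_nonneg_left a2 hk)

/-- logarithmic derivatives of functions in `cT` with few zeros and poles are small -/
lemma logD_cS {x h : Mer} (hh : h ≠ 0) (H : h ∈ D.cT x) (hP : D.few (fun ρ => Real.posLog (D.ts x ρ)) {z | Mer.v z h ≠ 0}) :
    Mer.D h / h ∈ D.cS x := by
  apply InG.mk
  · exact lld_G hh H
  · apply nn_bd hP (s := 0) (k := 1)
    · have := (InG.C (D := D) (fun ρ => Real.posLog (D.ts x ρ)) 0).nn
      rwa [Mer.C.map_zero] at this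
    · norm_num
    · intro z _
      have := (pm_le_iff z (Mer.D h / h) 1).2 (by simpa using Mer.og_logD z)
      have := pm_nonneg z 0
      push_cast at *; linarith
    · intro z hz
      have hz : Mer.v z h = 0 := by simpa using hz
      have := (pm_le_iff z (Mer.D h / h) 0).2 (by simpa using Mer.og_logD0 hz)
      have := pm_nonneg z 0
      push_cast at *; linarith

end Dom
end


open Complex Filter Topology MeasureTheory
open scoped Classical

noncomputable section

lemma mF_le_of_le {r B : ℝ} (hr : 0 < r) {F : ℂ → ℂ} (hF : ∀ z ∈ Metric.closedBall (0:ℂ) r, MeromorphicAt F z)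
    (h : ∀ z, ‖z‖ = r → Real.posLog ‖F z‖ ≤ B) : mF r F ≤ B := by
  unfold mF
  apply Real.circleAverage_mono_on_of_le_circle (GoodF.ci hr hF)
  intro z hz
  rw [abs_of_pos hr] at hz
  exact h z (by simpa using hz)

lemma posLog_le_self {x : ℝ} (hx : 0 ≤ x) : Real.posLog x ≤ x := by
  rw [Real.posLog_apply]; apply max_le hx
  rcases eq_or_lt_of_le hx with h | h
  · rw [← h]; simp
  · have := Real.log_le_sub_one_of_pos h; linarith

/-- the whole plane -/
def PL : Dom where
  rad := {r | 1/2 ≤ r}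
  half := fun r hr => hr
  oc := fun r hr t h1 h2 => h1
  ψ := id
  an := fun r hr z hz => analyticAt_id
  dpos := fun r hr z hz => by simp; norm_num
  base := fun r => r + 1
  base_one := fun r hr => by simp only [Set.mem_ofPred_eq] at hr; linarith
  base_mono := fun r hr ρ hρ h => by linarith
  base_log := fun r hr => by
    simp only [Set.mem_ofPred_eq] at hr
    have := posLog_le_self (show 0 ≤ r by linarith); linarith
  zB := ⟨1, fun r hr => by
    simp only [Set.mem_ofPred_eq] at hr
    apply mF_le_of_le (by linarith) (fun z _ => analyticAt_id.meromorphicAt)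
    intro z hz
    simp only [id, hz]
    have := posLog_le_self (show 0 ≤ r by linarith); linarith⟩

def cay (ζ : ℂ) : ℂ := I * (1 + ζ) / (1 - ζ)

lemma cay_ne {ζ : ℂ} (h : ‖ζ‖ < 1) : 1 - ζ ≠ 0 := by
  intro h1; rw [sub_eq_zero] at h1; rw [← h1] at h; simp at h

lemma cay_an {ζ : ℂ} (h : ‖ζ‖ < 1) : AnalyticAt ℂ cay ζ := by
  unfold cay; have := cay_ne h; fun_prop (disch := assumption)

lemma cay_deriv {ζ : ℂ} (h : ‖ζ‖ < 1) : deriv cay ζ = 2 * I / (1 - ζ) ^ 2 := by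
  have h1 : HasDerivAt cay ((I * 1 * (1 - ζ) - I * (1 + ζ) * (-1)) / (1 - ζ) ^ 2) ζ :=
    (((hasDerivAt_id ζ).const_add 1).const_mul I).div ((hasDerivAt_id ζ).const_sub 1) (cay_ne h)
  rw [h1.deriv]; congr 1; ring

lemma cay_norm {ζ : ℂ} {r : ℝ} (h : ‖ζ‖ ≤ r) (hr : r < 1) : ‖cay ζ‖ ≤ 2 / (1 - r) := by
  unfold cay
  rw [norm_div, norm_mul, norm_I, one_mul]
  have h1 : ‖1 + ζ‖ ≤ 2 := (norm_add_le _ _).trans (by simp; linarith)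
  have h2 : 1 - r ≤ ‖1 - ζ‖ := by
    have := norm_sub_norm_le (1:ℂ) ζ; simp at this; linarith
  apply div_le_div₀ (by norm_num) h1 (by linarith) h2

/-- upper half plane -/
def HP : Dom where
  rad := {r | 1/2 ≤ r ∧ r < 1}
  half := fun r hr => hr.1
  oc := fun r hr t h1 h2 => ⟨h1, by have := hr.2; linarith⟩
  ψ := cay
  an := fun r hr z hz => cay_an (by have := hr.2; linarith)
  dpos := fun r hr z hz => by
    have h1 : ‖z‖ < 1 := by have := hr.2; linarith
    rw [cay_deriv h1, norm_div, norm_mul, norm_I, norm_pow]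
    have h2 : ‖1 - z‖ ≤ 2 := (norm_sub_le _ _).trans (by simp; linarith)
    have h3 : 0 < ‖1 - z‖ := norm_pos_iff.2 (cay_ne h1)
    rw [div_le_div_iff₀ (by norm_num) (by positivity)]
    simp; nlinarith
  base := fun r => Real.log (2 / (1 - r)) + 1
  base_one := fun r hr => by
    have : 0 ≤ Real.log (2 / (1 - r)) := Real.log_nonneg (by
      rw [le_div_iff₀ (by have := hr.2; linarith)]; linarith [hr.1])
    linarith
  base_mono := fun r hr ρ hρ h => by
    have := hr.2; have := hρ.2
    have : Real.log (2 / (1 - r)) ≤ Real.log (2 / (1 - ρ)) := by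
      apply Real.log_le_log (div_pos (by norm_num) (by linarith))
      apply div_le_div_of_nonneg_left (by norm_num) (by linarith) (by linarith)
    linarith
  base_log := fun r hr => by
    have h1 := hr.1; have h2 := hr.2
    have : Real.posLog r = 0 := by
      rw [Real.posLog_eq_zero_iff, abs_of_nonneg (by linarith)]; linarith
    rw [this]
    have : 0 ≤ Real.log (2 / (1 - r)) := Real.log_nonneg (by
      rw [le_div_iff₀ (by have := hr.2; linarith)]; linarith [hr.1])
    linarith
  zB := ⟨1, fun r hr => by
    have h1 := hr.1; have h2 := hr.2
    apply mF_le_of_le (by linarith) (fun z hz => (cay_an (by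
      have : ‖z‖ ≤ r := by simpa using hz
      linarith)).meromorphicAt)
    intro z hz
    have h3 := Real.posLog_le_posLog (norm_nonneg _) (cay_norm hz.le h2)
    have h4 : 1 ≤ 2 / (1 - r) := by rw [le_div_iff₀ (by linarith)]; linarith
    rw [Real.posLog_eq_log (x := 2 / (1 - r)) (by rwa [abs_of_nonneg (by linarith)])] at h3
    linarith⟩

lemma cay_im {ζ : ℂ} (h : ‖ζ‖ < 1) : 0 < (cay ζ).im := by
  have h1 : (cay ζ).im = (1 - ‖ζ‖ ^ 2) / ‖1 - ζ‖ ^ 2 := by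
    rw [← Complex.normSq_eq_norm_sq, ← Complex.normSq_eq_norm_sq]
    unfold cay
    rw [Complex.div_im]
    simp [Complex.normSq_apply]
    have : (1 - ζ.re) * (1 - ζ.re) + ζ.im * ζ.im ≠ 0 := by
      have := Complex.normSq_pos.2 (cay_ne h)
      simp [Complex.normSq_apply] at this; exact this.ne'
    field_simp; ring
  rw [h1]
  have := norm_pos_iff.2 (cay_ne h)
  have h0 := norm_nonneg ζ
  apply div_pos <;> nlinarith [pow_pos this 2]

lemma HP_few {P : Set ℂ} (h : (P ∩ {w | w.im ≠ 0}).Finite) (γ) : HP.few γ P := by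
  apply Dom.few_inter
  apply (Dom.few_finite h γ).mono
  rintro w ⟨h1, r, hr, z, hz, rfl⟩
  refine ⟨h1, ?_⟩
  exact (cay_im (by have := hr.2; linarith)).ne'

end


open Complex Filter Topology MeasureTheory
open scoped Classical

noncomputable section
namespace Mer

/-- differential subfields containing the rational functions -/
structure DSub (S : Subfield Mer) : Prop where
  d : ∀ h ∈ S, D h ∈ S
  c : ∀ a, C a ∈ S
  z : Z ∈ S

lemma const_ratio {h k Y : Mer} (hk : k ≠ 0) (h1 : D h = Y * h) (h2 : D k = Y * k) : ∃ c, h = C c * k := by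
  have : D (h / k) = 0 := by
    rw [D_div _ hk, h1, h2]; field_simp; ring
  obtain ⟨c, hc⟩ := const_of_D this
  exact ⟨c, by rw [← hc]; field_simp⟩

lemma D_C_mul (c : ℂ) (h : Mer) : D (C c * h) = C c * D h := by rw [D_mul, D_C]; ring

lemma C_two : C 2 = 2 := map_ofNat C 2

lemma C_half : C (1/2) = 1/2 := by simp [C_two]

lemma prim {S : Subfield Mer} (hS : DSub S) {h : Mer} {a b : ℂ} (hh : D h = C a * Z + C b) : h ∈ S := by
  have : D (h - (C (a/2) * Z^2 + C b * Z)) = 0 := by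
    rw [D_sub, D_add, D_C_mul, D_C_mul, D_sq, D_Z, hh]
    have : C (a/2) = C a / 2 := by simp [C_two]
    rw [this]; ring
  obtain ⟨c, hc⟩ := const_of_D this
  have : h = (C (a/2) * Z^2 + C b * Z) + C c := by rw [← hc]; ring
  rw [this]
  exact S.add_mem (S.add_mem (S.mul_mem (hS.c _) (S.pow_mem hS.z _)) (S.mul_mem (hS.c _) hS.z)) (hS.c _)

lemma algA_end {S : Subfield Mer} (hS : DSub S) {u t t1 Y1 X : Mer} {e e0 : ℂ} (hu : u ≠ 0) (ht : t = 1 - D u) (ht0 : t ≠ 0)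
    (ht1 : t1 = 1 - D (u * t⁻¹)) (ht10 : t1 ≠ 0) (hY1 : D t1 = Y1 * t1) (hX : X = C e * Z + C e0) (hX0 : X ≠ 0)
    (hXs : D (D (X * t⁻¹)) = Y1 * D (X * t⁻¹)) : u ∈ S := by
  obtain ⟨w, hw⟩ := const_ratio ht10 hXs hY1
  have h1 : D (X * t⁻¹ + C w * (u * t⁻¹) - C w * Z) = 0 := by
    rw [D_sub, D_add, D_C_mul, D_C_mul, D_Z, hw, ht1]; ring
  obtain ⟨d, hd⟩ := const_of_D h1
  have h2 : X + C w * u = (C w * Z + C d) * t := by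
    rw [← hd]; field_simp; ring
  have h3 : D ((C w * Z + C d) * u) = C (w - e) * Z + C (d - e0) := by
    rw [D_mul, D_add, D_C_mul, D_Z, D_C]
    have e1 : (C w * Z + C d) * D u = (C w * Z + C d) - (X + C w * u) := by rw [h2, ht]; ring
    rw [e1, hX]; simp; ring
  have h4 := prim hS h3
  have h5 : C w * Z + C d ≠ 0 := by
    intro h5
    rw [h5, zero_mul] at h2
    have hw0 : w = 0 := by
      have : D (C w * Z + C d) = C w := by rw [D_add, D_C_mul, D_C, D_Z]; ring
      rw [h5, D_zero] at this
      exact C_inj (by rw [← this, C.map_zero])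
    rw [hw0] at h2; simp at h2; exact hX0 h2
  have : u = ((C w * Z + C d) * u) / (C w * Z + C d) := by field_simp
  rw [this]
  exact S.div_mem h4 (S.add_mem (S.mul_mem (hS.c _) hS.z) (hS.c _))

lemma algA {S : Subfield Mer} (hS : DSub S) {L L1 t t1 : Mer} (hL : L ≠ 0) (hL1 : L1 = L + D L / L) (hL10 : L1 ≠ 0)
    (ht : t = L1 / L) (ht1 : t1 = (L1 + D L1 / L1) / L1) (ht10 : t1 ≠ 0)
    (hY : D t / t ∈ S) (hY1 : D t1 / t1 ∈ S) : L ∈ S := by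
  set Y := D t / t with eY
  set Y1 := D t1 / t1 with eY1
  have ht0 : t ≠ 0 := by rw [ht]; exact div_ne_zero hL10 hL
  set χ := D L / L with eχ
  have dL : D L = χ * L := by rw [eχ]; field_simp
  have dt : D t = Y * t := by rw [eY]; field_simp
  have dt1 : D t1 = Y1 * t1 := by rw [eY1]; field_simp
  have tL : t * L = L + χ := by rw [ht, hL1]; field_simp
  have dχ : D χ = χ^2 + (L + χ) * Y := by
    have : D (t * L) = D L + D χ := by rw [tL, D_add]
    rw [D_mul, dt, dL] at this
    linear_combination -this + (Y + χ) * tL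
  have t1L : t1 * (t * L) = t * L + (χ + Y) := by
    have e : L1 = t * L := by rw [tL, hL1]
    rw [ht1, e, D_mul, dt, dL]; field_simp; ring
  have dY : D Y = L * (Y1 - Y) + χ * (2 * Y1 + Y) + Y * (Y + Y1) := by
    have : D (t1 * (t * L)) = D (t * L) + (D χ + D Y) := by rw [t1L, D_add, D_add]
    rw [D_mul, dt1, D_mul, dt, dL, dχ] at this
    linear_combination -this + (Y1 + Y + χ) * t1L + (Y1) * tL
  set u := L⁻¹ with eu
  have hu : u ≠ 0 := inv_ne_zero hL
  have du : D u = - χ * u := by rw [eu, D_inv hL, dL]; field_simp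
  have tu : t = 1 - D u := by
    rw [du, eu]; field_simp; linear_combination tL
  suffices u ∈ S by
    have h := S.inv_mem this
    rwa [eu, inv_inv] at h
  have uL : L ∈ S → u ∈ S := fun h => S.inv_mem h
  by_cases hY0 : Y = 0
  · have : D t = 0 := by rw [dt, hY0, zero_mul]
    obtain ⟨c, hc⟩ := const_of_D this
    apply prim hS (a := 0) (b := 1 - c)
    rw [map_sub, ← hc, tu]; simp
  by_cases hα : Y1 - Y = 0
  · have e : Y1 = Y := sub_eq_zero.1 hα
    have hβ : 3 * Y ≠ 0 := mul_ne_zero (by norm_num) hY0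
    have h1 : χ = (D Y - 2 * Y^2) / (3 * Y) := by
      rw [eq_div_iff hβ, dY, e]; ring
    have hχ : χ ∈ S := by
      rw [h1]
      exact S.div_mem (S.sub_mem (hS.d _ hY) (S.mul_mem (ofNat_mem S 2) (S.pow_mem hY 2))) (S.mul_mem (ofNat_mem S 3) hY)
    have h2 : L = (D χ - χ^2) / Y - χ := by rw [dχ]; field_simp; ring
    apply uL; rw [h2]
    exact S.sub_mem (S.div_mem (S.sub_mem (hS.d _ hχ) (S.pow_mem hχ 2)) hY) hχ
  set b := (2 * Y1 + Y) / (Y1 - Y) with eb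
  set g := (D Y - Y * (Y + Y1)) / (Y1 - Y) with eg
  have hb : b ∈ S := S.div_mem (S.add_mem (S.mul_mem (ofNat_mem S 2) hY1) hY) (S.sub_mem hY1 hY)
  have hg : g ∈ S := S.div_mem (S.sub_mem (hS.d _ hY) (S.mul_mem hY (S.add_mem hY hY1))) (S.sub_mem hY1 hY)
  have bα : b * (Y1 - Y) = 2 * Y1 + Y := by rw [eb]; field_simp
  have gα : g * (Y1 - Y) = D Y - Y * (Y + Y1) := by rw [eg]; field_simp
  have Lb : L + b * χ = g := by
    apply mul_right_cancel₀ hα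
    rw [gα]; linear_combination χ * bα - dY
  have key : χ * (g + D b + b * Y - b^2 * Y) = D g - b * g * Y := by
    have : D L + (D b * χ + b * D χ) = D g := by rw [← Lb, D_add, D_mul]
    rw [dL, dχ] at this
    linear_combination this - (χ + b * Y) * Lb
  by_cases hc : g + D b + b * Y - b^2 * Y = 0
  · have hdb : D b = b^2 * Y - b * Y - g := by linear_combination hc
    have hdg : D g = b * g * Y := by rw [hc] at key; linear_combination -key
    have dti : D t⁻¹ = - Y * t⁻¹ := by rw [D_inv ht0, dt]; field_simp
    have et1 : t1 = 1 - D (u * t⁻¹) := by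
      rw [D_mul, dti, du, eu]; field_simp; linear_combination t1L
    by_cases hg0 : g = 0
    · apply algA_end hS (X := 1) (e := 0) (e0 := 1) hu tu ht0 et1 ht10 dt1 (by simp) one_ne_zero
      rw [one_mul, dti, D_mul, D_neg, dti]
      have : D Y = Y * (Y + Y1) := by rw [hg0] at gα; linear_combination -gα
      rw [this]; ring
    · have hx : D ((1 - b) / g) = 1 := by
        rw [D_div _ hg0, D_sub, D_one, hdb, hdg]; field_simp; ring
      obtain ⟨z0, hz0⟩ := const_of_D (h := (1 - b) / g - Z) (by rw [D_sub, hx, D_Z, sub_self])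
      apply algA_end hS (X := (1 - b) / g) (e := 1) (e0 := z0) hu tu ht0 et1 ht10 dt1
      · rw [← hz0]; simp
      · intro h; rw [h, D_zero] at hx; exact zero_ne_one hx
      · have e : ∀ x : Mer, D x = 1 → D (x * t⁻¹) = t⁻¹ * (1 - x * Y) := by
          intro x hx; rw [D_mul, hx, dti]; ring
        rw [e _ hx, D_mul, D_sub, D_one, D_mul, hx, dti]
        have e2 : (1 - b) / g * g = 1 - b := by field_simp
        have e3 : D Y = g * (Y1 - Y) + Y * (Y + Y1) := by rw [gα]; ring
        rw [e3]
        linear_combination (- t⁻¹ * (Y1 - Y)) * e2 + t⁻¹ * bα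
  · have hχ : χ ∈ S := by
      have : χ = (D g - b * g * Y) / (g + D b + b * Y - b^2 * Y) := by rw [eq_div_iff hc, key]
      rw [this]
      exact S.div_mem (S.sub_mem (hS.d _ hg) (S.mul_mem (S.mul_mem hb hg) hY))
        (S.sub_mem (S.add_mem (S.add_mem hg (hS.d _ hb)) (S.mul_mem hb hY)) (S.mul_mem (S.pow_mem hb 2) hY))
    apply uL
    have : L = g - b * χ := by rw [← Lb]; ring
    rw [this]
    exact S.sub_mem hg (S.mul_mem hb hχ)

end Mer
end


open Complex Filter Topology MeasureTheory
open scoped Classical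

noncomputable section
namespace Mer

/-- iterated derivatives -/
def F (φ : Mer) (n : ℕ) : Mer := D^[n] φ
/-- logarithmic derivatives -/
def L (φ : Mer) (n : ℕ) : Mer := F φ (n + 1) / F φ n
def tq (φ : Mer) (n : ℕ) : Mer := L φ (n + 1) / L φ n

lemma F_zero (φ) : F φ 0 = φ := rfl
lemma F_succ (φ n) : F φ (n + 1) = D (F φ n) := by
  unfold F; rw [Function.iterate_succ_apply']

lemma L_def (φ n) : L φ n = D (F φ n) / F φ n := by rw [L, F_succ]

lemma L_ne {φ n} (h : F φ n ≠ 0) (h1 : F φ (n + 1) ≠ 0) : L φ n ≠ 0 := div_ne_zero h1 h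

lemma L_succ {φ n} (h : F φ n ≠ 0) (h1 : F φ (n + 1) ≠ 0) : L φ (n + 1) = L φ n + D (L φ n) / L φ n := by
  rw [L_def φ n, D_div _ h, ← F_succ, ← F_succ, L]
  field_simp; ring

lemma tq_ne {φ n} (h : F φ n ≠ 0) (h1 : F φ (n + 1) ≠ 0) (h2 : F φ (n + 2) ≠ 0) : tq φ n ≠ 0 :=
  div_ne_zero (L_ne h1 h2) (L_ne h h1)

lemma tq_eq {φ n} (h : F φ n ≠ 0) (h1 : F φ (n + 1) ≠ 0) : tq φ n = 1 - D (L φ n)⁻¹ := by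
  rw [tq, L_succ h h1, D_inv (L_ne h h1)]
  have := L_ne h h1
  field_simp; ring

lemma v_tq {φ n} (h : F φ n ≠ 0) (h1 : F φ (n + 1) ≠ 0) (h2 : F φ (n + 2) ≠ 0) (z : ℂ) :
    v z (tq φ n) = v z (F φ n) + v z (F φ (n + 2)) - 2 * v z (F φ (n + 1)) := by
  rw [tq, v_div _ (L_ne h1 h2) (L_ne h h1), L, L, v_div _ h2 h1, v_div _ h1 h]; ring

lemma v_step {h : Mer} {z : ℂ} (h1 : D h ≠ 0) (a : v z h ≤ 0) (b : v z (D h) ≤ 0) :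
    (v z h = 0 ∧ v z (D h) = 0) ∨ (v z h < 0 ∧ v z (D h) = v z h - 1) := by
  rcases eq_or_lt_of_le a with a0 | a0
  · left
    refine ⟨a0, le_antisymm b ?_⟩
    exact og_v (og_D0 (og_of_v a0.ge)) h1
  · right; exact ⟨a0, (v_D a0.ne).2⟩

lemma v_tq0 {φ n} (h : F φ n ≠ 0) (h1 : F φ (n + 1) ≠ 0) (h2 : F φ (n + 2) ≠ 0) {z : ℂ}
    (a : v z (F φ n) ≤ 0) (a1 : v z (F φ (n + 1)) ≤ 0) (a2 : v z (F φ (n + 2)) ≤ 0) : v z (tq φ n) = 0 := by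
  rw [v_tq h h1 h2]
  rw [F_succ] at a1 h1
  rw [show n + 2 = n + 1 + 1 from rfl, F_succ φ (n + 1), F_succ] at a2 h2
  rw [show n + 2 = n + 1 + 1 from rfl, F_succ φ (n + 1), F_succ]
  have e1 := v_step h1 a a1
  have e2 := v_step h2 a1 a2
  omega

end Mer

namespace Dom
variable {D : Dom}
open Mer

lemma dsub (γ) : DSub (D.cls γ) := ⟨fun _ h => cls_D h, cls_C γ, cls_Z γ⟩

lemma cls_L {γ φ} {n : ℕ} (h : F φ n ≠ 0) (h1 : F φ (n + 1) ≠ 0) (H : L φ n ∈ D.cls γ) : L φ (n + 1) ∈ D.cls γ := by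
  rw [L_succ h h1]
  exact (D.cls γ).add_mem H ((D.cls γ).div_mem (cls_D H) H)

lemma Aplus {φ : Mer} {j : ℕ} (h : ∀ i ≤ 3, F φ (j + i) ≠ 0)
    (hz : ∀ i ≤ 3, D.few 0 {z | 0 < v z (F φ (j + i))}) : L φ j ∈ D.cls 0 := by
  have n0 := h 0 (by norm_num)
  have n1 := h 1 (by norm_num)
  have n2 := h 2 (by norm_num)
  have n3 := h 3 (by norm_num)
  apply growth
  have c0 : L φ j ∈ D.cT (L φ j) := self_cT _
  have c1 : L φ (j + 1) ∈ D.cT (L φ j) := cls_L n0 n1 c0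
  have c2 : L φ (j + 2) ∈ D.cT (L φ j) := cls_L n1 n2 c1
  have f4 := ((((hz 0 (by norm_num)).union (hz 1 (by norm_num))).union (hz 2 (by norm_num))).union (hz 3 (by norm_num)))
  refine algA (dsub _) (L_ne n0 n1) (L_succ n0 n1) (L_ne n1 n2) (t := tq φ j) (t1 := tq φ (j + 1)) rfl ?_ (tq_ne n1 n2 n3) ?_ ?_
  · rw [← L_succ n1 n2]; rfl
  · apply logD_cS (tq_ne n0 n1 n2) ((D.cT _).div_mem c1 c0)
    apply few.gauge
    apply f4.mono
    intro z hz
    by_contra hc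
    simp only [Set.mem_union, Set.mem_ofPred_eq, not_or, not_lt] at hc
    exact hz (v_tq0 n0 n1 n2 hc.1.1.1 hc.1.1.2 hc.1.2)
  · apply logD_cS (tq_ne n1 n2 n3) ((D.cT _).div_mem c2 c1)
    apply few.gauge
    apply f4.mono
    intro z hz
    by_contra hc
    simp only [Set.mem_union, Set.mem_ofPred_eq, not_or, not_lt] at hc
    exact hz (v_tq0 n1 n2 n3 hc.1.1.2 hc.1.2 hc.2)

end Dom
end


open Complex Filter Topology MeasureTheory
open scoped Classical

noncomputable section

lemma poisson_bd {G : ℂ → ℂ} {r M : ℝ} (hr : 0 < r) (hG : ∀ z, ‖z‖ ≤ r → AnalyticAt ℂ G z)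
    (hM : mF r (fun z => exp (G z)) ≤ M) {w : ℂ} (hw : ‖w‖ < r) : (G w).re ≤ (r + ‖w‖) / (r - ‖w‖) * M := by
  have hwb : w ∈ Metric.ball (0:ℂ) r := by simpa using hw
  have h1 : InnerProductSpace.HarmonicOnNhd (fun z => (G z).re) (Metric.closedBall 0 r) := by
    intro z hz
    exact (hG z (by simpa using hz)).harmonicAt_re
  have h2 := InnerProductSpace.HarmonicOnNhd.circleAverage_re_herglotzRieszKernel_smul h1 hwb
  rw [← h2]
  have hK : 0 ≤ (r + ‖w‖) / (r - ‖w‖) := by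
    have := norm_nonneg w
    apply div_nonneg <;> linarith
  refine le_trans ?_ (mul_le_mul_of_nonneg_left hM hK)
  unfold mF
  rw [← smul_eq_mul, ← Real.circleAverage_fun_smul]
  apply Real.circleAverage_mono
  · apply ContinuousOn.circleIntegrable hr.le
    apply ContinuousOn.smul
    · apply Complex.continuous_re.comp_continuousOn
      rw [herglotzRieszKernel_fun_def]
      apply ContinuousOn.div (by fun_prop) (by fun_prop)
      intro z hz h
      have h1 : z = w := by linear_combination h
      have : ‖z‖ = r := by simpa using hz
      rw [h1] at this; linarith
    · intro z hz
      have : ‖z‖ = r := by simpa using hz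
      exact (Complex.continuous_re.continuousAt.comp (hG z this.le).continuousAt).continuousWithinAt
  · have := GoodF.ci (F := fun z => exp (G z)) hr (fun z hz => by
      have := hG z (by simpa using hz)
      exact (this.cexp).meromorphicAt)
    have h3 := this.const_fun_smul (a := (r + ‖w‖) / (r - ‖w‖))
    exact h3
  · intro z hz
    rw [abs_of_pos hr] at hz
    have hz2 : ‖z‖ = r := by simpa using hz
    have a1 := re_herglotzRieszKernel_le (c := 0) hz hwb
    have a2 := le_re_herglotzRieszKernel (c := 0) hz hwb
    simp only [sub_zero] at a1 a2
    have a0 : 0 ≤ ((z + w) / (z - w)).re := le_trans (by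
      have := norm_nonneg w
      apply div_nonneg <;> linarith) a2
    simp only [Pi.smul_apply', smul_eq_mul, Function.comp, herglotzRieszKernel_def, sub_zero]
    have a3 : (G z).re ≤ Real.posLog ‖exp (G z)‖ := by
      rw [Complex.norm_exp, Real.posLog_apply, Real.log_exp]; exact le_max_right _ _
    have a4 : 0 ≤ Real.posLog ‖exp (G z)‖ := Real.posLog_nonneg
    calc _ ≤ ((z + w) / (z - w)).re * Real.posLog ‖exp (G z)‖ := mul_le_mul_of_nonneg_left a3 a0
      _ ≤ _ := mul_le_mul_of_nonneg_right a1 a4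

lemma halfplane_bd {P : ℂ → ℂ} (hP : Differentiable ℂ P) {A : ℝ} (hA : 0 ≤ A)
    (H : ∀ r, 1/2 ≤ r → r < 1 → mF r (fun z => exp (P (cay z))) ≤ A * (Real.log (2 / (1 - r)) + 1)) :
    ∀ z : ℂ, 0 < z.im → (P z).re ≤ 16 * A * (√((‖z‖ ^ 2 + 1) / z.im)) ^ 3 := by
  intro z hz
  set q := √((‖z‖ ^ 2 + 1) / z.im) with hq
  have hq2 : q ^ 2 = (‖z‖ ^ 2 + 1) / z.im := Real.sq_sqrt (by positivity)
  have hq0 : 0 < q := Real.sqrt_pos.2 (by positivity)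
  have hzi : z + I ≠ 0 := by
    intro h; have := congrArg Complex.im h; simp at this; linarith
  set ζ := (z - I) / (z + I) with hζ
  have hn : ‖z‖ ^ 2 = z.re ^ 2 + z.im ^ 2 := by rw [← Complex.normSq_eq_norm_sq, Complex.normSq_apply]; ring
  have hN : ‖z + I‖ ^ 2 = z.re ^ 2 + (z.im + 1) ^ 2 := by
    rw [← Complex.normSq_eq_norm_sq, Complex.normSq_apply]; simp; ring
  have hN2 : ‖z - I‖ ^ 2 = z.re ^ 2 + (z.im - 1) ^ 2 := by
    rw [← Complex.normSq_eq_norm_sq, Complex.normSq_apply]; simp; ring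
  have hN0 : 0 < ‖z + I‖ ^ 2 := by have := norm_pos_iff.2 hzi; positivity
  have h1 : 1 - ‖ζ‖ ^ 2 = 4 * z.im / ‖z + I‖ ^ 2 := by
    rw [hζ, norm_div, div_pow, eq_div_iff hN0.ne', sub_mul, div_mul_cancel₀ _ hN0.ne', hN, hN2]; ring
  have hζ1 : ‖ζ‖ < 1 := by
    have : 0 < 1 - ‖ζ‖ ^ 2 := by rw [h1]; positivity
    nlinarith [norm_nonneg ζ]
  have hcay : cay ζ = z := by
    unfold cay
    rw [div_eq_iff (cay_ne hζ1), hζ]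
    field_simp; ring_nf; 
  set δ := 1 - ‖ζ‖ with hδ
  have hδ0 : 0 < δ := by linarith
  have hδ1 : δ ≤ 1 := by have := norm_nonneg ζ; linarith
  have hδq : 1 / δ ≤ q ^ 2 := by
    rw [hq2, div_le_div_iff₀ hδ0 hz, one_mul]
    have h2 : 4 * z.im = (1 - ‖ζ‖ ^ 2) * ‖z + I‖ ^ 2 := by rw [h1]; field_simp
    have h3 : 1 - ‖ζ‖ ^ 2 ≤ 2 * δ := by nlinarith [norm_nonneg ζ, sq_nonneg (1 - ‖ζ‖)]
    have h4 : ‖z + I‖ ^ 2 ≤ 2 * (‖z‖ ^ 2 + 1) := by rw [hN, hn]; nlinarith [sq_nonneg (z.im - 1), sq_nonneg z.re]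
    have h5 : 4 * z.im ≤ (2 * δ) * (2 * (‖z‖ ^ 2 + 1)) := by
      rw [h2]; exact mul_le_mul h3 h4 hN0.le (by positivity)
    linarith
  have hb := poisson_bd (G := fun w => P (cay w)) (r := 1 - δ / 2) (by linarith)
    (fun w hw => (hP.analyticAt _).comp (cay_an (by linarith))) (H (1 - δ / 2) (by linarith) (by linarith)) (w := ζ) (by linarith)
  rw [hcay] at hb
  refine hb.trans ?_
  have e1 : (1 - δ / 2 + ‖ζ‖) / (1 - δ / 2 - ‖ζ‖) ≤ 4 * q ^ 2 := by
    have : 1 - δ / 2 - ‖ζ‖ = δ / 2 := by rw [hδ]; ring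
    rw [this, div_le_iff₀ (by positivity)]
    rw [div_le_iff₀ hδ0] at hδq
    nlinarith
  have e2 : Real.log (2 / (1 - (1 - δ / 2))) + 1 ≤ 4 * q := by
    have : 2 / (1 - (1 - δ / 2)) = 4 * (1 / δ) := by rw [show 1 - (1 - δ / 2) = δ / 2 by ring]; field_simp; norm_num
    rw [this]
    have : 4 * (1 / δ) ≤ (2 * q) ^ 2 := by nlinarith
    have h6 := Real.log_le_log (by positivity) this
    rw [Real.log_pow] at h6
    have h7 := Real.log_le_sub_one_of_pos (show 0 < 2 * q by positivity)
    push_cast at h6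
    linarith
  have e3 : 0 ≤ Real.log (2 / (1 - (1 - δ / 2))) + 1 := by
    have := Real.log_nonneg (x := 2 / (1 - (1 - δ / 2))) (by rw [le_div_iff₀ (by linarith)]; linarith)
    linarith
  calc _ ≤ 4 * q ^ 2 * (A * (4 * q)) := by
        apply mul_le_mul e1 (mul_le_mul_of_nonneg_left e2 hA) (by positivity) (by positivity)
    _ = _ := by ring

set_option maxHeartbeats 1000000 in
lemma lin_of_bd {P : ℂ → ℂ} (hP : Differentiable ℂ P) {B : ℝ} (hB : 0 ≤ B)
    (H : ∀ z : ℂ, z.im ≠ 0 → (P z).re ≤ B * (√((‖z‖ ^ 2 + 1) / |z.im|)) ^ 3) :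
    ∃ c0 c1, ∀ z, P z = c0 + c1 * z := by
  set c0 := P 0
  set c1 := dslope P 0 0
  set Q := dslope (dslope P 0) 0 with hQ
  have hd1 : Differentiable ℂ (dslope P 0) := by
    rw [← differentiableOn_univ, differentiableOn_dslope (by simp)]; exact hP.differentiableOn
  have hd2 : Differentiable ℂ Q := by
    rw [← differentiableOn_univ, differentiableOn_dslope (by simp)]; exact hd1.differentiableOn
  have hPQ : ∀ z, P z = c0 + c1 * z + z ^ 2 * Q z := by
    intro z
    have e1 := sub_smul_dslope P 0 z
    have e2 := sub_smul_dslope (dslope P 0) 0 z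
    simp only [sub_zero, smul_eq_mul] at e1 e2
    linear_combination -e1 - z * e2
  set M := 4 * B + ‖c0‖ + ‖c1‖ + 1 with hM
  have hM0 : 0 < M := by positivity
  have key : ∀ z, ‖Q z‖ ≤ 64 * (M + ‖Q 0‖) := by
    intro z
    set r := 2 * ‖z‖ + 1 with hr
    have hz0 := norm_nonneg z
    have hr1 : 1 ≤ r := by linarith
    set G : ℂ → ℂ := fun w => - (w ^ 2 - r ^ 2) ^ 2 * Q w / 4 with hG
    have hGd : Differentiable ℂ G := by fun_prop
    have hbd : ∀ w, ‖w‖ = r → (G w).re ≤ M * r ^ 4 := by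
      intro w hw
      have hw2 : ((r:ℂ)) ^ 2 = w * (starRingEnd ℂ) w := by
        rw [Complex.mul_conj, Complex.normSq_eq_norm_sq, hw]; push_cast; ring
      have hcc : (starRingEnd ℂ) w = w - 2 * w.im * I := by
        apply Complex.ext <;> simp; ring
      have hGw : G w = ((w.im ^ 2 : ℝ) : ℂ) * (P w - c0 - c1 * w) := by
        have : w ^ 2 * Q w = P w - c0 - c1 * w := by rw [hPQ w]; ring
        rw [← this]
        simp only [hG]
        rw [hw2, hcc]; push_cast
        linear_combination (-(w:ℂ) ^ 2 * w.im ^ 2 * Q w) * I_sq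
      rw [hGw, Complex.re_ofReal_mul]
      have hy : |w.im| ≤ r := hw ▸ Complex.abs_im_le_norm w
      have h3 : (P w - c0 - c1 * w).re ≤ (P w).re + ‖c0‖ + ‖c1‖ * r := by
        simp only [Complex.sub_re]
        have := neg_le_of_abs_le (Complex.abs_re_le_norm c0)
        have := neg_le_of_abs_le (Complex.abs_re_le_norm (c1 * w))
        rw [norm_mul, hw] at this
        linarith
      have hy2 : w.im ^ 2 ≤ r ^ 2 := by rw [← sq_abs]; gcongr
      have hr2 : r ^ 2 ≤ r ^ 4 := pow_le_pow_right₀ hr1 (by norm_num)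
      have hr3 : r ^ 3 ≤ r ^ 4 := pow_le_pow_right₀ hr1 (by norm_num)
      have h4 : w.im ^ 2 * (P w).re ≤ 4 * B * r ^ 4 := by
        by_cases h0 : w.im = 0
        · rw [h0]; simp; positivity
        have h5 := H w h0
        have hyp : 0 < |w.im| := abs_pos.2 h0
        set q := √((‖w‖ ^ 2 + 1) / |w.im|) with hq
        have hq2 : q ^ 2 = (‖w‖ ^ 2 + 1) / |w.im| := Real.sq_sqrt (by positivity)
        have hq0 : 0 ≤ q := Real.sqrt_nonneg _
        have h6 : |w.im| * q ^ 2 ≤ 2 * r ^ 2 := by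
          rw [hq2, hw]; field_simp; nlinarith
        have h7 : |w.im| * q ≤ 2 * r ^ 2 := by
          apply le_of_sq_le_sq _ (by positivity)
          have : (|w.im| * q) ^ 2 = |w.im| * (|w.im| * q ^ 2) := by ring
          rw [this]
          calc _ ≤ r * (2 * r ^ 2) := mul_le_mul hy h6 (by positivity) (by positivity)
            _ ≤ _ := by nlinarith [pow_pos (show 0 < r by linarith) 4]
        calc _ ≤ w.im ^ 2 * (B * q ^ 3) := mul_le_mul_of_nonneg_left h5 (sq_nonneg _)
          _ = B * ((|w.im| * q ^ 2) * (|w.im| * q)) := by rw [← sq_abs w.im]; ring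
          _ ≤ B * ((2 * r ^ 2) * (2 * r ^ 2)) := by
            apply mul_le_mul_of_nonneg_left _ hB
            apply mul_le_mul h6 h7 (by positivity) (by positivity)
          _ = _ := by ring
      calc _ ≤ w.im ^ 2 * ((P w).re + ‖c0‖ + ‖c1‖ * r) := mul_le_mul_of_nonneg_left h3 (sq_nonneg _)
        _ = w.im ^ 2 * (P w).re + w.im ^ 2 * (‖c0‖ + ‖c1‖ * r) := by ring
        _ ≤ 4 * B * r ^ 4 + r ^ 2 * (‖c0‖ + ‖c1‖ * r) := by gcongr
        _ = 4 * B * r ^ 4 + ‖c0‖ * r ^ 2 + ‖c1‖ * r ^ 3 := by ring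
        _ ≤ 4 * B * r ^ 4 + ‖c0‖ * r ^ 4 + ‖c1‖ * r ^ 4 := by gcongr
        _ ≤ _ := by rw [hM]; nlinarith [pow_pos (show 0 < r by linarith) 4]
    have hbd2 : Set.MapsTo G (Metric.ball 0 r) {z | z.re ≤ M * r ^ 4} := by
      intro w hw
      have := Complex.norm_le_of_forall_mem_frontier_norm_le (f := fun w => exp (G w)) (U := Metric.ball (0:ℂ) r) Metric.isBounded_ball
        (hGd.cexp.diffContOnCl) (C := Real.exp (M * r ^ 4)) (fun u hu => by
          rw [Complex.norm_exp]
          apply Real.exp_le_exp.2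
          apply hbd
          rw [frontier_ball _ (by linarith)] at hu
          simpa using hu) (subset_closure hw)
      rw [Complex.norm_exp] at this
      exact Real.exp_le_exp.1 this
    have hzb : z ∈ Metric.ball (0:ℂ) r := by simp; linarith
    have hbc := Complex.borelCaratheodory (M := M * r ^ 4) (by positivity) hGd.differentiableOn hbd2 (by linarith) hzb
    have hrz : 0 < r - ‖z‖ := by linarith
    have e1 : 2 * (M * r ^ 4) * ‖z‖ / (r - ‖z‖) ≤ 2 * (M * r ^ 4) := by
      rw [div_le_iff₀ hrz]
      apply mul_le_mul_of_nonneg_left _ (by positivity); linarith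
    have e2 : ‖G 0‖ * (r + ‖z‖) / (r - ‖z‖) ≤ ‖G 0‖ * 3 := by
      rw [div_le_iff₀ hrz, mul_assoc]
      apply mul_le_mul_of_nonneg_left _ (by positivity); linarith
    have e3 : ‖G 0‖ = r ^ 4 * ‖Q 0‖ / 4 := by
      simp only [hG]
      rw [norm_div, norm_mul, norm_neg, norm_pow]
      simp [abs_of_pos (show 0 < r by linarith)]
      left; ring
    have e4 : r ^ 4 / 16 * ‖Q z‖ ≤ ‖G z‖ := by
      simp only [hG]
      rw [norm_div, norm_mul, norm_neg, norm_pow]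
      have : r ^ 2 / 2 ≤ ‖z ^ 2 - (r:ℂ) ^ 2‖ := by
        have h := norm_sub_norm_le ((r:ℂ) ^ 2) (z ^ 2)
        rw [norm_pow, norm_pow, Complex.norm_real, Real.norm_of_nonneg (by linarith), norm_sub_rev] at h
        nlinarith
      have h2 : (r ^ 2 / 2) ^ 2 ≤ ‖z ^ 2 - (r:ℂ) ^ 2‖ ^ 2 := by gcongr
      have h3 := norm_nonneg (Q z)
      simp only [Complex.norm_ofNat]
      nlinarith
    have hr4 : 0 < r ^ 4 := by positivity
    have : r ^ 4 * ‖Q z‖ ≤ r ^ 4 * (64 * (M + ‖Q 0‖)) := by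
      have := norm_nonneg (Q 0)
      nlinarith
    exact le_of_mul_le_mul_left this hr4
  obtain ⟨c2, hc2⟩ := hd2.exists_const_forall_eq_of_bounded
    (isBounded_iff_forall_norm_le.2 ⟨64 * (M + ‖Q 0‖), by rintro _ ⟨z, rfl⟩; exact key z⟩)
  have hP2 : ∀ z, P z = c0 + c1 * z + z ^ 2 * c2 := fun z => by rw [hPQ z, hc2]
  have ray : ∀ w : ℂ, w.im ≠ 0 → (w ^ 2 * c2).re ≤ 0 := by
    intro w hw
    by_contra! hα
    set α := (w ^ 2 * c2).re with hαd
    set K := (‖w‖ ^ 2 + 1) / |w.im| with hK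
    have hwi : 0 < |w.im| := abs_pos.2 hw
    have hK0 : 0 < K := by positivity
    set E := B * √K ^ 3 + ‖c0‖ + ‖c1‖ * ‖w‖ with hE
    have hE0 : 0 ≤ E := by positivity
    set s := E / α + 1 with hs
    have hs1 : 1 ≤ s := by have : 0 ≤ E / α := by positivity
                           linarith
    have h1 := H ((s ^ 2 : ℝ) * w) (by rw [Complex.im_ofReal_mul]; exact mul_ne_zero (by positivity) hw)
    have h2 : √((‖((s ^ 2 : ℝ) : ℂ) * w‖ ^ 2 + 1) / |(((s ^ 2 : ℝ) : ℂ) * w).im|) ≤ s * √K := by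
      apply Real.sqrt_le_iff.2 ⟨by positivity, ?_⟩
      rw [mul_pow, Real.sq_sqrt hK0.le, norm_mul, Complex.norm_real, Complex.im_ofReal_mul, abs_mul, Real.norm_of_nonneg (by positivity), abs_of_nonneg (by positivity), hK]
      rw [← mul_div_assoc, div_le_div_iff₀ (by positivity) (by positivity)]
      have : 1 ≤ s ^ 4 := one_le_pow₀ hs1
      nlinarith
    have h3 : (√((‖((s ^ 2 : ℝ) : ℂ) * w‖ ^ 2 + 1) / |(((s ^ 2 : ℝ) : ℂ) * w).im|)) ^ 3 ≤ (s * √K) ^ 3 :=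
      pow_le_pow_left₀ (Real.sqrt_nonneg _) h2 3
    have h4 : (P ((s ^ 2 : ℝ) * w)).re = c0.re + s ^ 2 * (c1 * w).re + s ^ 4 * α := by
      rw [hP2, hαd, ← Complex.re_ofReal_mul, ← Complex.re_ofReal_mul, ← Complex.add_re, ← Complex.add_re]
      congr 1; push_cast; ring
    rw [h4] at h1
    have h5 := h1.trans (mul_le_mul_of_nonneg_left h3 hB)
    have a1 := neg_le_of_abs_le (Complex.abs_re_le_norm c0)
    have a2 := neg_le_of_abs_le (Complex.abs_re_le_norm (c1 * w))
    rw [norm_mul] at a2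
    have b3 : 1 ≤ s ^ 3 := one_le_pow₀ hs1
    have b2 : s ^ 2 ≤ s ^ 3 := pow_le_pow_right₀ hs1 (by norm_num)
    have h6 : s ^ 4 * α ≤ E * s ^ 3 := by
      have q1 : - (s ^ 2 * (c1 * w).re) ≤ s ^ 3 * (‖c1‖ * ‖w‖) := by
        calc _ = s ^ 2 * (-(c1 * w).re) := by ring
          _ ≤ s ^ 2 * (‖c1‖ * ‖w‖) := by apply mul_le_mul_of_nonneg_left _ (by positivity); linarith
          _ ≤ _ := by gcongr
      have q2 : ‖c0‖ ≤ s ^ 3 * ‖c0‖ := le_mul_of_one_le_left (norm_nonneg _) b3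
      have q3 : E * s ^ 3 = B * (s * √K) ^ 3 + s ^ 3 * ‖c0‖ + s ^ 3 * (‖c1‖ * ‖w‖) := by rw [hE]; ring
      rw [q3]; linarith
    have h7 : s * α ≤ E := by
      have : s ^ 3 * (s * α) ≤ s ^ 3 * E := by linarith
      exact le_of_mul_le_mul_left this (by positivity)
    have h8 : s * α = E + α := by rw [hs]; field_simp
    linarith
  have r1 := ray (1 + I) (by simp)
  have r2 := ray (1 - I) (by simp)
  have r3 := ray (2 + I) (by simp)
  have r4 := ray (1 - 2 * I) (by simp)
  simp [pow_two] at r1 r2 r3 r4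
  have hc20 : c2 = 0 := by
    apply Complex.ext <;> simp <;> linarith
  exact ⟨c0, c1, fun z => by rw [hP2, hc20]; ring⟩

end


open Complex Filter Topology MeasureTheory
open scoped Classical

noncomputable section
namespace Mer

lemma entire_rep {h : Mer} (hh : ∀ z, og z 0 h) : ∃ (H : ℂ → ℂ) (hH : Differentiable ℂ H),
    h = mk H (fun z => (hH.analyticAt z).meromorphicAt) := by
  have hm : MeromorphicOn h.rep Set.univ := fun z _ => h.rep_mero z
  have hd : Differentiable ℂ (toMeromorphicNFOn h.rep Set.univ) := by
    intro z
    have h1 := (meromorphicNFOn_toMeromorphicNFOn h.rep Set.univ (Set.mem_univ z)).meromorphicOrderAt_nonneg_iff_analyticAt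
    apply (h1.1 _).differentiableAt
    rw [meromorphicOrderAt_toMeromorphicNFOn hm (Set.mem_univ z)]
    exact og_iff_ord.1 (hh z)
  refine ⟨_, hd, ?_⟩
  conv_lhs => rw [← mk_rep h]
  exact mk_eq.2 fun z => (hm.toMeromorphicNFOn_eq_self_on_nhdsNE (Set.mem_univ z)).symm

lemma exp_mero {P : ℂ → ℂ} (hP : Differentiable ℂ P) (z : ℂ) : MeromorphicAt (fun z => exp (P z)) z :=
  ((hP.cexp).analyticAt z).meromorphicAt

lemma D_exp {P : ℂ → ℂ} (hP : Differentiable ℂ P) {Q : ℂ → ℂ} (hQ : ∀ z, MeromorphicAt Q z)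
    (h : ∀ z, HasDerivAt P (Q z) z) :
    D (mk _ (exp_mero hP)) = mk Q hQ * mk _ (exp_mero hP) := by
  rw [D_mk, mk_mul]
  refine mk_eq.2 fun z => Eventually.of_forall fun w => ?_
  simp only [Pi.mul_apply]
  rw [((h w).cexp).deriv]; ring

lemma exp_v {P : ℂ → ℂ} (hP : Differentiable ℂ P) (z : ℂ) : v z (mk _ (exp_mero hP)) = 0 := by
  unfold v; rw [ord_mk, ((hP.cexp).analyticAt z).meromorphicOrderAt_eq,
    ((hP.cexp).analyticAt z).analyticOrderAt_eq_zero.2 (exp_ne_zero _)]; rfl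

lemma exp_ne {P : ℂ → ℂ} (hP : Differentiable ℂ P) : mk _ (exp_mero hP) ≠ 0 := by
  intro h
  have h1 := ord_mk (exp_mero hP) 0
  rw [h, ord_zero, ((hP.cexp).analyticAt 0).meromorphicOrderAt_eq,
    ((hP.cexp).analyticAt 0).analyticOrderAt_eq_zero.2 (exp_ne_zero _)] at h1
  simp at h1

lemma exp_rep {E : Mer} (hE : E ≠ 0) (hv : ∀ z, v z E = 0) : ∃ (P : ℂ → ℂ) (hP : Differentiable ℂ P),
    E = mk _ (exp_mero hP) := by
  obtain ⟨Q, hQ, hq⟩ := entire_rep (fun z => og_logD0 (hv z))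
  obtain ⟨P, hP⟩ := hQ.isExactOn_univ
  have hP' : ∀ z, HasDerivAt P (Q z) z := fun z => hP z (Set.mem_univ z)
  have hPd : Differentiable ℂ P := fun z => (hP' z).differentiableAt
  have h1 := D_exp hPd (fun z => (hQ.analyticAt z).meromorphicAt) hP'
  rw [← hq] at h1
  obtain ⟨c, hc⟩ := const_ratio (exp_ne hPd) (show D E = D E / E * E by field_simp) h1
  have hc0 : c ≠ 0 := by rintro rfl; simp at hc; exact hE hc
  refine ⟨fun z => P z + log c, hPd.add_const _, ?_⟩
  rw [hc, C_def, mk_mul]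
  refine mk_eq.2 fun z => Eventually.of_forall fun w => ?_
  simp [exp_add, exp_log hc0]; ring

/-- rational functions -/
def RatF : Subfield Mer := Subfield.closure (Set.range C ∪ {Z})

lemma RatF_c (a : ℂ) : C a ∈ RatF := Subfield.subset_closure (Or.inl ⟨a, rfl⟩)
lemma RatF_z : Z ∈ RatF := Subfield.subset_closure (Or.inr rfl)

lemma RatF_le {S : Subfield Mer} (hc : ∀ a, C a ∈ S) (hz : Z ∈ S) : RatF ≤ S := by
  apply Subfield.closure_le.2
  rintro x (⟨a, rfl⟩ | rfl)
  · exact hc a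
  · exact hz

lemma RatF_D {h : Mer} (hh : h ∈ RatF) : D h ∈ RatF := by
  induction hh using Subfield.closure_induction with
  | mem x hx =>
    rcases hx with (⟨a, rfl⟩ | rfl)
    · simp [RatF.zero_mem]
    · simp [RatF.one_mem]
  | one => simp [RatF.zero_mem]
  | add x y hx hy h1 h2 => rw [D_add]; exact RatF.add_mem h1 h2
  | neg x hx h1 => rw [D_neg]; exact RatF.neg_mem h1
  | inv x hx h1 =>
    by_cases h0 : x = 0
    · rw [h0]; simp [RatF.zero_mem]
    · rw [D_inv h0]; exact RatF.div_mem (RatF.neg_mem h1) (RatF.pow_mem hx 2)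
  | mul x y hx hy h1 h2 => rw [D_mul]; exact RatF.add_mem (RatF.mul_mem h1 hy) (RatF.mul_mem hx h2)

lemma RatF_dsub : DSub RatF := ⟨fun _ h => RatF_D h, RatF_c, RatF_z⟩

lemma til_Z : til Z = Z := by
  unfold Z; rw [til_mk]
  exact mk_eq.2 fun z => Eventually.of_forall fun w => by simp [mtilde]

lemma RatF_til {h : Mer} (hh : h ∈ RatF) : til h ∈ RatF := by
  have : RatF ≤ RatF.comap tilH := RatF_le (fun a => by
    show til (C a) ∈ RatF
    rw [til_C]; exact RatF_c _) (by show til Z ∈ RatF; rw [til_Z]; exact RatF_z)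
  exact this hh

lemma RatF_cls (D : Dom) (γ) : RatF ≤ D.cls γ := RatF_le (Dom.cls_C γ) (Dom.cls_Z γ)

/-- divisor realisation -/
lemma exists_rat (P : Finset ℂ) (n : ℂ → ℤ) : ∃ R ∈ RatF, R ≠ 0 ∧ ∀ z, v z R = if z ∈ P then n z else 0 := by
  induction P using Finset.induction_on with
  | empty => exact ⟨1, RatF.one_mem, one_ne_zero, fun z => by simp [v_one]⟩
  | insert a P ha ih =>
    obtain ⟨R, hR, hR0, h⟩ := ih
    obtain ⟨h1, h2⟩ := v_Z_sub1 a
    have hz : ∀ z, z ≠ a → v z (Z - C a) = 0 := fun z hz => by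
      have c0 : C (z - a) ≠ 0 := fun h => by
        have := C_inj (h.trans C.map_zero.symm)
        exact hz (sub_eq_zero.1 this)
      have h3 := v_add_of_lt (z := z) (n := 1) (k := Z - C z) c0 (by rw [v_C]; norm_num) (og_of_v (by rw [(v_Z_sub1 z).1]))
      have e : C (z - a) + (Z - C z) = Z - C a := by simp
      rw [e, v_C] at h3; exact h3.2
    have vz : ∀ z, ∀ k : ℤ, v z ((Z - C a)^k) = k * v z (Z - C a) := by
      intro z k
      cases k with
      | ofNat k => simp [v_pow]
      | negSucc k => rw [zpow_negSucc, v_inv, v_pow, Int.negSucc_eq]; push_cast; ring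
    refine ⟨R * (Z - C a)^(n a), RatF.mul_mem hR (RatF.zpow_mem (RatF.sub_mem RatF_z (RatF_c _)) _),
      mul_ne_zero hR0 (zpow_ne_zero _ h2), fun z => ?_⟩
    rw [v_mul z hR0 (zpow_ne_zero _ h2), vz, h]
    by_cases hza : z = a
    · subst hza; simp [ha, h1]
    · simp [hza, hz z hza]

lemma HP_mF {E : Mer} {P : ℂ → ℂ} {hP : Differentiable ℂ P} (hE : E = mk _ (exp_mero hP)) (h : E ∈ HP.cls 0) :
    ∃ A, 0 ≤ A ∧ ∀ r, 1/2 ≤ r → r < 1 → mF r (fun z => exp (P (cay z))) ≤ A * (Real.log (2 / (1 - r)) + 1) := by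
  obtain ⟨A, hA, H⟩ := Dom.InG.mm h
  refine ⟨A * 3, by positivity, fun r h1 h2 => ?_⟩
  have hr : r ∈ HP.rad := ⟨h1, h2⟩
  have hρ : (1 + r)/2 ∈ HP.rad := ⟨by linarith, by linarith⟩
  have h3 := H r hr _ hρ (by linarith)
  have h4 : HP.mm r E = mF r (fun z => exp (P (cay z))) := by
    apply Dom.mm_congr hr
    intro z hz
    apply Dom.comp_ev hr hz (G := fun z => exp (P z))
    rw [hE]; exact rep_mk _ _
  simp only [h4] at h3
  refine h3.trans ?_
  rw [mul_assoc]
  apply mul_le_mul_of_nonneg_left _ hA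
  have e1 : 0 < 1 - r := by linarith
  have l1 : 0 ≤ Real.log (2 / (1 - r)) := Real.log_nonneg (by rw [le_div_iff₀ e1]; linarith)
  have e2 : Real.log (2 / (1 - (1 + r)/2)) = Real.log 2 + Real.log (2 / (1 - r)) := by
    rw [← Real.log_mul (by norm_num) (by positivity)]; congr 1
    have : 1 - (1 + r)/2 = (1 - r)/2 := by ring
    rw [this]; field_simp
  have e3 : Real.posLog (1 / ((1 + r)/2 - r)) = Real.log (2 / (1 - r)) := by
    have : 1 / ((1 + r)/2 - r) = 2 / (1 - r) := by
      have : (1 + r)/2 - r = (1 - r)/2 := by ring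
      rw [this]; field_simp
    rw [this, Real.posLog_eq_log]
    rw [abs_of_nonneg (by positivity), le_div_iff₀ e1]; linarith
  have := Real.log_two_lt_d9
  show HP.base ((1 + r)/2) + |(0 : ℝ → ℝ) ((1+r)/2)| + Real.posLog (1 / ((1 + r)/2 - r)) ≤ _
  rw [e3]
  show Real.log (2 / (1 - (1 + r)/2)) + 1 + _ + _ ≤ _
  rw [e2]; simp; linarith

lemma exp_lin {E : Mer} (hE : E ≠ 0) (hv : ∀ z, v z E = 0) (h1 : E ∈ HP.cls 0) (h2 : til E ∈ HP.cls 0) :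
    ∃ c, D E = C c * E ∧ E ∈ PL.cls 0 := by
  obtain ⟨P, hP, hEP⟩ := exp_rep hE hv
  obtain ⟨A, hA, H1⟩ := HP_mF (hP := hP) hEP h1
  have hPt : Differentiable ℂ (mtilde P) := fun z => (analyticAt_mtilde (hP.analyticAt _)).differentiableAt
  have htE : til E = mk _ (exp_mero hPt) := by
    rw [hEP, til_mk]
    refine mk_eq.2 fun z => Eventually.of_forall fun w => ?_
    simp [mtilde, ← Complex.exp_conj]
  obtain ⟨B, hB, H2⟩ := HP_mF (hP := hPt) htE h2
  have b1 := halfplane_bd hP hA H1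
  have b2 := halfplane_bd hPt hB H2
  obtain ⟨c0, c1, hc⟩ := lin_of_bd hP (B := 16 * A + 16 * B) (by positivity) (by
    intro z hz
    have e : 0 ≤ (√((‖z‖ ^ 2 + 1) / |z.im|)) ^ 3 := by positivity
    rcases lt_or_gt_of_ne hz with h | h
    · have := b2 (starRingEnd ℂ z) (by simpa using h)
      simp only [mtilde, Complex.conj_conj, Complex.conj_re, Complex.norm_conj, Complex.conj_im] at this
      rw [abs_of_neg h] at e ⊢
      refine this.trans ?_
      apply mul_le_mul_of_nonneg_right _ e; linarith
    · have := b1 z h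
      rw [abs_of_pos h] at e ⊢
      refine this.trans ?_
      apply mul_le_mul_of_nonneg_right _ e; linarith)
  refine ⟨c1, ?_, ?_⟩
  · rw [hEP, D_exp hP (fun z => MeromorphicAt.const c1 z), C_def]
    intro z
    have : P = fun z => c0 + c1 * z := funext hc
    rw [this]
    simpa using ((hasDerivAt_id z).const_mul c1).const_add c0
  · refine Dom.InG.mk ?_ ?_
    · refine ⟨‖c0‖ + ‖c1‖, by positivity, fun r hr ρ hρ hh => ?_⟩
      have hr0 := Dom.r0 hr
      have : PL.mm r E = mF r (fun z => exp (P z)) := by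
        apply Dom.mm_congr hr; intro z hz
        apply Dom.comp_ev hr hz (G := fun z => exp (P z))
        rw [hEP]; exact rep_mk _ _
      show PL.mm r E ≤ _
      rw [this]
      have : mF r (fun z => exp (P z)) ≤ ‖c0‖ + ‖c1‖ * r := by
        apply mF_le_of_le hr0 (fun z _ => exp_mero hP z)
        intro z hz
        rw [Real.posLog_apply]
        apply max_le (by positivity)
        rw [Complex.norm_exp, Real.log_exp, hc]
        refine (Complex.re_le_norm _).trans ((norm_add_le _ _).trans ?_)
        rw [norm_mul, hz]
      refine this.trans ?_
      have g : r + 1 ≤ PL.ga 0 r ρ := by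
        have := Real.posLog_nonneg (x := 1 / (ρ - r))
        show r + 1 ≤ (ρ + 1) + |(0:ℝ→ℝ) ρ| + Real.posLog (1 / (ρ - r))
        have : |(0:ℝ→ℝ) ρ| = 0 := by simp
        linarith
      have := norm_nonneg c0; have := norm_nonneg c1
      nlinarith
    · refine (Dom.Bd.const 0 0).mono fun r hr => ?_
      apply Dom.nn_le hr; intro S _
      simp [Dom.pm, hv]

/-- Lemma R -/
lemma lemR {h : Mer} (hh : h ≠ 0) (hf : {z | v z h ≠ 0}.Finite) (h1 : h ∈ HP.cls 0) (h2 : til h ∈ HP.cls 0) :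
    D h / h ∈ RatF ∧ h ∈ PL.cls 0 := by
  obtain ⟨R, hR, hR0, hRv⟩ := exists_rat hf.toFinset (fun z => v z h)
  have hE : h / R ≠ 0 := div_ne_zero hh hR0
  obtain ⟨c, hc, hcl⟩ := exp_lin hE (fun z => by
    rw [v_div z hh hR0, hRv]
    by_cases hz : v z h = 0 <;> simp [hz]) ((HP.cls 0).div_mem h1 (RatF_cls HP 0 hR)) (by
    rw [til_div]; exact (HP.cls 0).div_mem h2 (RatF_cls HP 0 (RatF_til hR)))
  have e : h = R * (h / R) := by field_simp
  constructor
  · have : D h / h = D R / R + C c := by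
      have : D h = D R * (h/R) + R * (C c * (h / R)) := by
        conv_lhs => rw [e, D_mul, hc]
      rw [this]; field_simp
    rw [this]
    exact RatF.add_mem (RatF.div_mem (RatF_D hR) hR) (RatF_c _)
  · rw [e]; exact (PL.cls 0).mul_mem (RatF_cls PL 0 hR) hcl

end Mer
end


open Complex Filter Topology MeasureTheory
open scoped Classical

noncomputable section

lemma circleAverage_conj (q : ℂ → ℝ) (r : ℝ) :
    Real.circleAverage (fun z => q (starRingEnd ℂ z)) 0 r = Real.circleAverage q 0 r := by
  unfold Real.circleAverage
  congr 1
  have h : ∀ θ : ℝ, starRingEnd ℂ (circleMap 0 r θ) = circleMap 0 r (2 * Real.pi - θ) := by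
    intro θ
    simp only [circleMap, zero_add, map_mul, Complex.conj_ofReal, ← Complex.exp_conj, Complex.conj_I]
    congr 1
    push_cast
    rw [sub_mul, Complex.exp_sub, Complex.exp_two_pi_mul_I, mul_neg, Complex.exp_neg, one_div]
  simp only [h]
  rw [intervalIntegral.integral_comp_sub_left (fun θ => q (circleMap 0 r θ))]
  simp

namespace Mer

lemma PL_tt_til {r : ℝ} (hr : r ∈ PL.rad) (h : Mer) : PL.tt r (til h) ≤ PL.tt r h := by
  apply add_le_add
  · apply le_of_eq
    have e : PL.mm r (til h) = mF r (mtilde h.rep) := by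
      apply Dom.mm_congr hr; intro z hz
      apply Dom.comp_ev hr hz (G := mtilde h.rep)
      intro w
      conv_lhs => rw [← mk_rep h, til_mk]
      exact rep_mk _ _ w
    rw [e]
    unfold Dom.mm mF
    rw [← circleAverage_conj]
    congr 1; funext z
    simp [mtilde, PL]
  · apply Dom.nn_le hr
    intro S hS
    have h1 := Dom.sum_le_nn hr h (S.image (starRingEnd ℂ)) (by
      intro z hz
      obtain ⟨w, hw, rfl⟩ := Finset.mem_image.1 hz
      rw [Complex.norm_conj]; exact hS w hw)
    rw [Finset.sum_image (fun x _ y _ hxy => (starRingEnd ℂ).injective hxy)] at h1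
    refine le_trans (le_of_eq ?_) h1
    apply Finset.sum_congr rfl
    intro z _
    congr 1
    · unfold Dom.pm
      show ((max (-(v z (til h))) 0 : ℤ) : ℝ) = ((max (-(v (starRingEnd ℂ z) h)) 0 : ℤ) : ℝ)
      rw [v_til]
    · unfold Wt; simp

lemma PL_til {h : Mer} (hh : h ∈ PL.cls 0) : til h ∈ PL.cls 0 :=
  Dom.Bd.mono hh fun _ hr => PL_tt_til hr h

lemma F_til (φ n) : F (til φ) n = til (F φ n) := by
  induction n with
  | zero => rfl
  | succ n ih => rw [F_succ, F_succ, til_D, ih]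
lemma L_til (φ n) : L (til φ) n = til (L φ n) := by rw [L, L, F_til, F_til, til_div]
lemma tq_til (φ n) : tq (til φ) n = til (tq φ n) := by rw [tq, tq, L_til, L_til, til_div]

/-- the setup -/
structure Su (φ : Mer) (N : ℕ) : Prop where
  hN : 7 ≤ N
  strict : ¬ ∃ c, φ = C c * til φ
  ne : ∀ m ≤ N, F φ m ≠ 0
  fin : ∀ m ≤ N, {z | 0 < v z (F φ m) ∧ z.im ≠ 0}.Finite

variable {φ : Mer} {N : ℕ}

lemma v_real {z : ℂ} (hz : z.im = 0) (h : Mer) : v z (til h) = v z h := by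
  rw [v_til, Complex.conj_eq_iff_im.2 hz]

namespace Su

lemma net (s : Su φ N) {m} (hm : m ≤ N) : F (til φ) m ≠ 0 := by
  rw [F_til]; exact til_ne_zero (s.ne m hm)

lemma fint (s : Su φ N) {m} (hm : m ≤ N) : {z | 0 < v z (F (til φ) m) ∧ z.im ≠ 0}.Finite := by
  apply ((s.fin m hm).image (starRingEnd ℂ)).subset
  rintro z ⟨h1, h2⟩
  rw [F_til, v_til] at h1
  exact ⟨starRingEnd ℂ z, ⟨h1, by simpa using h2⟩, by simp⟩

lemma lne (s : Su φ N) {m} (hm : m + 1 ≤ N) : L φ m ≠ 0 := L_ne (s.ne m (by omega)) (s.ne _ hm)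
lemma lnet (s : Su φ N) {m} (hm : m + 1 ≤ N) : L (til φ) m ≠ 0 := L_ne (s.net (by omega)) (s.net hm)
lemma tne (s : Su φ N) {m} (hm : m + 2 ≤ N) : tq φ m ≠ 0 := tq_ne (s.ne m (by omega)) (s.ne _ (by omega)) (s.ne _ hm)
lemma tnet (s : Su φ N) {m} (hm : m + 2 ≤ N) : tq (til φ) m ≠ 0 := tq_ne (s.net (m := m) (by omega)) (s.net (by omega)) (s.net hm)

lemma LH (s : Su φ N) {m} (hm : m + 1 ≤ N) : L φ m ∈ HP.cls 0 := by
  have := s.hN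
  induction m with
  | zero =>
    apply Dom.Aplus
    · intro i hi; exact s.ne _ (by omega)
    · intro i hi; apply HP_few
      exact s.fin _ (by omega)
  | succ m ih => exact Dom.cls_L (s.ne _ (by omega)) (s.ne _ (by omega)) (ih (by omega))

lemma LHt (s : Su φ N) {m} (hm : m + 1 ≤ N) : L (til φ) m ∈ HP.cls 0 := by
  have := s.hN
  induction m with
  | zero =>
    apply Dom.Aplus
    · intro i hi; exact s.net (by omega)
    · intro i hi; apply HP_few
      exact s.fint (by omega)
  | succ m ih => exact Dom.cls_L (s.net (by omega)) (s.net (by omega)) (ih (by omega))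

end Su

def K (φ : Mer) (m : ℕ) : Mer := tq φ m / tq (til φ) m

lemma K_til (φ m) : til (K φ m) = (K φ m)⁻¹ := by
  rw [K, til_div, tq_til, til_til, inv_div]

namespace Su

lemma Kne (s : Su φ N) {m} (hm : m + 2 ≤ N) : K φ m ≠ 0 := div_ne_zero (s.tne hm) (s.tnet hm)

lemma KH (s : Su φ N) {m} (hm : m + 2 ≤ N) : K φ m ∈ HP.cls 0 :=
  (HP.cls 0).div_mem ((HP.cls 0).div_mem (s.LH (by omega)) (s.LH (by omega)))
    ((HP.cls 0).div_mem (s.LHt (by omega)) (s.LHt (by omega)))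

lemma v_F_real {z : ℂ} (hz : z.im = 0) (m) : v z (F (til φ) m) = v z (F φ m) := by
  rw [F_til, v_real hz]

lemma K_fin (s : Su φ N) {m} (hm : m + 2 ≤ N) : {z | v z (K φ m) ≠ 0}.Finite := by
  apply (((((s.fin m (by omega)).union (s.fin (m+1) (by omega))).union (s.fin (m+2) hm)).union
    (s.fint (m := m) (by omega))).union (s.fint (m := m+1) (by omega))).union (s.fint hm) |>.subset
  intro z hz
  by_contra hc
  apply hz
  rw [K, v_div _ (s.tne hm) (s.tnet hm)]
  by_cases hi : z.im = 0
  · rw [tq_til, v_real hi]; ring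
  · simp only [Set.mem_union, Set.mem_ofPred_eq, not_or, hi, not_lt, ne_eq, not_false_eq_true, and_true] at hc
    rw [v_tq0 (s.ne _ (by omega)) (s.ne _ (by omega)) (s.ne _ hm) hc.1.1.1.1.1 hc.1.1.1.1.2 hc.1.1.1.2,
      v_tq0 (s.net (by omega)) (s.net (by omega)) (s.net hm) hc.1.1.2 hc.1.2 hc.2]; rfl

lemma K_R (s : Su φ N) {m} (hm : m + 2 ≤ N) : D (K φ m) / K φ m ∈ RatF ∧ K φ m ∈ PL.cls 0 :=
  lemR (s.Kne hm) (s.K_fin hm) (s.KH hm) (by rw [K_til]; exact (HP.cls 0).inv_mem (s.KH hm))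

lemma up (s : Su φ N) {j m} (hj : L φ j ∈ PL.cls 0) (hjm : j ≤ m) (hm : m + 1 ≤ N) : L φ m ∈ PL.cls 0 := by
  induction m, hjm using Nat.le_induction with
  | base => exact hj
  | succ m hjm ih => exact Dom.cls_L (s.ne _ (by omega)) (s.ne _ (by omega)) (ih (by omega))

end Su

/-- polynomials -/
lemma poly_prim (q : Polynomial ℂ) : ∃ Q : Polynomial ℂ, Polynomial.derivative Q = q := by
  induction q using Polynomial.induction_on' with
  | add p q hp hq =>
    obtain ⟨P, rfl⟩ := hp; obtain ⟨Q, rfl⟩ := hq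
    exact ⟨P + Q, by simp⟩
  | monomial n a =>
    refine ⟨Polynomial.monomial (n+1) (a / (n+1)), ?_⟩
    rw [Polynomial.derivative_monomial]
    have : (n:ℂ) + 1 ≠ 0 := by exact_mod_cast Nat.succ_ne_zero n
    simp; field_simp

def evZ (q : Polynomial ℂ) : Mer := q.eval₂ C Z

lemma evZ_rat (q) : evZ q ∈ RatF := by
  unfold evZ
  rw [Polynomial.eval₂_eq_sum_range]
  exact RatF.sum_mem fun i _ => RatF.mul_mem (RatF_c _) (RatF.pow_mem RatF_z _)

lemma D_pow (h : Mer) (n : ℕ) : D (h ^ (n+1)) = (n + 1) * h ^ n * D h := by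
  induction n with
  | zero => simp
  | succ n ih => rw [pow_succ, D_mul, ih]; push_cast; ring

lemma evZ_D (q) : D (evZ q) = evZ (Polynomial.derivative q) := by
  unfold evZ
  induction q using Polynomial.induction_on' with
  | add p q hp hq => simp [Polynomial.eval₂_add, D_add, hp, hq]
  | monomial n a =>
    rw [Polynomial.derivative_monomial, Polynomial.eval₂_monomial, Polynomial.eval₂_monomial, D_C_mul]
    cases n with
    | zero => simp
    | succ n => rw [D_pow, D_Z]; simp; ring

lemma poly_of_D (n : ℕ) (h : Mer) (hh : F h n = 0) : ∃ q, h = evZ q := by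
  induction n generalizing h with
  | zero => exact ⟨0, by rw [F_zero] at hh; simp [evZ, hh]⟩
  | succ n ih =>
    have : F (D h) n = 0 := by rw [← hh]; rfl
    obtain ⟨q, hq⟩ := ih _ this
    obtain ⟨Q, rfl⟩ := poly_prim q
    rw [← evZ_D] at hq
    obtain ⟨c, hc⟩ := const_of_D (h := h - evZ Q) (by rw [D_sub, hq, sub_self])
    refine ⟨Q + Polynomial.C c, ?_⟩
    have : evZ (Q + Polynomial.C c) = evZ Q + C c := by simp [evZ]
    rw [this, ← hc]; ring

lemma evZ_og (q) (z : ℂ) : og z 0 (evZ q) := by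
  unfold evZ
  have hZ : og z 0 Z := by
    have : Z = (Z - C z) + C z := by ring
    rw [this]
    have h1 : og z 1 (Z - C z) := Or.inr (by rw [(v_Z_sub1 z).1])
    exact og_add (og_mono h1 (by norm_num)) (og_C z z)
  induction q using Polynomial.induction_on' with
  | add p q hp hq => rw [Polynomial.eval₂_add]; exact og_add hp hq
  | monomial n a => rw [Polynomial.eval₂_monomial]; exact og_mul0 (og_C z a) (og_pow0 hZ n)

lemma F_sub (a b n) : F (a - b) n = F a n - F b n := by
  induction n with
  | zero => rfl
  | succ n ih => rw [F_succ, F_succ, F_succ, ih, D_sub]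

lemma F_Cmul (c a n) : F (C c * a) n = C c * F a n := by
  induction n with
  | zero => rfl
  | succ n ih => rw [F_succ, F_succ, ih, D_C_mul]

lemma Su.caseA (s : Su φ N) {m} (hm : m + 1 ≤ N) (h : L φ m = L (til φ) m) : L φ 0 ∈ PL.cls 0 := by
  obtain ⟨c, hc⟩ := const_ratio (s.net (m := m) (by omega)) (h := F φ m) (Y := L φ m)
    (by rw [L_def]; field_simp [s.ne m (by omega)]) (by rw [h, L_def]; field_simp [s.net (m := m) (by omega)])
  have hc0 : c ≠ 0 := by rintro rfl; simp at hc; exact s.ne m (by omega) hc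
  have hC0 : C c ≠ 0 := fun h => hc0 (C_inj (h.trans C.map_zero.symm))
  obtain ⟨q, hq⟩ := poly_of_D m (φ - C c * til φ) (by rw [F_sub, F_Cmul, ← hc, sub_self])
  set p := evZ q with hp
  have hp0 : p ≠ 0 := by
    intro h0; rw [h0, sub_eq_zero] at hq; exact s.strict ⟨c, hq⟩
  have hpR : p ∈ RatF := evZ_rat q
  have hφ : φ ≠ 0 := s.ne 0 (by omega)
  have hψ : til φ ≠ 0 := til_ne_zero hφ
  have hqR : D p / p ∈ RatF := RatF.div_mem (RatF_D hpR) hpR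
  set Q := D p / p with hQ
  have hDp : D p = D φ - C c * D (til φ) := by rw [← hq, D_sub, D_C_mul]
  have L0 : L φ 0 = D φ / φ := by rw [L_def, F_zero]
  have l0 : L (til φ) 0 = D (til φ) / til φ := by rw [L_def, F_zero]
  by_cases hL : L φ 0 = Q
  · rw [hL]; exact RatF_cls PL 0 hqR
  set E := φ / (C c * til φ) with hE
  have hcψ : C c * til φ ≠ 0 := mul_ne_zero hC0 hψ
  have hE0 : E ≠ 0 := div_ne_zero hφ hcψ
  have hE1 : 1 - E ≠ 0 := by
    intro h0; apply hp0; rw [← hq]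
    have : E = 1 := by rw [sub_eq_zero] at h0; exact h0.symm
    rw [hE, div_eq_one_iff_eq hcψ] at this
    rw [sub_eq_zero]; exact this
  have e1 : E * (L φ 0 - Q) = L (til φ) 0 - Q := by
    rw [hE, hQ, hDp, L0, l0, ← hq]
    have : φ - C c * til φ ≠ 0 := by rw [hq]; exact hp0
    field_simp; ring
  have e2 : D E / E = L φ 0 - L (til φ) 0 := by
    rw [hE, D_div _ hcψ, D_C_mul, L0, l0]; field_simp
  have hLQ : L φ 0 - Q ≠ 0 := sub_ne_zero.2 hL
  have eE : E = (L (til φ) 0 - Q) / (L φ 0 - Q) := by rw [eq_div_iff hLQ]; exact e1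
  have hn := s.hN
  have r1 : E ∈ HP.cls 0 := by
    rw [eE]; exact (HP.cls 0).div_mem ((HP.cls 0).sub_mem (s.LHt (by omega)) (RatF_cls _ _ hqR))
      ((HP.cls 0).sub_mem (s.LH (by omega)) (RatF_cls _ _ hqR))
  have r2 : til E ∈ HP.cls 0 := by
    rw [eE, til_div, til_sub, til_sub, ← L_til, til_til, ← L_til]
    exact (HP.cls 0).div_mem ((HP.cls 0).sub_mem (s.LH (by omega)) (RatF_cls _ _ (RatF_til hqR)))
      ((HP.cls 0).sub_mem (s.LHt (by omega)) (RatF_cls _ _ (RatF_til hqR)))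
  obtain ⟨r3, r4⟩ := lemR hE0 (by
    apply ((s.fin 0 (by omega)).union (s.fint (m := 0) (by omega))).subset
    intro z hz
    by_contra hc'
    apply hz
    have vc : v z (C c * til φ) = v z (til φ) := by rw [v_mul _ hC0 hψ, v_C, zero_add]
    rw [hE, v_div _ hφ hcψ, vc]
    by_cases hi : z.im = 0
    · rw [v_real hi]; ring
    · simp only [Set.mem_union, Set.mem_ofPred_eq, not_or, hi, not_lt, ne_eq, not_false_eq_true, and_true, F_zero] at hc'
      have ep : φ = C c * til φ + p := by rw [← hq]; ring
      have ep' : C c * til φ = φ + (-p) := by rw [← hq]; ring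
      rcases eq_or_lt_of_le hc'.1 with h1 | h1
      · rcases eq_or_lt_of_le hc'.2 with h2 | h2
        · rw [h1, h2]; rfl
        · have := (v_add_of_lt hcψ (by rw [vc]; exact h2) (evZ_og q z)).2
          rw [← hp, ← ep, vc] at this; rw [this]; ring
      · have := (v_add_of_lt hφ h1 (og_neg (evZ_og q z))).2
        rw [← hp, ← ep', vc] at this; rw [this]; ring) r1 r2
  have : L φ 0 = Q + (D E / E) / (1 - E) := by
    have h3 : L φ 0 - Q = (D E / E) / (1 - E) := by
      rw [eq_div_iff hE1, e2]
      linear_combination -e1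
    linear_combination h3
  rw [this]
  exact (PL.cls 0).add_mem (RatF_cls _ _ hqR) ((PL.cls 0).div_mem (RatF_cls _ _ r3) ((PL.cls 0).sub_mem (PL.cls 0).one_mem r4))

lemma Su.lemB (s : Su φ N) {j} (hj : j + 1 ≤ N) (h : L φ j ∈ PL.cls 0) : L φ 0 ∈ PL.cls 0 := by
  induction j with
  | zero => exact h
  | succ j ih =>
    by_cases hA : L φ j = L (til φ) j
    · exact s.caseA (by omega) hA
    apply ih (by omega)
    have ht : L (til φ) (j+1) ∈ PL.cls 0 := by rw [L_til]; exact PL_til h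
    have n1 := s.lne (m := j) (by omega)
    have n2 := s.lnet (m := j) (by omega)
    have n3 := s.lne (m := j+1) (by omega)
    have n4 := s.lnet (m := j+1) (by omega)
    have hR : L φ j / L (til φ) j ∈ PL.cls 0 := by
      have : L φ j / L (til φ) j = (L φ (j+1) / L (til φ) (j+1)) / K φ j := by
        unfold K tq; field_simp
      rw [this]
      exact (PL.cls 0).div_mem ((PL.cls 0).div_mem h ht) (s.K_R (by omega)).2
    set R := L φ j / L (til φ) j with hRd
    have hR0 : R ≠ 0 := div_ne_zero n1 n2
    have hR1 : 1 - R⁻¹ ≠ 0 := by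
      intro h0
      have : R = 1 := by rw [sub_eq_zero] at h0; exact inv_eq_one.1 h0.symm
      rw [hRd, div_eq_one_iff_eq n2] at this; exact hA this
    have e1 : L φ j - L (til φ) j = L φ (j+1) - L (til φ) (j+1) - D R / R := by
      rw [L_succ (s.ne j (by omega)) (s.ne _ (by omega)), L_succ (s.net (m := j) (by omega)) (s.net (by omega)), hRd, D_div _ n2]
      field_simp; ring
    have e2 : L φ j = (L φ (j+1) - L (til φ) (j+1) - D R / R) / (1 - R⁻¹) := by
      rw [eq_div_iff hR1, ← e1, hRd]; field_simp
    rw [e2]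
    exact (PL.cls 0).div_mem ((PL.cls 0).sub_mem ((PL.cls 0).sub_mem h ht) ((PL.cls 0).div_mem (Dom.cls_D hR) hR))
      ((PL.cls 0).sub_mem (PL.cls 0).one_mem ((PL.cls 0).inv_mem hR))

/-- consequence of `K_m` being constant -/
lemma Su.Kconst (s : Su φ N) {m} (hm : m + 2 ≤ N) {c} (h : K φ m = C c) :
    ∃ a d, (L φ m)⁻¹ = C c * (L (til φ) m)⁻¹ + a ∧ a = C (1 - c) * Z + C d ∧ D a = C (1 - c) := by
  have h1 : tq φ m = C c * tq (til φ) m := by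
    rw [← h, K]; field_simp [s.tnet hm]
  rw [tq_eq (s.ne _ (by omega)) (s.ne _ (by omega)), tq_eq (s.net (by omega)) (s.net (by omega))] at h1
  obtain ⟨d, hd⟩ := const_of_D (h := (L φ m)⁻¹ - C c * (L (til φ) m)⁻¹ - C (1 - c) * Z) (by
    rw [D_sub, D_sub, D_C_mul, D_C_mul, D_Z, C.map_sub, C.map_one]
    linear_combination -h1)
  refine ⟨_, d, ?_, rfl, ?_⟩
  · rw [← hd]; ring
  · rw [D_add, D_C_mul, D_Z, D_C]; ring

lemma Su.two (s : Su φ N) {m} (hm : m + 3 ≤ N) {c c'} (h : K φ m = C c) (h' : K φ (m+1) = C c') : L φ 0 ∈ PL.cls 0 := by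
  obtain ⟨a, d, ha, ha1, ha2⟩ := s.Kconst (by omega) h
  obtain ⟨e, d', he, he1, he2⟩ := s.Kconst (by omega) h'
  have n1 := s.lne (m := m) (by omega)
  have n2 := s.lnet (m := m) (by omega)
  have n3 := s.lne (m := m+1) (by omega)
  have n4 := s.lnet (m := m+1) (by omega)
  have t0 := s.tne (m := m) (by omega)
  have t0' := s.tnet (m := m) (by omega)
  by_cases e0 : e = 0
  · have : c' = 1 := by
      rw [e0, D_zero] at he2
      have := C_inj (C.map_zero.trans he2); linear_combination this
    rw [e0, this] at he
    simp at he
    exact s.caseA (by omega) he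
  apply s.lemB (j := m) (by omega)
  have ht : tq φ m = 1 - D (L φ m)⁻¹ := tq_eq (s.ne _ (by omega)) (s.ne _ (by omega))
  have h1 : tq φ m = C c * tq (til φ) m := by
    rw [← h, K]; field_simp
  have u1 : (L φ (m+1))⁻¹ = (L φ m)⁻¹ / tq φ m := by unfold tq; field_simp
  have u2 : (L (til φ) (m+1))⁻¹ = (L (til φ) m)⁻¹ / tq (til φ) m := by unfold tq; field_simp
  set u := (L φ m)⁻¹ with hu
  set w := (L (til φ) m)⁻¹ with hw
  rw [u1, u2] at he
  have e1 : u - C c' * (u - a) = e * tq φ m := by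
    have e2 : u = C c' * (w / tq (til φ) m) * tq φ m + e * tq φ m := by
      rw [← add_mul, ← he]; field_simp
    have e3 : w / tq (til φ) m * tq φ m = u - a := by
      rw [h1, ha]; field_simp; ring
    rw [mul_assoc, e3] at e2
    linear_combination e2
  have e2 : D (e * u) = C ((1 - c') - c' * (1 - c)) * Z + C (d' - c' * d) := by
    rw [D_mul, he2]
    rw [ht] at e1
    rw [ha1] at e1
    simp only [C.map_sub, C.map_mul, C.map_one] at *
    linear_combination e1 + he1
  have e3 : e * u ∈ RatF := prim RatF_dsub e2
  have e4 : e ∈ RatF := by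
    rw [he1]; exact RatF.add_mem (RatF.mul_mem (RatF_c _) RatF_z) (RatF_c _)
  have e5 : L φ m = e / (e * u) := by rw [hu]; field_simp
  rw [e5]
  exact RatF_cls _ _ (RatF.div_mem e4 e3)

end Mer
end


open Complex Filter Topology MeasureTheory
open scoped Classical

noncomputable section

namespace Mer

variable {φ : Mer} {N : ℕ}

lemma logD_div {h k : Mer} (hh : h ≠ 0) (hk : k ≠ 0) : D (h / k) / (h / k) = D h / h - D k / k := by
  rw [D_div _ hk]; field_simp

lemma logD_mul {h k : Mer} (hh : h ≠ 0) (hk : k ≠ 0) : D (h * k) / (h * k) = D h / h + D k / k := by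
  rw [D_mul]; field_simp

lemma og_logD_sub {h k : Mer} {z : ℂ} (hh : h ≠ 0) (hk : k ≠ 0) (e : v z h = v z k) :
    og z 0 (D h / h - D k / k) := by
  rw [← logD_div hh hk]
  exact og_logD0 (by rw [v_div _ hh hk, e, sub_self])

lemma v_logD {h : Mer} {z : ℂ} (hv : v z h ≠ 0) : D h / h ≠ 0 ∧ v z (D h / h) = -1 := by
  have h0 : h ≠ 0 := by rintro rfl; exact hv (v_zero z)
  obtain ⟨h1, h2⟩ := v_D hv
  exact ⟨div_ne_zero h1 h0, by rw [v_div _ h1 h0, h2]; ring⟩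

lemma cpart {h : Mer} {x : ℂ} {n : ℕ} (hn : 1 ≤ n) (hv : v x h = n) :
    og x 1 (D (D h) / D h - ((n:Mer) + 1) / n * (D h / h) + 2 / (Z - C x)) := by
  have hn0 : (n : Mer) ≠ 0 := by exact_mod_cast (by omega : n ≠ 0)
  have h0 : h ≠ 0 := by rintro rfl; rw [v_zero] at hv; omega
  obtain ⟨z1, z2⟩ := v_Z_sub1 x
  set ζ := Z - C x with hζ
  have dζ : D ζ = 1 := by rw [hζ, D_sub, D_Z, D_C, sub_zero]
  set k := h / ζ ^ n with hk
  have zn : ζ ^ n ≠ 0 := pow_ne_zero _ z2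
  have k0 : k ≠ 0 := div_ne_zero h0 zn
  set A := D k / k with hA
  have oA : og x 0 A := og_logD0 (by rw [hk, v_div _ h0 zn, v_pow, z1, hv]; ring)
  have e0 : h = k * ζ ^ n := by rw [hk]; field_simp
  have e1 : D h / h = n / ζ + A := by
    rw [e0, logD_mul k0 zn, ← hA]
    obtain ⟨p, rfl⟩ : ∃ p, n = p + 1 := ⟨n - 1, by omega⟩
    rw [D_pow, dζ, pow_succ]; push_cast; field_simp; ring
  have oz : og x 1 ζ := Or.inr (by rw [z1])
  have ozA : og x 1 (ζ * A) := by simpa using og_mul oz oA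
  obtain ⟨q0, q1⟩ := v_add_of_lt (n := 1) hn0 (by rw [← map_natCast C n, v_C]; norm_num) ozA
  rw [← map_natCast C n, v_C, map_natCast] at q1
  have l0 : D h / h ≠ 0 := by
    rw [e1]; intro h3; apply q0
    field_simp at h3; simpa using h3
  have d0 : D h ≠ 0 := fun h3 => l0 (by rw [h3, zero_div])
  have e2 : D (D h) / D h = D h / h + D (D h / h) / (D h / h) := by
    rw [D_div _ h0]; field_simp; ring
  have e3 : D (D h / h) = - n / ζ ^ 2 + D A := by
    rw [e1, D_add, D_div _ z2, dζ, D_nat]; ring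
  have e4 : D (D h) / D h - ((n:Mer) + 1) / n * (D h / h) + 2 / ζ
      = ζ * ((n * D A - A ^ 2) * ((n:Mer)⁻¹ * ((n:Mer) + ζ * A)⁻¹)) := by
    rw [e2, e3, e1]
    have : (n : Mer) / ζ + A ≠ 0 := by rw [← e1]; exact l0
    have e5 : (n : Mer) / ζ + A = (n + ζ * A) / ζ := by field_simp
    rw [e5]
    field_simp; ring
  rw [e4]
  have : og x (1 + 0) (ζ * ((n * D A - A ^ 2) * ((n:Mer)⁻¹ * ((n:Mer) + ζ * A)⁻¹))) := by
    apply og_mul oz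
    apply og_mul0
    · exact og_sub (og_mul0 (og_nat x n) (og_D0 oA)) (og_pow0 oA 2)
    · exact og_mul0 (og_inv0 (by rw [← map_natCast C n, v_C])) (og_inv0 q1)
  simpa using this

/-- difference of logarithmic derivatives -/
def Dd (φ : Mer) (m : ℕ) : Mer := L φ m - L (til φ) m

lemma Su.kk (s : Su φ N) {m} (hm : m + 2 ≤ N) : D (K φ m) / K φ m = Dd φ (m+2) - 2 * Dd φ (m+1) + Dd φ m := by
  have n1 := s.lne (m := m) (by omega)
  have n2 := s.lnet (m := m) (by omega)
  have n3 := s.lne (m := m+1) (by omega)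
  have n4 := s.lnet (m := m+1) (by omega)
  unfold K Dd
  rw [logD_div (s.tne hm) (s.tnet hm), tq, tq, logD_div n3 n1, logD_div n4 n2,
    L_succ (n := m+1) (s.ne _ (by omega)) (s.ne _ (by omega)), L_succ (n := m+1) (s.net (by omega)) (s.net (by omega)),
    L_succ (n := m) (s.ne _ (by omega)) (s.ne _ (by omega)), L_succ (n := m) (s.net (by omega)) (s.net (by omega))]
  ring

lemma Su.Dd_og (s : Su φ N) {m} (hm : m ≤ N) {x : ℂ} (hx : x.im = 0) : og x 0 (Dd φ m) := by
  unfold Dd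
  rw [L_def, L_def]
  exact og_logD_sub (s.ne m hm) (s.net hm) (Su.v_F_real hx m).symm

lemma Su.Kone (s : Su φ N) {m} (hm : m + 2 ≤ N) {x : ℂ} (hx : x.im = 0) (h0 : v x (F φ m) ≠ 0)
    (h1 : v x (F φ (m+1)) ≠ 0) : og x 1 (K φ m - 1) := by
  have n1 := s.lne (m := m) (by omega)
  have n2 := s.lnet (m := m) (by omega)
  have n3 := s.lne (m := m+1) (by omega)
  have n4 := s.lnet (m := m+1) (by omega)
  have e : K φ m - 1 = Dd φ (m+1) * (L (til φ) m * (L φ m)⁻¹ * (L (til φ) (m+1))⁻¹) - Dd φ m * (L φ m)⁻¹ := by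
    unfold K Dd tq; field_simp; ring
  have v1 : v x (L φ m) = -1 := by rw [L_def]; exact (v_logD h0).2
  have v2 : v x (L (til φ) m) = -1 := by rw [L_def]; exact (v_logD (by rwa [Su.v_F_real hx])).2
  have v4 : v x (L (til φ) (m+1)) = -1 := by rw [L_def]; exact (v_logD (by rwa [Su.v_F_real hx])).2
  rw [e]
  apply og_sub
  · apply og_mul0 (s.Dd_og (by omega) hx)
    right
    rw [v_mul _ (mul_ne_zero n2 (inv_ne_zero n1)) (inv_ne_zero n4), v_mul _ n2 (inv_ne_zero n1), v_inv, v_inv, v1, v2, v4]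
    norm_num
  · apply og_mul0 (s.Dd_og (by omega) hx)
    right; rw [v_inv, v1]; norm_num

lemma Su.cp (s : Su φ N) {m} (hm : m + 1 ≤ N) {x : ℂ} (hx : x.im = 0) {n : ℕ} (hn : 1 ≤ n) (hv : v x (F φ m) = n) :
    og x 1 (Dd φ (m+1) - ((n:Mer) + 1) / n * Dd φ m) := by
  have := og_sub (cpart hn hv) (cpart (h := F (til φ) m) hn (by rw [Su.v_F_real hx, hv]))
  convert this using 1
  unfold Dd
  rw [L_def, L_def, L_def, L_def, F_succ, F_succ]
  ring

lemma og_nat_inv (z : ℂ) (n : ℕ) : og z 0 ((n:Mer)⁻¹) := og_inv0 (by rw [← map_natCast C n, v_C])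

lemma Su.F1 (s : Su φ N) {m} (hm : m + 3 ≤ N) (hk : D (K φ m) ≠ 0) : PL.few 0 {z | 0 < v z (F φ (m+1))} := by
  have hKc := (s.K_R (m := m) (by omega)).2
  have hKc' := (s.K_R (m := m+1) (by omega)).2
  have hkc : D (K φ m) / K φ m ∈ PL.cls 0 := RatF_cls _ _ (s.K_R (m := m) (by omega)).1
  have f1 := Dom.few_zeros ((PL.cls 0).sub_mem hKc (PL.cls 0).one_mem)
  have f2 := Dom.few_zeros ((PL.cls 0).sub_mem hKc' (PL.cls 0).one_mem)
  have f3 := Dom.few_zeros hkc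
  have f4 := Dom.few_finite (D := PL) (s.fin (m+1) (by omega)) 0
  refine (((f1.union f2).union f3).union f4).mono ?_
  intro x hx
  by_cases hi : x.im = 0
  swap
  · exact Or.inr ⟨hx, hi⟩
  left
  have k0 : D (K φ m) / K φ m ≠ 0 := div_ne_zero hk (s.Kne (by omega))
  have hk1 : K φ m - 1 ≠ 0 := by
    intro h0; apply hk; rw [sub_eq_zero.1 h0, D_one]
  have hx' : 0 < v x (F φ (m+1)) := hx
  by_cases h0 : v x (F φ m) = 0
  swap
  · exact Or.inl (Or.inl (og_v (s.Kone (by omega) hi h0 hx'.ne') hk1))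
  obtain ⟨n, hn⟩ := Int.eq_ofNat_of_zero_le hx'.le
  have hn1 : 1 ≤ n := by omega
  have n0 : (n : Mer) ≠ 0 := by exact_mod_cast (by omega : n ≠ 0)
  have d0 : og x 1 (Dd φ m) := by
    unfold Dd
    have a1 : og x 1 (L φ m) := Or.inr (by rw [L, v_div _ (s.ne _ (by omega)) (s.ne _ (by omega)), h0, hn]; omega)
    have a2 : og x 1 (L (til φ) m) := Or.inr (by
      rw [L, v_div _ (s.net (by omega)) (s.net (by omega)), Su.v_F_real hi, Su.v_F_real hi, h0, hn]; omega)
    exact og_sub a1 a2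
  have d1 := s.cp (m := m+1) (by omega) hi hn1 hn
  have kk := s.kk (m := m) (by omega)
  by_cases hn2 : n = 1
  · subst hn2
    right
    apply og_v _ k0
    rw [kk]
    have := og_add d1 d0
    convert this using 1
    push_cast; ring
  have hn2 : 2 ≤ n := by omega
  have v2 : v x (F φ (m+2)) = ((n - 1 : ℕ) : ℤ) := by
    rw [F_succ, (v_D hx'.ne').2, hn]; push_cast [hn1]; simp
  by_cases hK1 : K φ (m+1) - 1 = 0
  swap
  · left; right
    exact og_v (s.Kone (by omega) hi hx'.ne' (by rw [v2]; omega)) hK1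
  right
  apply og_v _ k0
  have kk' := s.kk (m := m+1) (by omega)
  rw [sub_eq_zero.1 hK1, D_one, zero_div] at kk'
  have d2 := s.cp (m := m+2) (by omega) hi (n := n - 1) (by omega) v2
  obtain ⟨p, rfl⟩ : ∃ p, n = p + 2 := ⟨n - 2, by omega⟩
  have ep : p + 2 - 1 = p + 1 := by omega
  rw [ep] at d2
  have p1 : (p : Mer) + 1 ≠ 0 := by exact_mod_cast (by omega : p + 1 ≠ 0)
  have p2 : (p : Mer) + 2 ≠ 0 := by exact_mod_cast (by omega : p + 2 ≠ 0)
  have cc : ∀ q : ℕ, og x 0 ((q : Mer)⁻¹) := og_nat_inv x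
  -- Dd (m+1) vanishes
  have d3 : og x 1 (Dd φ (m+1)) := by
    have e : Dd φ (m+1) = (((p+1:ℕ):Mer) * ((p+2:ℕ):Mer)) * ((2:ℕ):Mer)⁻¹ * (
        -(Dd φ (m+2+1) - (((p+1:ℕ):Mer) + 1) / ((p+1:ℕ):Mer) * Dd φ (m+2))
        + (p : Mer) * ((p+1:ℕ):Mer)⁻¹ * (Dd φ (m+1+1) - (((p+2:ℕ):Mer) + 1) / ((p+2:ℕ):Mer) * Dd φ (m+1))) := by
      have e1 : Dd φ (m+2+1) = 2 * Dd φ (m+2) - Dd φ (m+1) := by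
        have e0 : m + 2 + 1 = m + 1 + 2 := by omega
        rw [e0]; linear_combination -kk'
      have e2 : m + 1 + 1 = m + 2 := by omega
      rw [e1, e2]
      push_cast
      field_simp; ring
    rw [e]
    apply og_mul0 (og_mul0 (og_mul0 (og_nat _ _) (og_nat _ _)) (cc _))
    exact og_add (og_neg d2) (og_mul0 (og_mul0 (og_nat _ _) (cc _)) d1)
  rw [kk]
  have e : Dd φ (m+2) - 2 * Dd φ (m+1) + Dd φ m = (Dd φ (m+1+1) - (((p+2:ℕ):Mer) + 1) / ((p+2:ℕ):Mer) * Dd φ (m+1))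
      + ((((p+3:ℕ):Mer)) * ((p+2:ℕ):Mer)⁻¹ - ((2:ℕ):Mer)) * Dd φ (m+1) + Dd φ m := by
    push_cast; ring
  rw [e]
  exact og_add (og_add d1 (og_mul0 (og_sub (og_mul0 (og_nat _ _) (cc _)) (og_nat _ _)) d3)) d0

lemma Su.F2 (s : Su φ N) {m} (hm : m + 2 ≤ N) {c a d} (h1 : (L φ m)⁻¹ = C c * (L (til φ) m)⁻¹ + a)
    (h2 : a = C (1 - c) * Z + C d) (h0 : a ≠ 0) : PL.few 0 {z | 0 < v z (F φ m)} := by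
  have ha : a ∈ RatF := by rw [h2]; exact RatF.add_mem (RatF.mul_mem (RatF_c _) RatF_z) (RatF_c _)
  refine ((Dom.few_zeros (RatF_cls PL 0 ha)).union (Dom.few_finite (D := PL) (s.fin m (by omega)) 0)).mono ?_
  intro x hx
  have hx' : 0 < v x (F φ m) := hx
  by_cases hi : x.im = 0
  swap
  · exact Or.inr ⟨hx, hi⟩
  left
  apply og_v _ h0
  have e : a = (L φ m)⁻¹ - C c * (L (til φ) m)⁻¹ := by rw [h1]; ring
  have v1 : v x (L φ m) = -1 := by rw [L_def]; exact (v_logD hx'.ne').2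
  have v2 : v x (L (til φ) m) = -1 := by rw [L_def]; exact (v_logD (by rw [Su.v_F_real hi]; exact hx'.ne')).2
  rw [e]
  have b1 : og x 1 ((L φ m)⁻¹) := Or.inr (by rw [v_inv, v1]; norm_num)
  have b2 : og x 1 ((L (til φ) m)⁻¹) := Or.inr (by rw [v_inv, v2]; norm_num)
  exact og_sub b1 (og_mul0 (og_C _ _) b2)

end Mer
end


open Complex Filter Topology MeasureTheory
open scoped Classical

noncomputable section

namespace Dom
variable {D : Dom}

/-- weights with small counting function -/
def Cnt (D : Dom) (γ : ℝ → ℝ) (q : ℂ → ℝ) : Prop :=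
  ∃ C, 0 ≤ C ∧ ∀ r ∈ D.rad, ∀ ρ ∈ D.rad, r < ρ → ∀ S : Finset ℂ, (∀ z ∈ S, ‖z‖ ≤ r) →
    ∑ z ∈ S, q (D.ψ z) * Wt r z ≤ C * D.ga γ r ρ

lemma Cnt.add {γ p q} (h : D.Cnt γ p) (k : D.Cnt γ q) : D.Cnt γ (fun z => p z + q z) := by
  obtain ⟨C, hC, h⟩ := h; obtain ⟨E, hE, k⟩ := k
  refine ⟨C + E, by positivity, fun r hr ρ hρ hh S hS => ?_⟩
  have a := h r hr ρ hρ hh S hS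
  have b := k r hr ρ hρ hh S hS
  simp only [add_mul, Finset.sum_add_distrib]; linarith

lemma Cnt.cmul {γ q} {k : ℝ} (hk : 0 ≤ k) (h : D.Cnt γ q) : D.Cnt γ (fun z => k * q z) := by
  obtain ⟨C, hC, h⟩ := h
  refine ⟨k * C, by positivity, fun r hr ρ hρ hh S hS => ?_⟩
  have a := h r hr ρ hρ hh S hS
  simp only [mul_assoc, ← Finset.mul_sum]
  exact mul_le_mul_of_nonneg_left a hk

lemma Cnt.few {γ} {P : Set ℂ} (h : D.few γ P) : D.Cnt γ (fun z => if z ∈ P then 1 else 0) := by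
  obtain ⟨C, hC, h⟩ := h
  refine ⟨C, hC, fun r hr ρ hρ hh S hS => ?_⟩
  have a := h r hr ρ hρ hh (S.filter (fun z => D.ψ z ∈ P)) (fun z hz => by
    rw [Finset.mem_filter] at hz; exact ⟨hS z hz.1, hz.2⟩)
  rw [Finset.sum_filter] at a
  simpa using a

lemma Cnt.nn {γ s} (h : D.Bd γ (fun r => D.nn r s)) : D.Cnt γ (fun z => pm z s) := by
  obtain ⟨C, hC, h⟩ := h
  exact ⟨C, hC, fun r hr ρ hρ hh S hS => (sum_le_nn hr s S hS).trans (h r hr ρ hρ hh)⟩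

lemma Cnt.cls {γ s} (h : s ∈ D.cls γ) : D.Cnt γ (fun z => pm z s) := Cnt.nn (InG.nn h)

lemma Cnt.bd {γ q h} (H : D.Cnt γ q) (hq : ∀ z, pm z h ≤ q z) : D.Bd γ (fun r => D.nn r h) := by
  obtain ⟨C, hC, H⟩ := H
  refine ⟨C, hC, fun r hr ρ hρ hh => nn_le hr _ fun S hS => le_trans ?_ (H r hr ρ hρ hh S hS)⟩
  exact Finset.sum_le_sum fun z _ => mul_le_mul_of_nonneg_right (hq _) (Wt_nonneg r z)

end Dom

namespace Mer

variable {φ : Mer} {N : ℕ}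

/-- `k(z) = h(1/z)` -/
def Inv (h k : Mer) : Prop := ∀ w : ℂ, w ≠ 0 → (fun z => h.rep z⁻¹) =ᶠ[𝓝[≠] w] k.rep

lemma inv_tend {w : ℂ} (hw : w ≠ 0) : Tendsto (fun z : ℂ => z⁻¹) (𝓝[≠] w) (𝓝[≠] w⁻¹) := by
  apply tendsto_nhdsWithin_iff.2
  refine ⟨(continuousAt_inv₀ hw).tendsto.mono_left nhdsWithin_le_nhds, ?_⟩
  filter_upwards [self_mem_nhdsWithin] with z hz
  simpa using hz

namespace Inv
variable {h k h' k' : Mer}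

lemma add (a : Inv h k) (b : Inv h' k') : Inv (h + h') (k + k') := by
  intro w hw
  filter_upwards [a w hw, b w hw, Dom.rep_add k k' w, (inv_tend hw).eventually (Dom.rep_add h h' w⁻¹)] with z h1 h2 h3 h4
  rw [h4, h3, Pi.add_apply, Pi.add_apply, h1, h2]

lemma mul (a : Inv h k) (b : Inv h' k') : Inv (h * h') (k * k') := by
  intro w hw
  filter_upwards [a w hw, b w hw, Dom.rep_mul k k' w, (inv_tend hw).eventually (Dom.rep_mul h h' w⁻¹)] with z h1 h2 h3 h4
  rw [h4, h3, Pi.mul_apply, Pi.mul_apply, h1, h2]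

lemma neg (a : Inv h k) : Inv (-h) (-k) := by
  intro w hw
  filter_upwards [a w hw, Dom.rep_neg k w, (inv_tend hw).eventually (Dom.rep_neg h w⁻¹)] with z h1 h3 h4
  rw [h4, h3, Pi.neg_apply, Pi.neg_apply, h1]

lemma inv (a : Inv h k) : Inv (h⁻¹) (k⁻¹) := by
  intro w hw
  filter_upwards [a w hw, Dom.rep_inv k w, (inv_tend hw).eventually (Dom.rep_inv h w⁻¹)] with z h1 h3 h4
  rw [h4, h3, Pi.inv_apply, Pi.inv_apply, h1]

lemma sub (a : Inv h k) (b : Inv h' k') : Inv (h - h') (k - k') := by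
  rw [sub_eq_add_neg, sub_eq_add_neg]; exact a.add b.neg

lemma div (a : Inv h k) (b : Inv h' k') : Inv (h / h') (k / k') := by
  rw [div_eq_mul_inv, div_eq_mul_inv]; exact a.mul b.inv

lemma const (c : ℂ) : Inv (C c) (C c) := by
  intro w hw
  filter_upwards [Dom.rep_C c w, (inv_tend hw).eventually (Dom.rep_C c w⁻¹)] with z h3 h4
  rw [h4, h3]

lemma one : Inv 1 1 := by simpa using const 1
lemma nat (n : ℕ) : Inv (n : Mer) n := by simpa using const n
lemma pow (a : Inv h k) (n : ℕ) : Inv (h ^ n) (k ^ n) := by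
  induction n with
  | zero => simpa using one
  | succ n ih => rw [pow_succ, pow_succ]; exact ih.mul a

lemma z : Inv Z (Z⁻¹) := by
  intro w hw
  filter_upwards [Dom.rep_inv Z w, Dom.rep_Z w, (inv_tend hw).eventually (Dom.rep_Z w⁻¹)] with z h1 h3 h4
  rw [h4, h1, Pi.inv_apply, h3]

lemma der (a : Inv h k) : Inv (D h) (-(Z ^ 2 * D k)) := by
  intro w hw
  have e1 := (a w hw).nhdsNE_deriv
  have e2 : ∀ᶠ z in 𝓝[≠] w, AnalyticAt ℂ h.rep z⁻¹ := (inv_tend hw).eventually (h.rep_mero w⁻¹).eventually_analyticAt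
  have e3 : ∀ᶠ z in 𝓝[≠] w, z ≠ 0 := (eventually_ne_nhds hw).filter_mono nhdsWithin_le_nhds
  filter_upwards [e1, e2, e3, (inv_tend hw).eventually (Dom.rep_D h w⁻¹), Dom.rep_neg (Z^2 * D k) w, Dom.rep_mul (Z^2) (D k) w,
    Dom.rep_D k w, Dom.rep_mul Z Z w, Dom.rep_Z w] with z h1 h2 h3 h4 h5 h6 h7 h8 h9
  rw [sq] at h6
  rw [h4, h5, Pi.neg_apply, sq, h6, Pi.mul_apply, h8, Pi.mul_apply, h9, h7, ← h1]
  have := (h2.differentiableAt.hasDerivAt).scomp z (hasDerivAt_inv h3)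
  have e := this.deriv
  have e' : deriv (fun z => h.rep z⁻¹) z = -(z ^ 2)⁻¹ * deriv h.rep z⁻¹ := by simpa [Function.comp_def] using e
  rw [e']; field_simp

lemma zero_unique (a : Inv 0 k) : k = 0 := by
  have h1 := a 1 one_ne_zero
  have h2 : k.rep =ᶠ[𝓝[≠] 1] fun _ => 0 := by
    have h3 := (inv_tend one_ne_zero).eventually (Dom.rep_C 0 (1:ℂ)⁻¹)
    rw [C.map_zero] at h3
    filter_upwards [h1, h3] with z h4 h5
    rw [← h4, h5]
  apply ord_top_imp (z := 1)
  unfold ord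
  rw [meromorphicOrderAt_eq_top_iff]
  exact h2

lemma unique (a : Inv h k) (b : Inv h k') : k = k' := by
  have := a.sub b
  rw [sub_self] at this
  exact sub_eq_zero.1 this.zero_unique

lemma eqn (a : Inv h k) (b : Inv h' k') (e : h = h') : k = k' := by
  subst e; exact a.unique b

lemma ord {w : ℂ} (hw : w ≠ 0) (a : Inv h k) : Mer.ord w k = Mer.ord w⁻¹ h := by
  unfold Mer.ord
  rw [← meromorphicOrderAt_congr (a w hw)]
  have := meromorphicOrderAt_comp_of_deriv_ne_zero (f := h.rep) (g := fun z : ℂ => z⁻¹) (x := w) (analyticAt_id.inv hw)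
    (by simp [hw])
  exact this

lemma og {w : ℂ} (hw : w ≠ 0) (a : Inv h k) {n : ℤ} (H : og w⁻¹ n h) : Mer.og w n k := by
  rw [og_iff_ord] at *
  rwa [a.ord hw]

end Inv

lemma Inv_exists {h : Mer} (hh : h ∈ RatF) : ∃ k, Inv h k := by
  let S : Subfield Mer :=
    { carrier := {h | ∃ k, Inv h k}
      mul_mem' := by rintro a b ⟨k, hk⟩ ⟨l, hl⟩; exact ⟨_, hk.mul hl⟩
      one_mem' := ⟨1, Inv.one⟩
      add_mem' := by rintro a b ⟨k, hk⟩ ⟨l, hl⟩; exact ⟨_, hk.add hl⟩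
      zero_mem' := ⟨0, by simpa using Inv.const 0⟩
      neg_mem' := by rintro a ⟨k, hk⟩; exact ⟨_, hk.neg⟩
      inv_mem' := by rintro a ⟨k, hk⟩; exact ⟨_, hk.inv⟩ }
  exact RatF_le (S := S) (fun c => ⟨_, Inv.const c⟩) ⟨_, Inv.z⟩ hh

/-- near a pole all values are large -/
lemma large_near_pole {k : Mer} (hk : v 0 k < 0) (B : ℝ) :
    ∃ δ > 0, ∀ w : ℂ, w ≠ 0 → ‖w‖ < δ → ∀ c : ℂ, ‖c‖ ≤ B → ¬ og w 1 (k - C c) := by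
  have h0 : k ≠ 0 := by rintro rfl; rw [v_zero] at hk; exact lt_irrefl _ hk
  have ho : meromorphicOrderAt k.rep 0 < 0 := by
    have := coe_v 0 h0
    unfold ord at this
    rw [← this]; exact_mod_cast hk
  have ht := tendsto_cobounded_of_meromorphicOrderAt_neg ho
  have h1 : ∀ᶠ z in 𝓝[≠] (0:ℂ), B + 1 < ‖k.rep z‖ :=
    (tendsto_norm_cobounded_atTop.comp ht).eventually_gt_atTop (B + 1)
  rw [eventually_nhdsWithin_iff, Metric.eventually_nhds_iff] at h1
  obtain ⟨δ, hδ, h1⟩ := h1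
  refine ⟨δ, hδ, fun w hw hwδ c hc hog => ?_⟩
  have h2 : Tendsto (k - C c).rep (𝓝[≠] w) (𝓝 0) := by
    rw [og_iff_ord] at hog
    apply tendsto_zero_of_meromorphicOrderAt_pos
    unfold ord at hog
    exact lt_of_lt_of_le (by norm_num) hog
  have h3 : ∀ᶠ z in 𝓝[≠] w, ‖(k - C c).rep z‖ < 1 := by
    have := h2.norm
    rw [norm_zero] at this
    exact this.eventually (gt_mem_nhds zero_lt_one)
  have h4 : ∀ᶠ z in 𝓝[≠] w, ‖z‖ < δ ∧ z ≠ 0 := by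
    apply Filter.Eventually.filter_mono nhdsWithin_le_nhds
    exact (continuous_norm.continuousAt.eventually (gt_mem_nhds hwδ)).and (eventually_ne_nhds hw)
  have h5 := Dom.rep_add k (-C c) w
  have h6 := Dom.rep_neg (C c) w
  have h7 := Dom.rep_C c w
  obtain ⟨z, a3, ⟨a4, a4'⟩, a5, a6, a7⟩ := (h3.and (h4.and (h5.and (h6.and h7)))).exists
  have b1 := h1 (y := z) (by simpa using a4) a4'
  rw [sub_eq_add_neg, a5, Pi.add_apply, a6, Pi.neg_apply, a7] at a3
  have : ‖k.rep z‖ ≤ ‖k.rep z + -c‖ + ‖c‖ := by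
    calc ‖k.rep z‖ = ‖(k.rep z + -c) + c‖ := by ring_nf
      _ ≤ _ := norm_add_le _ _
  linarith

lemma fin_ball (h : Mer) (R : ℝ) : {z | v z h ≠ 0 ∧ ‖z‖ ≤ R}.Finite := by
  by_cases hh : h = 0
  · simp [hh, v_zero]
  by_contra hinf
  obtain ⟨x, _, hx⟩ := (show Set.Infinite _ from hinf).exists_accPt_of_subset_isCompact (isCompact_closedBall (0:ℂ) R)
    (fun z hz => by simpa using hz.2)
  rw [accPt_iff_frequently_nhdsNE] at hx
  obtain ⟨z, h1, h2⟩ := (hx.and_eventually (v_zero_codiscrete hh x)).exists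
  exact h1.1 h2

/-- derivative of the Newton quotient -/
lemma newton_val {h : Mer} {x : ℂ} {n : ℤ} (hn : n ≠ 0) (hv : v x h = n) :
    og x 1 (D ((D h / h)⁻¹) - C ((n:ℂ)⁻¹)) ∧ og x 1 ((D h / h)⁻¹) := by
  have h0 : h ≠ 0 := by rintro rfl; rw [v_zero] at hv; omega
  have hn0 : (n : ℂ) ≠ 0 := by exact_mod_cast hn
  have hN0 : C (n:ℂ) ≠ 0 := fun h => hn0 (C_inj (h.trans C.map_zero.symm))
  obtain ⟨z1, z2⟩ := v_Z_sub1 x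
  obtain ⟨l1, l2⟩ := v_logD (h := h) (z := x) (by rw [hv]; exact hn)
  set ζ := Z - C x with hζ
  set l := D h / h with hl
  have dζ : D ζ = 1 := by rw [hζ, D_sub, D_Z, D_C, sub_zero]
  have o1 : og x 1 (l⁻¹) := Or.inr (by rw [v_inv, l2]; norm_num)
  refine ⟨?_, o1⟩
  -- `l = n/ζ + A`
  have key : og x 0 (l - C (n:ℂ) / ζ) := by
    have zn : ζ ^ n ≠ 0 := zpow_ne_zero _ z2
    have hz : D (ζ ^ n) / ζ ^ n = C (n:ℂ) / ζ := by
      have hp : ∀ p : ℕ, D (ζ ^ p) / ζ ^ p = (p : Mer) / ζ := by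
        intro p
        cases p with
        | zero => simp [D_one]
        | succ p => rw [D_pow, dζ, pow_succ]; push_cast; field_simp
      obtain ⟨p, rfl | rfl⟩ := n.eq_nat_or_neg
      · rw [zpow_natCast, hp]; simp
      · rw [zpow_neg, zpow_natCast]
        have zp := pow_ne_zero p z2
        have := hp p
        rw [D_inv zp]
        have e : -D (ζ ^ p) / (ζ ^ p) ^ 2 / (ζ ^ p)⁻¹ = - (D (ζ ^ p) / ζ ^ p) := by field_simp
        rw [e, this]; simp [neg_div]
    have vz : v x (ζ ^ n) = n := by
      obtain ⟨p, rfl | rfl⟩ := n.eq_nat_or_neg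
      · rw [zpow_natCast, v_pow, z1]; simp
      · rw [zpow_neg, zpow_natCast, v_inv, v_pow, z1]; simp
    rw [← hz]
    exact og_logD_sub h0 zn (by rw [hv, vz])
  have e : l⁻¹ - C ((n:ℂ)⁻¹) * ζ = -(l⁻¹ * ζ * (C ((n:ℂ)⁻¹) * (l - C (n:ℂ) / ζ))) := by
    rw [map_inv₀]; field_simp; ring
  have o2 : og x 2 (l⁻¹ - C ((n:ℂ)⁻¹) * ζ) := by
    rw [e]
    have o3 : og x 1 ζ := Or.inr (by rw [z1])
    have := og_mul (og_mul o1 o3) (og_mul0 (og_C x ((n:ℂ)⁻¹)) key)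
    exact og_neg this
  have := og_D o2
  rw [D_sub, D_C_mul, dζ, mul_one] at this
  exact this

end Mer
end


open Complex Filter Topology MeasureTheory
open scoped Classical

noncomputable section

namespace Dom
variable {D : Dom}

lemma mm_ode {r : ℝ} (hr : r ∈ D.rad) {h l A τ E : Mer} (e : h = A⁻¹ * (l + -τ + -(E * h⁻¹))) :
    D.mm r h ≤ D.mm r A⁻¹ + D.mm r l + D.mm r τ + D.mm r E + 2 * Real.log 2 := by
  set G : ℂ → ℂ := fun z => (A⁻¹).rep z * (l.rep z + -τ.rep z + -(E.rep z * (h.rep z)⁻¹)) with hG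
  set H : ℂ → ℂ := fun z => if h.rep z = G z then h.rep z else 0 with hH
  have e1 : ∀ w, h.rep =ᶠ[𝓝[≠] w] H := by
    intro w
    have : h.rep =ᶠ[𝓝[≠] w] G := by
      conv_lhs => rw [e]
      filter_upwards [rep_mul A⁻¹ (l + -τ + -(E * h⁻¹)) w, rep_add (l + -τ) (-(E * h⁻¹)) w, rep_add l (-τ) w,
        rep_neg τ w, rep_neg (E * h⁻¹) w, rep_mul E h⁻¹ w, rep_inv h w] with z h1 h2 h3 h4 h5 h6 h7
      rw [h1, Pi.mul_apply, h2, Pi.add_apply, h3, Pi.add_apply, h4, h5, Pi.neg_apply, Pi.neg_apply, h6, Pi.mul_apply, h7]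
      rfl
    filter_upwards [this] with z hz
    rw [hH]; simp only [hz, if_true]
  have e2 : ∀ z, Real.posLog ‖H z‖ ≤ Real.posLog ‖(A⁻¹).rep z‖ + Real.posLog ‖l.rep z‖ + Real.posLog ‖τ.rep z‖
      + Real.posLog ‖E.rep z‖ + 2 * Real.log 2 := by
    intro z
    have p1 := Real.posLog_nonneg (x := ‖(A⁻¹).rep z‖)
    have p2 := Real.posLog_nonneg (x := ‖l.rep z‖)
    have p3 := Real.posLog_nonneg (x := ‖τ.rep z‖)
    have p4 := Real.posLog_nonneg (x := ‖E.rep z‖)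
    have p5 := Real.log_pos (x := 2) (by norm_num)
    simp only [hH]
    split_ifs with hz
    swap
    · simp only [norm_zero, Real.posLog_zero]; linarith
    by_cases h1 : ‖h.rep z‖ ≤ 1
    · have : Real.posLog ‖h.rep z‖ = 0 := by
        rw [Real.posLog_eq_zero_iff]; simpa using h1
      linarith
    push Not at h1
    rw [hz, hG]
    simp only [norm_mul]
    have q1 := Real.posLog_mul (x := ‖(A⁻¹).rep z‖) (y := ‖l.rep z + -τ.rep z + -(E.rep z * (h.rep z)⁻¹)‖)
    have q2 := Real.posLog_norm_add_le (l.rep z + -τ.rep z) (-(E.rep z * (h.rep z)⁻¹))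
    have q3 := Real.posLog_norm_add_le (l.rep z) (-τ.rep z)
    have q4 : Real.posLog ‖-(E.rep z * (h.rep z)⁻¹)‖ ≤ Real.posLog ‖E.rep z‖ := by
      apply Real.posLog_le_posLog (norm_nonneg _)
      rw [norm_neg, norm_mul, norm_inv]
      exact mul_le_of_le_one_right (norm_nonneg _) (inv_le_one_of_one_le₀ h1.le)
    rw [norm_neg] at q3
    linarith
  rw [mm_congr hr (F := H ∘ D.ψ) (fun z hz => comp_ev hr hz e1)]
  have c1 := GoodF.ci (r0 hr) (mero hr A⁻¹)
  have c2 := GoodF.ci (r0 hr) (mero hr l)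
  have c3 := GoodF.ci (r0 hr) (mero hr τ)
  have c4 := GoodF.ci (r0 hr) (mero hr E)
  have := mF_le (r0 hr) (F := H ∘ D.ψ) (fun z hz => (mero hr h z hz).congr (comp_ev hr (by simpa using hz) e1))
    ((((c1.add c2).add c3).add c4).add (circleIntegrable_const (2 * Real.log 2) 0 r))
    (fun z _ => e2 (D.ψ z))
  refine this.trans (le_of_eq ?_)
  unfold mm mF
  rw [Real.circleAverage_add (((c1.add c2).add c3).add c4) (circleIntegrable_const _ 0 r), Real.circleAverage_const,
    Real.circleAverage_add ((c1.add c2).add c3) c4, Real.circleAverage_add (c1.add c2) c3, Real.circleAverage_add c1 c2]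

end Dom

namespace Mer

variable {φ : Mer} {N : ℕ}

lemma Su.finish (s : Su φ N) {m} (hm : m + 2 ≤ N) (hz : PL.few 0 {z | 0 < v z (F φ m)}) {t0 τ E T0 : Mer}
    (r0 : t0 ∈ RatF) (r1 : τ ∈ RatF) (r2 : E ∈ RatF) (e : tq φ m = t0 + τ * (L φ m)⁻¹ + E * (L φ m)⁻¹ ^ 2)
    (hT : Inv t0 T0) (hT0 : v 0 T0 < 0) : L φ m ∈ PL.cls 0 := by
  have n0 := s.ne m (by omega)
  have l0 := s.lne (m := m) (by omega)
  have ht := tq_eq (s.ne m (by omega)) (s.ne (m+1) (by omega))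
  -- few poles
  have hp : PL.few 0 {z | v z (F φ m) ≠ 0} := by
    obtain ⟨δ, hδ, hl⟩ := large_near_pole hT0 2
    refine (((hz.union (Dom.few_poles (RatF_cls PL 0 r1))).union (Dom.few_poles (RatF_cls PL 0 r2))).union
      (Dom.few_finite (D := PL) (fin_ball (F φ m) δ⁻¹) 0)).mono ?_
    intro x hx
    have hx : v x (F φ m) ≠ 0 := hx
    by_contra hc
    simp only [Set.mem_union, Set.mem_ofPred_eq, not_or, not_lt, not_and, not_le] at hc
    obtain ⟨⟨⟨c1, c2⟩, c3⟩, c4⟩ := hc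
    replace c4 := c4 hx
    have x0 : x ≠ 0 := by
      rintro rfl; rw [norm_zero] at c4; have := inv_pos.2 hδ; linarith
    obtain ⟨o1, o2⟩ := newton_val hx rfl
    rw [← L_def] at o1 o2
    set n := v x (F φ m) with hn
    have o3 : og x 1 (t0 - C (1 - (n:ℂ)⁻¹)) := by
      have ee : t0 - C (1 - (n:ℂ)⁻¹) = -(D (L φ m)⁻¹ - C ((n:ℂ)⁻¹)) - τ * (L φ m)⁻¹ - E * ((L φ m)⁻¹ * (L φ m)⁻¹) := by
        rw [ht] at e
        rw [C.map_sub, C.map_one]; linear_combination -e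
      rw [ee]
      have o4 : og x 0 τ := Or.inr c2
      have o5 : og x 0 E := Or.inr c3
      exact og_sub (og_sub (og_neg o1) (og_mul0 o4 o2)) (og_mul0 o5 (og_mul0 (og_mono o2 (by norm_num)) o2))
    refine hl x⁻¹ (inv_ne_zero x0) ?_ (1 - (n:ℂ)⁻¹) ?_ ((hT.sub (Inv.const _)).og (inv_ne_zero x0) (by rwa [inv_inv]))
    · rw [norm_inv]; exact (inv_lt_comm₀ hδ (norm_pos_iff.2 x0)).1 c4
    · refine (norm_sub_le _ _).trans ?_
      rw [norm_one, norm_inv]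
      have : (1:ℝ) ≤ ‖(n:ℂ)‖ := by
        rw [Complex.norm_intCast]; exact_mod_cast Int.one_le_abs hx
      have := inv_le_one_of_one_le₀ this
      linarith
  apply Dom.growth
  have t1 : t0 - 1 ≠ 0 := by
    intro h0
    have h1 : t0 = C 1 := by rw [map_one]; exact sub_eq_zero.1 h0
    have := hT.eqn (Inv.const 1) h1
    rw [this, v_C] at hT0; exact lt_irrefl _ hT0
  apply Dom.InG.mk
  · set γ := fun ρ => Real.posLog (PL.ts (L φ m) ρ) with hγ
    have b1 : PL.Bd γ (fun r => PL.mm r (D (L φ m) / L φ m)) := Dom.lld_G l0 (Dom.self_cT _)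
    have q : ∀ {h}, h ∈ RatF → PL.Bd γ (fun r => PL.mm r h) := fun hh => Dom.InG.mm (RatF_cls PL γ hh)
    refine (((((q (RatF.inv_mem (RatF.sub_mem r0 RatF.one_mem))).add b1).add (q r1)).add (q r2)).add
      (Dom.Bd.const γ (2 * Real.log 2))).mono fun r hr => ?_
    apply Dom.mm_ode hr
    have e3 : D (L φ m)⁻¹ = - D (L φ m) / L φ m ^ 2 := D_inv l0
    rw [ht, e3] at e
    rw [eq_comm, inv_mul_eq_iff_eq_mul₀ t1]
    field_simp at e ⊢
    linear_combination e
  · refine Dom.Cnt.bd (Dom.Cnt.few (hp.gauge)) ?_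
    intro z
    split_ifs with h
    · have := (Dom.pm_le_iff z (L φ m) 1).2 (by rw [L_def]; simpa using og_logD z)
      exact_mod_cast this
    · have h : v z (F φ m) = 0 := by simpa using h
      have := (Dom.pm_le_iff z (L φ m) 0).2 (by rw [L_def]; simpa using og_logD0 h)
      exact_mod_cast this

end Mer
end


open Complex Filter Topology MeasureTheory
open scoped Classical

noncomputable section

namespace Mer

/-- regularity of the second coefficient at a simple zero of `U` -/
lemma E_reg {U t β ε π : Mer} {z : ℂ} (hU : U ≠ 0) (ht : t ≠ 0) (h3 : ε + 2 * β ≠ 0)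
    (hπ : π * (ε + 2 * β) = D β) (H1 : D U = (ε + β) / 2 - t) (H2 : U * D t = β * t - 2 * t ^ 2)
    (vU : v z U = 1) (oε : og z 0 ε) (oβ : og z 0 β) (v3 : v z (ε + 2 * β) = 0) (vt : ¬ 0 < v z t) :
    og z 0 ((t - β / 2 + π * U) / U ^ 2) := by
  have o2 : og z 0 ((2:Mer)⁻¹) := og_nat_inv z 2
  have oU : og z 0 U := Or.inr (by rw [vU]; norm_num)
  have ot : og z 0 t := by
    have : t = (ε + β) * 2⁻¹ - D U := by rw [H1]; ring
    rw [this]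
    refine og_sub ?_ (og_D0 oU)
    rw [mul_comm]; exact og_mul0 o2 (og_add oε oβ)
  have vt0 : v z t = 0 := by have := og_v ot ht; omega
  set q := -(2⁻¹ * (D t / t)) with hq
  have oq : og z 0 q := og_neg (og_mul0 o2 (og_logD0 vt0))
  have e1 : t = β / 2 + U * q := by
    have : U * q = -(2⁻¹ * ((U * D t) / t)) := by rw [hq]; ring
    rw [this, H2]; field_simp; ring
  have e2 : D t = -2 * q * t := by rw [hq]; field_simp
  have e3 : (q + π) * (ε + 2 * β) = -2 * (U * (q ^ 2 + D q)) := by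
    have h4 : D t = D β / 2 + D U * q + U * D q := by
      conv_lhs => rw [e1]
      have : β / 2 = C (1/2) * β := by rw [C_half]; ring
      rw [D_add, D_mul, this, D_C_mul, C_half]; ring
    rw [e2] at h4
    rw [H1] at h4
    rw [← hπ] at h4
    linear_combination (-2) * h4 + (-4 * q + 2 * q) * e1
  have e4 : (t - β / 2 + π * U) / U ^ 2 = -(2 * ((q ^ 2 + D q) * (ε + 2 * β)⁻¹)) := by
    have h5 : t - β / 2 + π * U = U * (q + π) := by linear_combination e1
    have h6 : q + π = -2 * (U * (q ^ 2 + D q)) / (ε + 2 * β) := by rw [eq_div_iff h3]; exact e3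
    rw [h5, h6]; field_simp
  rw [e4]
  exact og_neg (og_mul0 (og_ofNat z 2) (og_mul0 (og_add (og_pow0 oq 2) (og_D0 oq)) (og_inv0 v3)))

lemma E_alg {U t β ε π E : Mer} (hU : U ≠ 0) (hπ : π * (ε + 2 * β) = D β) (H1 : D U = (ε + β) / 2 - t)
    (H2 : U * D t = β * t - 2 * t ^ 2) (hE : t = β / 2 - π * U + E * U ^ 2) :
    (- D π + π ^ 2 + E * (ε + β)) + (D E - π * E) * U = 0 := by
  have h1 : D t = 2 * t * (π - E * U) := by
    have : U * D t = U * (2 * t * (π - E * U)) := by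
      rw [H2]; linear_combination (-2 * t) * hE
    exact mul_left_cancel₀ hU this
  have h2 : D t = D β / 2 - (D π * U + π * D U) + (D E * U ^ 2 + E * (2 * U * D U)) := by
    conv_lhs => rw [hE]
    have : β / 2 = C (1/2) * β := by rw [C_half]; ring
    rw [D_add, D_sub, D_mul, D_mul, this, D_C_mul, C_half, D_sq]; ring
  rw [h1, H1, ← hπ] at h2
  have : U * ((- D π + π ^ 2 + E * (ε + β)) + (D E - π * E) * U) = U * 0 := by
    rw [mul_zero]
    linear_combination (-1) * h2 + π * hE
  exact mul_left_cancel₀ hU this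

end Mer
end


open Complex Filter Topology MeasureTheory
open scoped Classical

noncomputable section

namespace Mer

lemma EinS {u U t β ε π : Mer} (hU : U ≠ 0) (ht : t ≠ 0) (hε : ε ≠ 0) (h3 : ε + 2 * β ≠ 0)
    (hUT : U ∈ PL.cT u) (htT : t ∈ PL.cT u) (hβB : β ∈ PL.cls 0) (hεB : ε ∈ PL.cls 0)
    (hπ : π * (ε + 2 * β) = D β) (H1 : D U = (ε + β) / 2 - t) (H2 : U * D t = β * t - 2 * t ^ 2)
    (hz : PL.few 0 {z | 0 < v z t}) : (t - β / 2 + π * U) / U ^ 2 ∈ PL.cS u := by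
  have h3B : ε + 2 * β ∈ PL.cls 0 := add_mem hεB (mul_mem (ofNat_mem _ 2) hβB)
  have hπB : π ∈ PL.cls 0 := by
    rw [eq_div_of_mul_eq h3 hπ]; exact div_mem (Dom.cls_D hβB) h3B
  have U2 : U ^ 2 ≠ 0 := pow_ne_zero 2 hU
  set s := t / U ^ 2 with hs
  have s0 : s ≠ 0 := div_ne_zero ht U2
  have eV : U⁻¹ = -(ε⁻¹ * (D s / s)) := by
    rw [hs, logD_div ht U2, D_sq, H1]
    have : D t = (β * t - 2 * t ^ 2) / U := by rw [eq_div_iff hU, mul_comm]; exact H2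
    rw [this]; field_simp; ring
  have V0 : U⁻¹ ≠ 0 := inv_ne_zero hU
  set E := (t - β / 2 + π * U) / U ^ 2 with hE
  have eE : E = U⁻¹ * (D U⁻¹ / U⁻¹) + (C (1/2) * ε * (U⁻¹ * U⁻¹) + π * U⁻¹) := by
    rw [mul_div_cancel₀ _ V0, D_inv hU, H1, C_half, hE]; field_simp; ring
  have eE' : E = D U⁻¹ + (C (1/2) * ε * (U⁻¹ * U⁻¹) + π * U⁻¹) := by
    rw [eE, mul_div_cancel₀ _ V0]
  set γ := fun ρ => Real.posLog (PL.ts u ρ) with hγ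
  have q : ∀ {h}, h ∈ PL.cls 0 → h ∈ PL.cls γ := fun hh => Dom.cls_zero_le γ hh
  have bl : PL.Bd γ (fun r => PL.mm r (D s / s)) :=
    Dom.lld_G s0 (show s ∈ PL.cT u from div_mem htT (pow_mem hUT 2))
  have bV : PL.Bd γ (fun r => PL.mm r U⁻¹) := by
    refine ((Dom.InG.mm (inv_mem (q hεB))).add bl).mono fun r hr => ?_
    rw [eV, Dom.mm_neg hr]; exact Dom.mm_mul hr _ _
  have bl2 : PL.Bd γ (fun r => PL.mm r (D U⁻¹ / U⁻¹)) :=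
    Dom.lld_G V0 (show U⁻¹ ∈ PL.cT u from inv_mem hUT)
  have bε : PL.Bd γ (fun r => PL.mm r (C (1/2) * ε)) := Dom.InG.mm (mul_mem (Dom.cls_C _ _) (q hεB))
  have bπ : PL.Bd γ (fun r => PL.mm r π) := Dom.InG.mm (q hπB)
  apply Dom.InG.mk
  · refine (((((bV.add bl2).add bε).add (bV.add bV)).add (bπ.add bV)).add (Dom.Bd.const γ (2 * Real.log 2))).mono fun r hr => ?_
    have a1 := Dom.mm_add hr (U⁻¹ * (D U⁻¹ / U⁻¹)) (C (1/2) * ε * (U⁻¹ * U⁻¹) + π * U⁻¹)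
    have a2 := Dom.mm_add hr (C (1/2) * ε * (U⁻¹ * U⁻¹)) (π * U⁻¹)
    have a3 := Dom.mm_mul hr U⁻¹ (D U⁻¹ / U⁻¹)
    have a4 := Dom.mm_mul hr (C (1/2) * ε) (U⁻¹ * U⁻¹)
    have a5 := Dom.mm_mul hr U⁻¹ U⁻¹
    have a6 := Dom.mm_mul hr π U⁻¹
    show PL.mm r E ≤ _
    rw [eE]; linarith
  · set P : Set ℂ := {z | 0 < v z t} ∪ {z | v z ε < 0} ∪ {z | 0 < v z ε} ∪ {z | v z β < 0} ∪ {z | v z π < 0} ∪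
      {z | v z (ε + 2 * β) < 0} ∪ {z | 0 < v z (ε + 2 * β)} with hP
    have fP : PL.few 0 P :=
      (((((hz.union (Dom.few_poles hεB)).union (Dom.few_zeros hεB)).union (Dom.few_poles hβB)).union
        (Dom.few_poles hπB)).union (Dom.few_poles h3B)).union (Dom.few_zeros h3B)
    refine Dom.Cnt.bd ((((Dom.Cnt.few fP.gauge).cmul (k := 5) (by norm_num)).add
      ((Dom.Cnt.cls (inv_mem (q hεB))).cmul (k := 5) (by norm_num))).add
      ((Dom.Cnt.cls (q hεB)).add (Dom.Cnt.cls (q hπB)))) ?_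
    intro z
    have n1 := Dom.pm_nonneg z ε⁻¹
    have n2 := Dom.pm_nonneg z ε
    have n3 := Dom.pm_nonneg z π
    by_cases h : z ∈ P
    · rw [if_pos h]
      have p1 := (Dom.pm_le_iff z (D s / s) 1).2 (by simpa using og_logD z)
      push_cast at p1
      have p2 : Dom.pm z U⁻¹ ≤ Dom.pm z ε⁻¹ + 1 := by
        rw [eV, Dom.pm_neg]; have := Dom.pm_mul z ε⁻¹ (D s / s); linarith
      have a0 := Dom.pm_D z U⁻¹
      have a1 := Dom.pm_add z (D U⁻¹) (C (1/2) * ε * (U⁻¹ * U⁻¹) + π * U⁻¹)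
      have a2 := Dom.pm_add z (C (1/2) * ε * (U⁻¹ * U⁻¹)) (π * U⁻¹)
      have a3 := Dom.pm_mul z (C (1/2)) ε
      rw [Dom.pm_C] at a3
      have a4 := Dom.pm_mul z (C (1/2) * ε) (U⁻¹ * U⁻¹)
      have a5 := Dom.pm_mul z U⁻¹ U⁻¹
      have a6 := Dom.pm_mul z π U⁻¹
      rw [eE']; linarith
    · rw [if_neg h]
      simp only [hP, Set.mem_union, Set.mem_ofPred_eq, not_or, not_lt] at h
      obtain ⟨⟨⟨⟨⟨⟨c1, c2⟩, c3⟩, c4⟩, c5⟩, c6⟩, c7⟩ := h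
      have vε : v z ε = 0 := le_antisymm c3 c2
      have v3 : v z (ε + 2 * β) = 0 := le_antisymm c7 c6
      have oε : og z 0 ε := Or.inr c2
      have oβ : og z 0 β := Or.inr c4
      have oπ : og z 0 π := Or.inr c5
      have oV : og z (-1) U⁻¹ := by
        rw [eV]; exact og_neg (og_mul0 (og_inv0 vε) (og_logD z))
      have o : og z 0 E := by
        have h1 := og_v oV V0
        rw [v_inv] at h1
        by_cases h2 : v z U = 1
        · exact E_reg hU ht h3 hπ H1 H2 h2 oε oβ v3 (by omega)
        · have oV0 : og z 0 U⁻¹ := Or.inr (by rw [v_inv]; omega)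
          rw [eE']
          exact og_add (og_D0 oV0) (og_add (og_mul0 (og_mul0 (og_C z _) oε) (og_mul0 oV0 oV0)) (og_mul0 oπ oV0))
      have := (Dom.pm_le_iff z E 0).2 (by simpa using o)
      push_cast at this
      linarith

end Mer
end


open Complex Filter Topology MeasureTheory
open scoped Classical

noncomputable section

namespace Mer

/-- the main dichotomy for the system `U' = η - t`, `U t' = β t - 2 t^2` -/
lemma ode_main {u p t β ε : Mer} (hp : p ∈ PL.cls 0) (hβ : β ∈ PL.cls 0) (hu : D u = 1 - t) (ht : t ≠ 0)
    (H2 : (u + p) * D t = β * t - 2 * t ^ 2) (hε : ε = 2 * (1 + D p) - β) (ε0 : ε ≠ 0) (h3 : ε + 2 * β ≠ 0)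
    (hz : PL.few 0 {z | 0 < v z t}) : u ∈ PL.cls 0 ∨ ∃ E π, E ≠ 0 ∧ π * (ε + 2 * β) = D β ∧
      t = β / 2 - π * (u + p) + E * (u + p) ^ 2 ∧ D E = π * E ∧ - D π + π ^ 2 + E * (ε + β) = 0 := by
  by_cases hU : u + p = 0
  · left; rw [eq_neg_of_add_eq_zero_left hU]; exact neg_mem hp
  have hεB : ε ∈ PL.cls 0 := by
    rw [hε]; exact sub_mem (mul_mem (ofNat_mem _ 2) (add_mem (one_mem _) (Dom.cls_D hp))) hβ
  have h3B : ε + 2 * β ∈ PL.cls 0 := add_mem hεB (mul_mem (ofNat_mem _ 2) hβ)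
  set π := D β / (ε + 2 * β) with hπ'
  have hπ : π * (ε + 2 * β) = D β := div_mul_cancel₀ _ h3
  have hπB : π ∈ PL.cls 0 := div_mem (Dom.cls_D hβ) h3B
  have uT : u ∈ PL.cT u := Dom.self_cT u
  have z0 : ∀ {h}, h ∈ PL.cls 0 → h ∈ PL.cT u := fun hh => Dom.cls_zero_le _ hh
  have z1 : ∀ {h}, h ∈ PL.cls 0 → h ∈ PL.cS u := fun hh => Dom.cls_zero_le _ hh
  have H1 : D (u + p) = (ε + β) / 2 - t := by rw [D_add, hu, hε]; ring
  have tT : t ∈ PL.cT u := by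
    have : t = 1 - D u := by rw [hu]; ring
    rw [this]; exact sub_mem (one_mem _) (Dom.cls_D uT)
  have ES := EinS (u := u) hU ht ε0 h3 (add_mem uT (z0 hp)) tT hβ hεB hπ H1 H2 hz
  set E := (t - β / 2 + π * (u + p)) / (u + p) ^ 2 with hE'
  have hE : t = β / 2 - π * (u + p) + E * (u + p) ^ 2 := by
    rw [hE', div_mul_cancel₀ _ (pow_ne_zero 2 hU)]; ring
  have X := E_alg hU hπ H1 H2 hE
  by_cases X0 : D E - π * E = 0
  swap
  · left
    apply Dom.growth
    have : u = -(- D π + π ^ 2 + E * (ε + β)) / (D E - π * E) - p := by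
      field_simp; linear_combination X
    have hES : E ∈ PL.cS u := ES
    refine (congrArg (· ∈ PL.cS u) this).mpr ?_
    exact sub_mem (div_mem (neg_mem (add_mem (add_mem (neg_mem (Dom.cls_D (z1 hπB))) (pow_mem (z1 hπB) 2))
      (mul_mem hES (add_mem (z1 hεB) (z1 hβ))))) (sub_mem (Dom.cls_D hES) (mul_mem (z1 hπB) hES))) (z1 hp)
  have X1 : - D π + π ^ 2 + E * (ε + β) = 0 := by rw [X0, zero_mul, add_zero] at X; exact X
  by_cases E0 : E = 0
  swap
  · right; exact ⟨E, π, E0, hπ, hE, sub_eq_zero.1 X0, X1⟩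
  left
  rw [E0] at hE X1
  have Dt : D t = 2 * t * π := by
    have : (u + p) * D t = (u + p) * (2 * t * π) := by rw [H2]; linear_combination (-2 * t) * hE
    exact mul_left_cancel₀ hU this
  by_cases π0 : π = 0
  · rw [π0, mul_zero] at Dt
    obtain ⟨c, hc⟩ := const_of_D Dt
    apply prim (Dom.dsub 0) (a := 0) (b := 1 - c)
    rw [hu, hc]; simp
  · have Dq : D π⁻¹ = -1 := by
      rw [D_inv π0]
      have : D π = π ^ 2 := by linear_combination -X1
      rw [this]; field_simp
    have Dk : D (t * π⁻¹ ^ 2) = 0 := by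
      rw [D_mul, D_sq, Dq, Dt]; field_simp; ring
    obtain ⟨k, hk⟩ := const_of_D Dk
    have qB : π⁻¹ ∈ PL.cls 0 := inv_mem hπB
    have tB : t ∈ PL.cls 0 := by
      have : t = C k / π⁻¹ ^ 2 := by rw [← hk]; field_simp
      rw [this]; exact div_mem (Dom.cls_C _ _) (pow_mem qB 2)
    have : u = (β / 2 - t) * π⁻¹ - p := by field_simp; linear_combination 2 * hE
    rw [this]
    exact sub_mem (mul_mem (sub_mem (div_mem hβ (ofNat_mem _ 2)) tB) qB) hp

/-- the final step hypothesis -/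
def Fin' (u t : Mer) : Prop := ∀ t0 τ E T0, t0 ∈ RatF → τ ∈ RatF → E ∈ RatF → t = t0 + τ * u + E * u ^ 2 →
  Inv t0 T0 → v 0 T0 < 0 → u ∈ PL.cls 0

/-- a nonconstant linear function at infinity -/
lemma Inv_lin {p : Mer} {a b : ℂ} (ha : a ≠ 0) (hp : p = C a * Z + C b) :
    ∃ P, Inv p P ∧ P ≠ 0 ∧ v 0 P = -1 := by
  have z1 : v 0 Z = 1 ∧ (Z:Mer) ≠ 0 := by simpa using v_Z_sub1 0
  have e : C a * Z⁻¹ + C b = Z⁻¹ * (C a + C b * Z) := by field_simp [z1.2]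
  have o : og 0 1 (C b * Z) := og_mul0 (og_C 0 b) (Or.inr (by rw [z1.1]))
  have ca : C a ≠ 0 := fun h => ha (C_inj (by rw [h, map_zero]))
  have := v_add_of_lt ca (by rw [v_C]; norm_num) o
  refine ⟨C a * Z⁻¹ + C b, ?_, ?_, ?_⟩
  · rw [hp]; exact ((Inv.const a).mul Inv.z).add (Inv.const b)
  · rw [e]; exact mul_ne_zero (inv_ne_zero z1.2) this.1
  · rw [e, v_mul _ (inv_ne_zero z1.2) this.1, this.2, v_inv, v_C, z1.1]; norm_num

lemma lin_of_D {p : Mer} {a : ℂ} (h : D p = C a) : ∃ b, p = C a * Z + C b := by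
  have : D (p - C a * Z) = 0 := by rw [D_sub, D_C_mul, D_Z, h]; ring
  obtain ⟨b, hb⟩ := const_of_D this
  exact ⟨b, by rw [← hb]; ring⟩

lemma Fin'.app {u t : Mer} (H : Fin' u t) {p : Mer} {a k e : ℂ} (ha : a ≠ 0) (he : e ≠ 0) (hp : D p = C a)
    (e1 : t = C k + C e * (u + p) ^ 2) : u ∈ PL.cls 0 := by
  obtain ⟨b, hb⟩ := lin_of_D hp
  obtain ⟨P, i1, i2, i3⟩ := Inv_lin ha hb
  have pR : p ∈ RatF := by rw [hb]; exact add_mem (mul_mem (RatF_c _) RatF_z) (RatF_c _)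
  refine H (C k + C e * p ^ 2) (2 * C e * p) (C e) (C k + C e * P ^ 2) (add_mem (RatF_c _) (mul_mem (RatF_c _) (pow_mem pR 2)))
    (mul_mem (mul_mem (ofNat_mem _ 2) (RatF_c _)) pR) (RatF_c _) (by rw [e1]; ring)
    ((Inv.const k).add ((Inv.const e).mul (i1.pow 2))) ?_
  have ce : C e ≠ 0 := fun h => he (C_inj (by rw [h, map_zero]))
  have n1 : C e * P ^ 2 ≠ 0 := mul_ne_zero ce (pow_ne_zero 2 i2)
  have v1 : v 0 (C e * P ^ 2) = -2 := by
    rw [v_mul _ ce (pow_ne_zero 2 i2), v_C, v_pow, i3]; norm_num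
  have := v_add_of_lt n1 (by rw [v1]; norm_num) (og_C 0 k)
  rw [add_comm, this.2, v1]; norm_num

lemma odeA {u p t : Mer} (hp : p ∈ PL.cls 0) (hu : D u = 1 - t) (ht : t ≠ 0)
    (H2 : (u + p) * D t = t - 2 * t ^ 2) (hz : PL.few 0 {z | 0 < v z t}) (H : Fin' u t) : u ∈ PL.cls 0 := by
  by_cases hU : u + p = 0
  · rw [eq_neg_of_add_eq_zero_left hU]; exact neg_mem hp
  have c2 : C (-1/2) = -1/2 := by simp [C_two]
  by_cases ε0 : 2 * (1 + D p) - (1:Mer) = 0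
  · have Dp : D p = C (-1/2) := by rw [c2]; linear_combination ε0 / 2
    have : D (t / (u + p) ^ 2) = 0 := by
      rw [D_div _ (pow_ne_zero 2 hU), D_sq, D_add, hu, Dp, c2]
      have : D t = (t - 2 * t ^ 2) / (u + p) := by rw [eq_div_iff hU, mul_comm]; exact H2
      rw [this]; field_simp; ring
    obtain ⟨e, he⟩ := const_of_D this
    refine H.app (k := 0) (e := e) (by norm_num) ?_ Dp ?_
    · rintro rfl
      rw [map_zero, div_eq_zero_iff] at he
      rcases he with he | he
      · exact ht he
      · exact pow_ne_zero 2 hU he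
    · rw [← he, map_zero, zero_add, div_mul_cancel₀ _ (pow_ne_zero 2 hU)]
  by_cases h3 : 2 * (1 + D p) - (1:Mer) + 2 * 1 = 0
  · have Dp : D p = -3/2 := by linear_combination h3 / 2
    have Dt : D t = (1 - 2 * t) / (u + p) * t := by field_simp; linear_combination H2
    set Y := (1 - 2 * t) / (u + p) with hY
    have DY : D Y = Y ^ 2 / 2 := by
      have e2 : D (1 - 2 * t) = -2 * D t := by rw [D_sub, D_mul, D_one, D_ofNat]; ring
      rw [hY, D_div _ hU, e2, Dt, D_add, hu, Dp, hY]; field_simp; ring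
    by_cases Y0 : Y = 0
    · rw [Y0, zero_mul] at Dt
      obtain ⟨c, hc⟩ := const_of_D Dt
      apply prim (Dom.dsub 0) (a := 0) (b := 1 - c)
      rw [hu, hc]; simp
    · have Dq : D Y⁻¹ = C (-1/2) := by rw [D_inv Y0, DY, c2]; field_simp
      have qB : Y⁻¹ ∈ PL.cls 0 := by
        obtain ⟨b, hb⟩ := lin_of_D Dq
        rw [hb]; exact add_mem (mul_mem (Dom.cls_C _ _) (Dom.cls_Z _)) (Dom.cls_C _ _)
      have Dk : D (t * Y⁻¹ ^ 2) = 0 := by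
        rw [D_mul, D_sq, Dq, Dt, c2]; field_simp; ring
      obtain ⟨k, hk⟩ := const_of_D Dk
      have tB : t ∈ PL.cls 0 := by
        have : t = C k / Y⁻¹ ^ 2 := by rw [← hk]; field_simp
        rw [this]; exact div_mem (Dom.cls_C _ _) (pow_mem qB 2)
      have : u = (1 - 2 * t) * Y⁻¹ - p := by
        have : Y * (u + p) = 1 - 2 * t := div_mul_cancel₀ _ hU
        field_simp; linear_combination this
      rw [this]
      exact sub_mem (mul_mem (sub_mem (one_mem _) (mul_mem (ofNat_mem _ 2) tB)) qB) hp
  rcases ode_main hp (one_mem _) hu ht (by rw [one_mul]; exact H2) rfl ε0 h3 hz with h | ⟨E, π, E0, hπ, hE, DE, X⟩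
  · exact h
  have π0 : π = 0 := by
    rw [D_one] at hπ
    exact (mul_eq_zero.1 hπ).resolve_right h3
  rw [π0] at DE hE X
  rw [zero_mul] at DE
  obtain ⟨e, rfl⟩ := const_of_D DE
  have h4 : D p = C (-1) := by
    rw [D_zero] at X
    have X : C e * (2 * (1 + D p)) = 0 := by linear_combination X
    have X := (mul_eq_zero.1 X).resolve_left E0
    rw [map_neg, map_one]; linear_combination X / 2
  refine H.app (k := 1/2) (e := e) (by norm_num) ?_ h4 ?_
  · rintro rfl; exact E0 (map_zero _)
  · rw [C_half]; linear_combination hE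

end Mer
end


open Complex Filter Topology MeasureTheory
open scoped Classical

noncomputable section

namespace Mer

lemma v0_Z : v 0 Z = 1 ∧ (Z:Mer) ≠ 0 := by simpa using v_Z_sub1 0

lemma euler_nat {h : Mer} (hh : h ≠ 0) {n : ℕ} (hn : v 0 h = n) : og 0 1 (Z * (D h / h) - C n) := by
  obtain ⟨z1, z2⟩ := v0_Z
  have zn : (Z:Mer) ^ n ≠ 0 := pow_ne_zero n z2
  set k := h / Z ^ n with hk
  have k0 : k ≠ 0 := div_ne_zero hh zn
  have vk : v 0 k = 0 := by rw [hk, v_div _ hh zn, v_pow, z1, hn]; ring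
  have e : h = k * Z ^ n := by rw [hk]; field_simp
  have e2 : Z * (D h / h) - C n = Z * (D k / k) := by
    rw [e, logD_mul k0 zn]
    rcases n with _ | n
    · simp
    · rw [D_pow, D_Z, map_natCast]; push_cast; field_simp; ring
  rw [e2, mul_comm]
  exact og_mul0 (og_logD0 vk) (Or.inr (by rw [z1]))

lemma euler {h : Mer} (hh : h ≠ 0) : og 0 1 (Z * (D h / h) - C (v 0 h : ℤ)) := by
  rcases le_total 0 (v 0 h) with hv | hv
  · obtain ⟨n, hn⟩ := Int.eq_ofNat_of_zero_le hv
    rw [hn]; exact_mod_cast euler_nat hh hn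
  · obtain ⟨n, hn⟩ := Int.eq_ofNat_of_zero_le (neg_nonneg.2 hv)
    have := euler_nat (inv_ne_zero hh) (n := n) (by rw [v_inv, hn]; )
    have e : Z * (D h / h) - C (v 0 h : ℤ) = -(Z * (D h⁻¹ / h⁻¹) - C n) := by
      have : v 0 h = -(n:ℤ) := by omega
      rw [D_inv hh, this]; push_cast; rw [map_neg]; field_simp; ring
    rw [e]; exact og_neg this

lemma C_small {c : ℂ} (h : og 0 1 (C c)) : c = 0 := by
  by_contra hc
  have := og_v h (fun h => hc (C_inj (by rw [h, map_zero])))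
  rw [v_C] at this; omega

lemma Inv.ne {h k : Mer} (a : Inv h k) (hh : h ≠ 0) : k ≠ 0 := by
  rintro rfl
  have := a.mul a.inv
  rw [mul_inv_cancel₀ hh, zero_mul] at this
  exact one_ne_zero (Inv.one.unique this)

lemma deg_int {η β : ℤ} (h : η * (3 - 2 * β) = -β) :
    (η = 0 ∧ β = 0) ∨ (η = 2 ∧ β = 2) ∨ (η = -1 ∧ β = 1) ∨ (η = 1 ∧ β = 3) := by
  have h2 : (2 * β - 3) * (2 * η - 1) = 3 := by linear_combination (-2) * h
  have h3 : (2 * η - 1) ∣ 3 := ⟨2 * β - 3, by rw [mul_comm]; exact h2.symm⟩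
  have h4 := Int.le_of_dvd (by norm_num) h3
  have h5 := Int.le_of_dvd (by norm_num) (neg_dvd.2 h3)
  have : η = -1 ∨ η = 0 ∨ η = 1 ∨ η = 2 := by omega
  clear h3 h4 h5 h2
  rcases this with rfl | rfl | rfl | rfl <;> omega

lemma degree {b y π : Mer} {z0 c2 : ℂ} (hb : b ∈ RatF) (hy : y ∈ RatF) (b0 : b ≠ 0) (y0 : y ≠ 0)
    (r1 : D y = C c2 - 2 * ((Z - C z0) * b)) (r2 : D y * (3 * b + 2 * ((Z - C z0) * D b)) = -(D b * y))
    (r3 : D y = -(π * y)) :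
    ∃ T0, Inv (b / 2 - π * ((Z - C z0) * (b - 1)) + y⁻¹ * ((Z - C z0) * (b - 1)) ^ 2) T0 ∧ v 0 T0 < 0 := by
  obtain ⟨B, iB⟩ := Inv_exists hb
  obtain ⟨Y, iY⟩ := Inv_exists hy
  have B0 := iB.ne b0
  have Y0 := iY.ne y0
  obtain ⟨z1, zn⟩ := v0_Z
  have oZ : og 0 1 Z := Or.inr (by rw [z1])
  have iX : Inv (Z - C z0) (Z⁻¹ - C z0) := Inv.z.sub (Inv.const _)
  set X := Z⁻¹ - C z0 with hX
  have i2 : Inv 2 2 := by exact_mod_cast Inv.nat 2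
  have i3 : Inv 3 3 := by exact_mod_cast Inv.nat 3
  have s1 := iY.der.eqn ((Inv.const c2).sub (i2.mul (iX.mul iB))) r1
  have s2 := (iY.der.mul ((i3.mul iB).add (i2.mul (iX.mul iB.der)))).eqn ((iB.der.mul iY).neg) r2
  have vX : X ≠ 0 ∧ v 0 X = -1 := by
    have o : og 0 0 (-C z0) := og_neg (og_C 0 z0)
    have := v_add_of_lt (inv_ne_zero zn) (by rw [v_inv, z1]; norm_num) o
    rw [← sub_eq_add_neg] at this
    refine ⟨this.1, ?_⟩
    rw [hX, this.2, v_inv, z1]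
  have eu1 := euler B0
  have eu2 := euler Y0
  set lB := Z * (D B / B) with hlB
  set lY := Z * (D Y / Y) with hlY
  have s3 : lY * (3 - 2 * (1 - C z0 * Z) * lB) = - lB := by
    have : Z * X = 1 - C z0 * Z := by rw [hX, mul_sub, mul_inv_cancel₀ zn]; ring
    rw [← this, hlY, hlB]
    have hh : Z ^ 2 * (D Y * (3 * B - 2 * (X * Z ^ 2 * D B))) = Z ^ 2 * (-(D B * Y)) := by
      linear_combination (-1) * s2
    have hh := mul_left_cancel₀ (pow_ne_zero 2 zn) hh
    clear_value X
    field_simp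
    linear_combination hh
  have olB : og 0 0 lB := by
    have := og_add (og_mono eu1 (by norm_num : (0:ℤ) ≤ 1)) (og_C 0 (v 0 B : ℤ)); simpa using this
  have olY : og 0 0 lY := by
    have := og_add (og_mono eu2 (by norm_num : (0:ℤ) ≤ 1)) (og_C 0 (v 0 Y : ℤ)); simpa using this
  have s4 : v 0 Y * (3 - 2 * v 0 B) = - v 0 B := by
    have : og 0 1 (C ((v 0 Y : ℤ) * (3 - 2 * (v 0 B : ℤ)) + (v 0 B : ℤ))) := by
      have e : C ((v 0 Y : ℤ) * (3 - 2 * (v 0 B : ℤ)) + (v 0 B : ℤ)) =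
          -((3 - 2 * C (v 0 B : ℤ)) * (lY - C (v 0 Y : ℤ))) + (2 * lY - 1) * (lB - C (v 0 B : ℤ))
            + (-(2 * (C z0 * (lY * lB)))) * Z := by
        simp only [map_add, map_mul, map_sub, map_ofNat]
        linear_combination s3
      rw [e]
      refine og_add (og_add (og_neg (og_mul0 (og_sub (og_ofNat 0 3) (og_mul0 (og_ofNat 0 2) (og_C 0 _))) eu2))
        (og_mul0 (og_sub (og_mul0 (og_ofNat 0 2) olY) (og_one 0)) eu1)) ?_
      exact og_mul0 (og_neg (og_mul0 (og_ofNat 0 2) (og_mul0 (og_C 0 _) (og_mul0 olY olB)))) oZ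
    have := C_small this
    have : (v 0 Y * (3 - 2 * v 0 B) + v 0 B : ℤ) = 0 := by exact_mod_cast this
    linarith
  have ePi : Inv π (Z * lY) := by
    have e : π = -(D y / y) := by rw [r3]; field_simp
    have := (iY.der.div iY).neg
    rw [← e] at this
    convert this using 1
    rw [hlY]; field_simp
  have i4 := iX.mul (iB.sub Inv.one)
  refine ⟨_, ((iB.div i2).sub (ePi.mul i4)).add (iY.inv.mul (i4.pow 2)), ?_⟩
  have key : 1 ≤ v 0 B → -1 ≤ v 0 Y → 
      v 0 (B / 2 - Z * lY * (X * (B - 1)) + Y⁻¹ * (X * (B - 1)) ^ 2) < 0 := by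
    intro k1 k2
    have oB : og 0 1 B := Or.inr k1
    have m1 : B - 1 ≠ 0 ∧ v 0 (B - 1) = 0 := by
      have := v_add_of_lt (z := 0) (h := -1) (k := B) (by simp) (n := 1) (by rw [v_neg, v_one]; norm_num) oB
      rw [v_neg, v_one] at this
      have e : B - 1 = -1 + B := by ring
      rw [e]; exact this
    set P := X * (B - 1) with hP
    have P0 : P ≠ 0 := mul_ne_zero vX.1 m1.1
    have vP : v 0 P = -1 := by rw [hP, v_mul _ vX.1 m1.1, vX.2, m1.2]; norm_num
    have q0 : Y⁻¹ * P ^ 2 ≠ 0 := mul_ne_zero (inv_ne_zero Y0) (pow_ne_zero 2 P0)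
    have vq : v 0 (Y⁻¹ * P ^ 2) < 0 := by
      rw [v_mul _ (inv_ne_zero Y0) (pow_ne_zero 2 P0), v_inv, v_pow, vP]; push_cast; omega
    have o : og 0 0 (B / 2 - Z * lY * P) := by
      refine og_sub ?_ ?_
      · rw [div_eq_mul_inv]; exact og_mul0 (og_mono oB (by norm_num)) (og_nat_inv 0 2)
      · have e : Z * lY * P = lY * (Z * P) := by ring
        rw [e]
        refine og_mul0 olY (Or.inr ?_)
        rw [v_mul _ zn P0, z1, vP]; norm_num
    have := v_add_of_lt q0 vq o
    rw [add_comm, this.2]; exact vq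
  rcases deg_int s4 with ⟨h1, h2⟩ | ⟨h1, h2⟩ | ⟨h1, h2⟩ | ⟨h1, h2⟩
  · exfalso
    have oY : og 0 0 Y := Or.inr h1.ge
    have o1 : og 0 0 (X * B) := by
      have e : X * B = 2⁻¹ * (C c2 + Z ^ 2 * D Y) := by
        field_simp; linear_combination s1
      rw [e]
      refine og_mul0 (og_nat_inv 0 2) (og_add (og_C 0 _) (og_mul0 (og_pow0 (og_mono oZ (by norm_num)) 2) (og_D0 oY)))
    have := og_v o1 (mul_ne_zero vX.1 B0)
    rw [v_mul _ vX.1 B0, vX.2, h2] at this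
    omega
  all_goals exact key (by omega) (by omega)

lemma odeB {u t b : Mer} {z0 : ℂ} (hb : b ∈ PL.cls 0) (hb1 : D b ≠ 0) (hu : D u = 1 - t) (ht : t ≠ 0)
    (H2 : (u + (Z - C z0) * (b - 1)) * D t = b * t - 2 * t ^ 2) (hz : PL.few 0 {z | 0 < v z t}) (H : Fin' u t)
    (hr : {z | v z b < 0}.Finite → b ∈ RatF) : u ∈ PL.cls 0 := by
  obtain ⟨vx, x0⟩ := v_Z_sub1 z0
  have Dx : D (Z - C z0) = 1 := by rw [D_sub, D_Z, D_C, sub_zero]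
  have xR : Z - C z0 ∈ RatF := sub_mem RatF_z (RatF_c _)
  have vxz : ∀ z, z ≠ z0 → v z (Z - C z0) = 0 := by
    intro z hzz
    have e : Z - C z0 = C (z - z0) + (Z - C z) := by rw [map_sub]; ring
    have := v_add_of_lt (z := z) (h := C (z - z0)) (n := 1) (k := Z - C z)
      (fun h => sub_ne_zero.2 hzz (C_inj (by rw [h, map_zero]))) (by rw [v_C]; norm_num) (Or.inr (v_Z_sub1 z).1.ge)
    rw [e, this.2, v_C]
  set x := Z - C z0 with hx
  have b0 : b ≠ 0 := by rintro rfl; exact hb1 D_zero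
  have hp : x * (b - 1) ∈ PL.cls 0 := mul_mem (RatF_cls PL 0 xR) (sub_mem hb (one_mem _))
  have Dp : D (x * (b - 1)) = (b - 1) + x * D b := by rw [D_mul, Dx, D_sub, D_one]; ring
  have eε : 2 * (1 + D (x * (b - 1))) - b = b + 2 * (x * D b) := by rw [Dp]; ring
  have ε0 : b + 2 * (x * D b) ≠ 0 := by
    intro h
    have : D (x * b ^ 2) = 0 := by rw [D_mul, Dx, D_sq]; linear_combination b * h
    obtain ⟨k, hk⟩ := const_of_D this
    have := congrArg (v z0) hk
    rw [v_mul _ x0 (pow_ne_zero 2 b0), v_pow, vx, v_C] at this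
    push_cast at this; omega
  have h3 : b + 2 * (x * D b) + 2 * b ≠ 0 := by
    intro h
    have : D (x ^ 3 * b ^ 2) = 0 := by rw [D_mul, D_cube, Dx, D_sq]; linear_combination x ^ 2 * b * h
    obtain ⟨k, hk⟩ := const_of_D this
    have := congrArg (v z0) hk
    rw [v_mul _ (pow_ne_zero 3 x0) (pow_ne_zero 2 b0), v_pow, v_pow, vx, v_C] at this
    push_cast at this; omega
  rcases ode_main hp hb hu ht H2 eε.symm ε0 h3 hz with h | ⟨E, π, E0, hπ, hE, DE, X⟩
  · exact h
  have y0 : E⁻¹ ≠ 0 := inv_ne_zero E0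
  have Dy : D E⁻¹ = -(π * E⁻¹) := by rw [D_inv E0, DE]; field_simp
  have : D (D E⁻¹ + 2 * (x * b)) = 0 := by
    rw [Dy, D_add, D_neg, D_mul π, Dy, D_mul 2, D_ofNat, D_mul x, Dx]
    field_simp; linear_combination X
  obtain ⟨c2, hc2⟩ := const_of_D this
  have r1 : D E⁻¹ = C c2 - 2 * (x * b) := by rw [← hc2]; ring
  have π0 : π ≠ 0 := by
    rintro rfl; rw [zero_mul] at hπ; exact hb1 hπ.symm
  have bR : b ∈ RatF := by
    apply hr
    refine (Set.finite_singleton z0).subset ?_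
    intro z hzb
    have hzb : v z b < 0 := hzb
    by_contra hzz
    have vx0 := vxz z hzz
    have vD : v z (D b) = v z b - 1 := (v_D hzb.ne).2
    have n1 : 2 * (x * D b) ≠ 0 := mul_ne_zero two_ne_zero (mul_ne_zero x0 hb1)
    have v2 : v z (2:Mer) = 0 := by rw [← C_two, v_C]
    have v1 : v z (2 * (x * D b)) = v z b - 1 := by
      rw [v_mul _ two_ne_zero (mul_ne_zero x0 hb1), v_mul _ x0 hb1, vD, vx0, v2]; ring
    have o3 : og z (v z b) (3 * b) := by
      exact og_mul0 (og_ofNat z 3) (Or.inr le_rfl)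
    have q := v_add_of_lt n1 (by rw [v1]; omega) o3
    have e : b + 2 * (x * D b) + 2 * b = 2 * (x * D b) + 3 * b := by ring
    have vπ : v z π = 0 := by
      have := congrArg (v z) hπ
      rw [v_mul _ π0 h3, e, q.2, v1, vD] at this; omega
    have vy : v z E⁻¹ = 0 := by
      by_contra hc
      have h1 := (v_D hc).2
      rw [Dy, v_neg, v_mul _ π0 y0, vπ] at h1; omega
    have o1 : og z 0 (x * b) := by
      have e : x * b = 2⁻¹ * (C c2 - D E⁻¹) := by rw [r1]; ring
      rw [e]
      exact og_mul0 (og_nat_inv z 2) (og_sub (og_C z _) (og_D0 (Or.inr vy.ge)))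
    have := og_v o1 (mul_ne_zero x0 b0)
    rw [v_mul _ x0 b0, vx0] at this; omega
  have DbR := RatF_D bR
  have πR : π ∈ RatF := by
    rw [eq_div_of_mul_eq h3 hπ]
    exact div_mem DbR (add_mem (add_mem bR (mul_mem (ofNat_mem _ 2) (mul_mem xR DbR))) (mul_mem (ofNat_mem _ 2) bR))
  have yR : E⁻¹ ∈ RatF := by
    have : E⁻¹ = -(C c2 - 2 * (x * b)) / π := by rw [← r1, Dy]; field_simp
    rw [this]
    exact div_mem (neg_mem (sub_mem (RatF_c _) (mul_mem (ofNat_mem _ 2) (mul_mem xR bR)))) πR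
  have ER : E ∈ RatF := by rw [← inv_inv E]; exact inv_mem yR
  have r2 : D E⁻¹ * (3 * b + 2 * (x * D b)) = -(D b * E⁻¹) := by
    rw [Dy]; linear_combination (-E⁻¹) * hπ
  obtain ⟨T0, iT, vT⟩ := degree bR yR b0 y0 r1 r2 Dy
  rw [inv_inv] at iT
  have pR : x * (b - 1) ∈ RatF := mul_mem xR (sub_mem bR (one_mem _))
  refine H _ (-π + 2 * E * (x * (b - 1))) E T0 ?_ ?_ ER ?_ iT vT
  · exact add_mem (sub_mem (div_mem bR (ofNat_mem _ 2)) (mul_mem πR pR)) (mul_mem ER (pow_mem pR 2))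
  · exact add_mem (neg_mem πR) (mul_mem (mul_mem (ofNat_mem _ 2) ER) pR)
  · rw [hE]; ring

end Mer
end


open Complex Filter Topology MeasureTheory
open scoped Classical

noncomputable section

namespace Mer
variable {φ : Mer} {N : ℕ}

lemma Su.ode (s : Su φ N) {m} (hm : m + 3 ≤ N) {c : ℂ} {a : Mer} {d : ℂ} (h : K φ m = C c)
    (e1 : (L φ m)⁻¹ = C c * (L (til φ) m)⁻¹ + a) (e2 : a = C (1 - c) * Z + C d) (e3 : D a = C (1 - c)) (a0 : a ≠ 0)
    (hK : D (K φ (m+1)) ≠ 0) (f0 : PL.few 0 {z | 0 < v z (F φ m)}) (f2 : PL.few 0 {z | 0 < v z (F φ (m+2))}) :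
    L φ m ∈ PL.cls 0 := by
  have n0 := s.ne m (by omega)
  have n1 := s.ne (m+1) (by omega)
  have n2 := s.ne (m+2) (by omega)
  have l0 := s.lne (m := m) (by omega)
  have l0' := s.lnet (m := m) (by omega)
  have t0 := s.tne (m := m) (by omega)
  have t0' := s.tnet (m := m) (by omega)
  have t1' := s.tnet (m := m+1) (by omega)
  have ht := tq_eq n0 n1
  have ht1 := tq_eq n1 n2
  have ht1' := tq_eq (s.net (m := m+1) (by omega)) (s.net (m := m+2) (by omega))
  have c0 : C c ≠ 0 := by rw [← h]; exact s.Kne (by omega)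
  have eu1 : (L φ (m+1))⁻¹ = (L φ m)⁻¹ / tq φ m := by rw [tq]; field_simp
  have ew1 : (L (til φ) (m+1))⁻¹ = (L (til φ) m)⁻¹ / tq (til φ) m := by rw [tq]; field_simp
  have et : tq φ m = C c * tq (til φ) m := by rw [← h, K]; field_simp
  have ew2 : (L (til φ) (m+1))⁻¹ = ((L φ m)⁻¹ - a) / tq φ m := by
    rw [ew1, et, e1]; field_simp; ring
  have eK : K φ (m+1) * tq (til φ) (m+1) = tq φ (m+1) := by rw [K]; field_simp
  rw [ht1', ht1, ew2, eu1] at eK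
  have K0 := s.Kne (m := m+1) (by omega)
  obtain ⟨KR, KB⟩ := s.K_R (m := m+1) (by omega)
  have K1 : 1 - K φ (m+1) ≠ 0 := by
    intro h1
    have : K φ (m+1) = 1 := by linear_combination -h1
    rw [this, D_one] at hK; exact hK rfl
  have Kfin := s.K_fin (m := m+1) (by omega)
  have KH := s.KH (m := m+1) (by omega)
  have Kt := K_til φ (m+1)
  have Fi : Fin' (L φ m)⁻¹ (tq φ m) := by
    intro t0 τ E T0 a1 a2 a3 a4 a5 a6
    exact inv_mem (s.finish (by omega) f0 a1 a2 a3 a4 a5 a6)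
  set k := K φ (m+1) with hk
  set κ := k / (1 - k) with hκ
  have κB : κ ∈ PL.cls 0 := div_mem KB (sub_mem (one_mem _) KB)
  have hz : PL.few 0 {z | 0 < v z (tq φ m)} := by
    refine (f0.union f2).mono ?_
    intro z hz
    by_contra hc
    have hz : 0 < v z (tq φ m) := hz
    simp only [Set.mem_union, Set.mem_ofPred_eq, not_or, not_lt] at hc
    have e := v_tq n0 n1 n2 z
    by_cases h1 : v z (F φ (m+1)) ≤ 0
    · have := v_tq0 n0 n1 n2 hc.1 h1 hc.2; omega
    · omega
  set u := (L φ m)⁻¹ with hu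
  set t := tq φ m with htt
  have Du : D u = 1 - t := by rw [ht]; ring
  have H2 : (u + κ * a) * D t = (1 + κ * C (1 - c)) * t - 2 * t ^ 2 := by
    have e : D (u / t) + κ * D (a / t) = 1 := by
      have : (u - a) / t = u / t - a / t := by ring
      rw [this, D_sub] at eK
      rw [hκ]; field_simp; linear_combination eK
    rw [D_div _ t0, D_div _ t0, Du, e3] at e
    field_simp at e
    linear_combination -e
  have goal : u ∈ PL.cls 0 := by
    by_cases hc : 1 - c = 0
    · refine odeA (p := κ * a) ?_ Du t0 ?_ hz Fi
      · rw [e2]; exact mul_mem κB (add_mem (mul_mem (Dom.cls_C _ _) (Dom.cls_Z _)) (Dom.cls_C _ _))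
      · rw [H2, hc, map_zero]; ring
    · have c1 : C (1 - c) ≠ 0 := fun h => hc (C_inj (by rw [h, map_zero]))
      have Dκ : D κ = D k / (1 - k) ^ 2 := by
        rw [hκ, D_div _ K1, D_sub, D_one]; ring
      have ebk : κ = (1 + κ * C (1 - c) - 1) / C (1 - c) := by field_simp; ring
      refine odeB (b := 1 + κ * C (1 - c)) (z0 := -d / (1 - c)) ?_ ?_ Du t0 ?_ hz Fi ?_
      · exact add_mem (one_mem _) (mul_mem κB (Dom.cls_C _ _))
      · rw [D_add, D_one, D_mul, D_C, Dκ, mul_zero, add_zero, zero_add]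
        exact mul_ne_zero (div_ne_zero hK (pow_ne_zero 2 K1)) c1
      · rw [← H2, e2, map_div₀, map_neg]; congr 1; field_simp; ring
      · intro hfin
        suffices kR : k ∈ RatF by
          exact add_mem (one_mem _) (mul_mem (div_mem kR (sub_mem (one_mem _) kR)) (RatF_c _))
        have h1 : {z | v z (1 - k) ≠ 0}.Finite := by
          refine (hfin.union Kfin).subset ?_
          intro z hz
          have hz : v z (1 - k) ≠ 0 := hz
          by_contra hc'
          simp only [Set.mem_union, Set.mem_ofPred_eq, not_or, not_lt, not_not] at hc'
          obtain ⟨q1, q2⟩ := hc'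
          have o1 : og z 0 (1 - k) := og_sub (og_one z) (Or.inr q2.ge)
          have o2 := og_v o1 K1
          have o3 : og z 0 κ := by
            rw [ebk, div_eq_mul_inv]
            exact og_mul0 (og_sub (Or.inr q1) (og_one z)) (og_inv0 (v_C z _))
          have κ0 : κ ≠ 0 := div_ne_zero K0 K1
          have o4 := og_v o3 κ0
          rw [hκ, v_div _ K0 K1, q2] at o4
          omega
        have j := (lemR K1 h1 (sub_mem (one_mem _) KH)
          (by rw [til_sub, til_one, Kt]; exact sub_mem (one_mem _) (inv_mem KH))).1
        rw [D_sub, D_one, zero_sub] at j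
        set J := -D k / (1 - k) with hJ
        set G := D k / k with hG
        have e4 : J - G = - (D k / ((1 - k) * k)) := by rw [hJ, hG]; field_simp; ring
        have : k = J / (J - G) := by
          rw [e4, hJ]; field_simp
        rw [this]; exact div_mem j (sub_mem j KR)
  rw [← inv_inv (L φ m)]; exact inv_mem goal

lemma Su.main (s : Su φ N) : L φ 0 ∈ PL.cls 0 := by
  have hN := s.hN
  by_cases hA : ∀ m ≤ 3, D (K φ m) ≠ 0
  · have f : ∀ i ≤ 3, PL.few 0 {z | 0 < v z (F φ (1 + i))} := fun i hi => by
      rw [add_comm]; exact s.F1 (by omega) (hA i hi)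
    exact s.lemB (j := 1) (by omega) (Dom.Aplus (fun i hi => s.ne _ (by omega)) f)
  push Not at hA
  obtain ⟨m, hm, hD⟩ := hA
  obtain ⟨c, hc⟩ := const_of_D hD
  by_cases hD1 : D (K φ (m+1)) = 0
  · obtain ⟨c', hc'⟩ := const_of_D hD1
    exact s.two (m := m) (by omega) hc hc'
  obtain ⟨a, d, e1, e2, e3⟩ := s.Kconst (m := m) (by omega) hc
  by_cases a0 : a = 0
  · have hc1 : 1 - c = 0 := by
      rw [a0, D_zero] at e3; exact C_inj (by rw [← e3, map_zero])
    have hc1 : c = 1 := by linear_combination -hc1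
    apply s.caseA (m := m) (by omega)
    rw [a0, hc1, map_one, one_mul, add_zero] at e1
    exact inv_injective e1
  · exact s.lemB (j := m) (by omega) (s.ode (by omega) hc e1 e2 e3 a0 hD1
      (s.F2 (by omega) e1 e2 a0) (s.F1 (m := m+1) (by omega) hD1))

end Mer
end


open Complex Filter Topology MeasureTheory
open scoped Classical

noncomputable section

namespace Mer

lemma mero_iter {f : ℂ → ℂ} (hf : ∀ z, MeromorphicAt f z) (m : ℕ) :
    ∀ z, MeromorphicAt (iteratedDeriv m f) z := by
  induction m with
  | zero => simpa using hf
  | succ m ih => intro z; rw [iteratedDeriv_succ]; exact (ih z).deriv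

lemma F_mk {f : ℂ → ℂ} (hf : ∀ z, MeromorphicAt f z) (m : ℕ) :
    F (mk f hf) m = mk (iteratedDeriv m f) (mero_iter hf m) := by
  induction m with
  | zero =>
    show mk f hf = _
    refine mk_eq.2 fun z => ?_
    rw [iteratedDeriv_zero]
  | succ m ih =>
    rw [F_succ, ih, D_mk]
    refine mk_eq.2 fun z => ?_
    rw [iteratedDeriv_succ]

lemma L_mk {f : ℂ → ℂ} (hf : ∀ z, MeromorphicAt f z) (m : ℕ) :
    L (mk f hf) m = mk (fun z => iteratedDeriv (m + 1) f z / iteratedDeriv m f z)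
      (fun z => (mero_iter hf (m+1) z).div (mero_iter hf m z)) := by
  rw [L, F_mk, F_mk, mk_div]; rfl

lemma im_inf : {z : ℂ | z.im ≠ 0}.Infinite := by
  refine Set.infinite_of_injective_forall_mem (f := fun n : ℕ => ((n:ℂ) + I)) ?_ ?_
  · intro a b h; simpa using h
  · intro n; simp

lemma Su_of_Setup {M : ℕ} {f : ℂ → ℂ} (hs : Setup M f) : Su (mk f hs.2.1) (M + 3) := by
  obtain ⟨hM, hf, hstr, hfin⟩ := hs
  have mo : ∀ m z, meroOrder (iteratedDeriv m f) z = ord z (F (mk f hf) m) := fun m z => by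
    rw [F_mk, ord_mk, meroOrder, dif_pos (mero_iter hf m z)]
  have ne : ∀ m ≤ M + 3, F (mk f hf) m ≠ 0 := by
    intro m hm h0
    refine im_inf ((hfin m hm).subset fun z hz => ⟨?_, hz⟩)
    rw [mo, h0, ord_zero]; exact WithTop.coe_lt_top _
  refine ⟨by omega, ?_, ne, ?_⟩
  · rintro ⟨c, hc⟩
    have h0 : mk f hf ≠ 0 := ne 0 (by omega)
    have c0 : c ≠ 0 := by
      rintro rfl; rw [map_zero, zero_mul] at hc; exact h0 hc
    have h1 : til (mk f hf) = C c⁻¹ * mk f hf := by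
      conv_rhs => rw [hc]
      rw [← mul_assoc, ← map_mul, inv_mul_cancel₀ c0, map_one, one_mul]
    rw [til_mk, C_def, mk_mul, mk_eq] at h1
    exact hstr ⟨c⁻¹, fun z => h1 z⟩
  · intro m hm
    refine (hfin m hm).subset fun z hz => ⟨?_, hz.2⟩
    rw [mo, ← coe_v z (ne m hm)]
    exact_mod_cast hz.1

lemma prox_eq {h : ℂ → ℂ} (hh : ∀ z, MeromorphicAt h z) {r : ℝ} (hr : 1 ≤ r) :
    proximity h r = PL.mm r (mk h hh) := by
  have hr' : r ∈ PL.rad := by show (1/2:ℝ) ≤ r; linarith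
  rw [Dom.mm_congr hr' (F := h) (fun z _ => rep_mk h hh z)]
  unfold proximity mF Real.circleAverage
  rw [smul_eq_mul]
  congr 1
  refine intervalIntegral.integral_congr fun θ _ => ?_
  simp [logPlus, Real.posLog, circleMap, max_comm]

lemma int_ind {r : ℝ} (hr : 1 ≤ r) (z : ℂ) :
    IntervalIntegrable (fun t : ℝ => (Set.Ici ‖z‖).indicator (fun t => t⁻¹) t) volume 1 r := by
  have h1 : IntervalIntegrable (fun t : ℝ => t⁻¹) volume 1 r := by
    apply ContinuousOn.intervalIntegrable
    intro x hx
    rw [Set.uIcc_of_le hr] at hx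
    exact (continuousAt_inv₀ (by linarith [hx.1])).continuousWithinAt
  rw [intervalIntegrable_iff_integrableOn_Ioc_of_le hr] at h1 ⊢
  exact h1.indicator measurableSet_Ici

lemma int_le_Wt {r : ℝ} (hr : 1 ≤ r) {z : ℂ} (hz : ‖z‖ ≤ r) :
    ∫ t in (1:ℝ)..r, (Set.Ici ‖z‖).indicator (fun t => t⁻¹) t ≤ Wt r z := by
  set a := max ‖z‖ 1 with ha
  have a1 : 1 ≤ a := le_max_right _ _
  have ar : a ≤ r := max_le hz hr
  have hI : IntegrableOn (fun t : ℝ => t⁻¹) (Set.Icc a r) := by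
    apply ContinuousOn.integrableOn_Icc
    intro x hx
    exact (continuousAt_inv₀ (by linarith [hx.1])).continuousWithinAt
  have e1 : ∫ t in (1:ℝ)..r, (Set.Ici ‖z‖).indicator (fun t => t⁻¹) t ≤ Real.log (r / a) := by
    rw [intervalIntegral.integral_of_le hr, setIntegral_indicator measurableSet_Ici,
      ← integral_inv_of_pos (by linarith) (by linarith), intervalIntegral.integral_of_le ar,
      ← integral_Icc_eq_integral_Ioc]
    refine setIntegral_mono_set hI ?_ ?_
    · refine (ae_restrict_iff' measurableSet_Icc).2 (Eventually.of_forall fun x hx => ?_)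
      have : 0 < x := by linarith [hx.1]
      exact (inv_pos.2 this).le
    · refine HasSubset.Subset.eventuallyLE fun x hx => ?_
      exact ⟨max_le hx.2 hx.1.1.le, hx.1.2⟩
  refine e1.trans ?_
  have hp : Real.log (r / a) ≤ Real.posLog (r / a) := le_max_right _ _
  unfold Wt
  split_ifs with h0
  · subst h0
    have : a = 1 := by simp [ha]
    rw [this, div_one] at hp ⊢
    linarith
  · refine hp.trans (Real.posLog_le_posLog (by positivity) ?_)
    have : 0 < ‖z‖ := norm_pos_iff.2 h0
    exact div_le_div_of_nonneg_left (by linarith) this (le_max_left _ _)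

lemma N_le {h : ℂ → ℂ} (hh : ∀ z, MeromorphicAt h z) {r : ℝ} (hr : 1 ≤ r) :
    NCount h r ≤ PL.nn r (mk h hh) := by
  have hr' : r ∈ PL.rad := by show (1/2:ℝ) ≤ r; linarith
  have hpm : ∀ z, (poleMult h z : ℝ) = Dom.pm z (mk h hh) := fun z => by
    rw [poleMult, meroOrder, dif_pos (hh z), Dom.pm, v, ord_mk]
    rw [← Int.toNat_eq_max]; norm_cast
  set S : Finset ℂ := (fin_ball (mk h hh) r).toFinset with hS
  have hSr : ∀ z ∈ S, ‖z‖ ≤ r := fun z hz => by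
    rw [hS, Set.Finite.mem_toFinset] at hz; exact hz.2
  have e : NCount h r = ∫ t in (1:ℝ)..r, ∑ z ∈ S, Dom.pm z (mk h hh) *
      (Set.Ici ‖z‖).indicator (fun t => t⁻¹) t := by
    refine intervalIntegral.integral_congr fun t ht => ?_
    rw [Set.uIcc_of_le hr] at ht
    show poleCount h t / t = _
    unfold poleCount
    rw [finsum_mem_eq_sum_of_inter_support_eq (t := S.filter (fun z => ‖z‖ ≤ t)), Finset.sum_filter,
      div_eq_mul_inv, Finset.sum_mul]
    · refine Finset.sum_congr rfl fun z _ => ?_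
      by_cases hz : ‖z‖ ≤ t
      · simp [Set.indicator, hz, hpm]
      · simp [Set.indicator, hz]
    · ext z
      simp only [Set.mem_inter_iff, Metric.mem_closedBall, dist_zero_right, Function.mem_support,
        Finset.coe_filter, Set.mem_ofPred_eq, hS, Set.Finite.mem_toFinset]
      constructor
      · rintro ⟨h1, h2⟩
        refine ⟨⟨⟨?_, h1.trans ht.2⟩, h1⟩, h2⟩
        intro h3; rw [hpm, Dom.pm, h3] at h2; simp at h2
      · rintro ⟨⟨_, h1⟩, h2⟩
        exact ⟨h1, h2⟩
  rw [e, intervalIntegral.integral_finsetSum (fun z _ => (int_ind hr z).const_mul _)]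
  refine le_trans (Finset.sum_le_sum fun z hz => ?_) (Dom.sum_le_nn hr' (mk h hh) S hSr)
  rw [intervalIntegral.integral_const_mul]
  exact mul_le_mul_of_nonneg_left (int_le_Wt hr (hSr z hz)) (Dom.pm_nonneg _ _)

lemma T_lin {h : ℂ → ℂ} (hh : ∀ z, MeromorphicAt h z) (H : mk h hh ∈ PL.cls 0) :
    ∃ A : ℝ, 0 ≤ A ∧ ∀ r, 1 ≤ r → TChar h r ≤ A * r := by
  obtain ⟨A, hA, H⟩ := Dom.mem_cls.1 H
  refine ⟨A * 3, by positivity, fun r hr => ?_⟩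
  have h1 : TChar h r ≤ PL.tt r (mk h hh) := add_le_add (prox_eq hh hr).le (N_le hh hr)
  have h2 := H r (by show (1/2:ℝ) ≤ r; linarith) (r+1) (by show (1/2:ℝ) ≤ r+1; linarith) (by linarith)
  have h3 : PL.ga 0 r (r+1) = r + 2 := by
    unfold Dom.ga
    show (r + 1) + 1 + |(0:ℝ)| + Real.posLog (1 / (r + 1 - r)) = r + 2
    simp [Real.posLog]; ring
  rw [h3] at h2
  have : A * (r+2) ≤ A * 3 * r := by nlinarith
  exact h1.trans (h2.trans this)

end Mer
end


/-- Lemma 3.7 of the paper: under the Setup there is `α > 0` such that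
`T(r, f^(m+1)/f^(m)) + T(r, g^(m+1)/g^(m)) < α r` for `1 ≤ m ≤ M + 2` and all large `r`. -/
theorem statement_15 (M : ℕ) (f : ℂ → ℂ) (hs : Setup M f) :
    ∃ α : ℝ, 0 < α ∧ ∀ m, 1 ≤ m → m ≤ M + 2 →
      ∀ᶠ r in atTop,
        TChar (fun z => iteratedDeriv (m + 1) f z / iteratedDeriv m f z) r +
          TChar (fun z => iteratedDeriv (m + 1) (mtilde f) z /
            iteratedDeriv m (mtilde f) z) r < α * r := by
  have s := Mer.Su_of_Setup hs
  have hf := hs.2.1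
  have hg : ∀ z, MeromorphicAt (mtilde f) z := fun _ => Mer.mero_mtilde (hf _)
  have key : ∀ m : ℕ, ∃ A : ℝ, 0 ≤ A ∧ (m ≤ M + 2 → ∀ r, 1 ≤ r →
      TChar (fun z => iteratedDeriv (m + 1) f z / iteratedDeriv m f z) r +
          TChar (fun z => iteratedDeriv (m + 1) (mtilde f) z /
            iteratedDeriv m (mtilde f) z) r ≤ A * r) := by
    intro m
    by_cases hm : m ≤ M + 2
    · have h1 := s.up s.main (Nat.zero_le m) (by omega)
      have h2 := Mer.PL_til h1
      rw [← Mer.L_til, Mer.til_mk, Mer.L_mk] at h2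
      rw [Mer.L_mk] at h1
      obtain ⟨A, hA, H⟩ := Mer.T_lin _ h1
      obtain ⟨B, hB, K⟩ := Mer.T_lin _ h2
      refine ⟨A + B, by positivity, fun _ r hr => ?_⟩
      have := H r hr
      have := K r hr
      linarith
    · exact ⟨0, le_rfl, fun h => absurd h hm⟩
  choose A hA H using key
  refine ⟨1 + ∑ m ∈ Finset.range (M + 3), A m, ?_, fun m _ hm => ?_⟩
  · have := Finset.sum_nonneg (s := Finset.range (M + 3)) (fun m _ => hA m)
    linarith
  · filter_upwards [eventually_ge_atTop 1] with r hr
    refine (H m hm r hr).trans_lt ?_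
    have := Finset.single_le_sum (s := Finset.range (M + 3)) (f := A) (fun m _ => hA m)
      (Finset.mem_range.2 (by omega : m < M + 3))
    nlinarith
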